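/- Let 2 < α ≤ 3 and let u ∈ C^∞(S²) be a solution of −Δu + α = e^{2u} on S². Fix y ∈ S², set w = u − u ∘ R_y and suppose w is not identically zero. Then the half-sphere H_y contains at most two simply connected nodal domains of w; i.e. H_y cannot contain three or more pairwise disjoint simply connected connected components of S² \ w^{-1}(0). -/

import Mathlib

open MeasureTheory Real
open scoped RealInnerProductSpace ContDiff

noncomputable section

abbrev E3 : Type := EuclideanSpace ℝ (Fin 3)

/-- The unit sphere `S²` as a subset of `ℝ³`. -/
def S2 : Set E3 := Metric.sphere 0 1

/-- The Euclidean Laplacian of `u : ℝ³ → ℝ`.  For a `0`-homogeneous function it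
coincides on `S²` with the Laplace–Beltrami operator of the round metric applied
to the restriction of `u` to `S²`. -/
def lap (u : E3 → ℝ) (x : E3) : ℝ :=
  ∑ i : Fin 3, iteratedFDeriv ℝ 2 u x ![EuclideanSpace.single i 1, EuclideanSpace.single i 1]

/-- `u : ℝ³ → ℝ` is positively homogeneous of degree `0`, i.e. it is the radial
extension of a function on `S²`. -/
def Hom0 (u : E3 → ℝ) : Prop := ∀ (x : E3) (r : ℝ), 0 < r → u (r • x) = u x

/-- `u` represents a smooth solution of the mean field equation `-Δ_{S²} u + α = e^{2u}`
on `S²`, encoded through its degree-zero homogeneous extension to `ℝ³ \ {0}`. -/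
def MFE (u : E3 → ℝ) (α : ℝ) : Prop :=
  ContDiffOn ℝ ∞ u {(0 : E3)}ᶜ ∧ Hom0 u ∧
    ∀ x ∈ S2, -lap u x + α = Real.exp (2 * u x)

/-- Reflection of `ℝ³` across the plane `{x · y = 0}`. -/
def Refl (y x : E3) : E3 := x - (2 * ⟪x, y⟫) • y

/-- The closed half-sphere `H_y`. -/
def halfSphere (y : E3) : Set E3 := {x ∈ S2 | 0 ≤ ⟪x, y⟫}

/-- The great circle `C_y`. -/
def circleOf (y : E3) : Set E3 := {x ∈ S2 | ⟪x, y⟫ = 0}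

/-- `u` is axially symmetric with respect to `p`: on the sphere it depends only on `x · p`. -/
def AxiallySymmetric (u : E3 → ℝ) (p : E3) : Prop :=
  ∀ x ∈ S2, ∀ y ∈ S2, ⟪x, p⟫ = ⟪y, p⟫ → u x = u y

/-- `p` is an umbilical critical point of `u` (viewed as a function on `S²`):
the (intrinsic) gradient vanishes and the Hessian, as a quadratic form on the
tangent plane `p^⊥`, is a multiple of the metric. -/
def UmbilicalCritical (u : E3 → ℝ) (p : E3) : Prop :=
  fderiv ℝ u p = 0 ∧
    ∃ c : ℝ, ∀ v : E3, ⟪v, p⟫ = 0 → iteratedFDeriv ℝ 2 u p ![v, v] = c * ‖v‖ ^ 2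

/-- `z` is an eigenvector of the Hessian `D²u(q)` viewed as a symmetric bilinear
form on the tangent plane `q^⊥`. -/
def HessEigen (u : E3 → ℝ) (q z : E3) : Prop :=
  ∃ lam : ℝ, ∀ v : E3, ⟪v, q⟫ = 0 → iteratedFDeriv ℝ 2 u q ![z, v] = lam * ⟪z, v⟫

/-- Cross product on `ℝ³`. -/
def cross (a b : E3) : E3 :=
  (WithLp.equiv 2 (Fin 3 → ℝ)).symm
    (crossProduct ((WithLp.equiv 2 (Fin 3 → ℝ)) a) ((WithLp.equiv 2 (Fin 3 → ℝ)) b))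

/-- `Ω` is a nodal domain of `w` on the sphere: a connected component of
`S² \ w⁻¹(0)` (in the subspace topology of `S²`). -/
def IsNodalDomain (w : E3 → ℝ) (Ω : Set E3) : Prop :=
  ∃ x ∈ S2, w x ≠ 0 ∧ Ω = connectedComponentIn {z ∈ S2 | w z ≠ 0} x

end

section RiemannMapping

open Set Metric Filter Topology Complex

/-- The disc automorphism exchanging `a` and `0` up to sign. -/
noncomputable def mob (a z : ℂ) : ℂ := (z - a) / (1 - (starRingEnd ℂ) a * z)

lemma mob_den_ne {a z : ℂ} (ha : ‖a‖ < 1) (hz : ‖z‖ < 1) : 1 - (starRingEnd ℂ) a * z ≠ 0 := by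
  intro h
  have h1 : (starRingEnd ℂ) a * z = 1 := (sub_eq_zero.mp h).symm
  have h2 : ‖a‖ * ‖z‖ = 1 := by
    rw [← Complex.norm_conj a, ← norm_mul, h1, norm_one]
  nlinarith [norm_nonneg a, norm_nonneg z]

lemma normSq_mob_den (a z : ℂ) :
    ‖1 - (starRingEnd ℂ) a * z‖ ^ 2 - ‖z - a‖ ^ 2 = (1 - ‖a‖ ^ 2) * (1 - ‖z‖ ^ 2) := by
  simp only [← Complex.normSq_eq_norm_sq, Complex.normSq_apply]
  simp
  ring

lemma norm_mob_lt {a z : ℂ} (ha : ‖a‖ < 1) (hz : ‖z‖ < 1) : ‖mob a z‖ < 1 := by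
  have h := normSq_mob_den a z
  have hd := mob_den_ne ha hz
  have hd' : 0 < ‖1 - (starRingEnd ℂ) a * z‖ := norm_pos_iff.mpr hd
  rw [mob, norm_div, div_lt_one hd']
  have h1 : 0 < (1 - ‖a‖ ^ 2) * (1 - ‖z‖ ^ 2) := by
    apply mul_pos <;> nlinarith [norm_nonneg a, norm_nonneg z]
  nlinarith [norm_nonneg (z - a)]

lemma hasDerivAt_mob {a z : ℂ} (ha : ‖a‖ < 1) (hz : ‖z‖ < 1) :
    HasDerivAt (mob a) ((1 - (‖a‖ : ℂ) ^ 2) / (1 - (starRingEnd ℂ) a * z) ^ 2) z := by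
  have hd := mob_den_ne ha hz
  have h1 : HasDerivAt (fun z => z - a) 1 z := (hasDerivAt_id z).sub_const a
  have h2 : HasDerivAt (fun z => 1 - (starRingEnd ℂ) a * z) (-((starRingEnd ℂ) a * 1)) z :=
    ((hasDerivAt_id z).const_mul _).const_sub 1
  have := h1.div h2 hd
  refine this.congr_deriv ?_
  congr 1
  have h3 : (starRingEnd ℂ) a * a = (‖a‖ : ℂ) ^ 2 := Complex.conj_mul' a
  linear_combination -h3

lemma mob_neg_mob {a z : ℂ} (ha : ‖a‖ < 1) (hz : ‖z‖ < 1) : mob (-a) (mob a z) = z := by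
  have hd := mob_den_ne ha hz
  have hm := mob_den_ne (a := -a) (by simpa using ha) (norm_mob_lt ha hz)
  rw [mob, div_eq_iff hm, mob]
  have hd' : 1 - z * (starRingEnd ℂ) a ≠ 0 := by rwa [mul_comm]
  simp only [map_neg]
  field_simp
  ring

lemma mob_injOn {a : ℂ} (ha : ‖a‖ < 1) : InjOn (mob a) (ball 0 1) := by
  intro z hz z' hz' h
  rw [mem_ball_zero_iff] at hz hz'
  rw [← mob_neg_mob ha hz, h, mob_neg_mob ha hz']

lemma ball_subset_of_mob_image {a : ℂ} (ha : ‖a‖ < 1) {z : ℂ} (h : mob a z = 0)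
    (hz : ‖z‖ < 1) : z = a := by
  have hd := mob_den_ne ha hz
  rw [mob, div_eq_zero_iff] at h
  rcases h with h | h
  · exact sub_eq_zero.mp h
  · exact absurd h hd

/-- Hurwitz: a limit of nonvanishing functions which vanishes at a point
vanishes near that point. -/
lemma hurwitz {ι : Type*} {l : Filter ι} [l.NeBot] {f : ι → ℂ → ℂ} {g : ℂ → ℂ} {U : Set ℂ}
    (hU : IsOpen U) (hf : ∀ i, DifferentiableOn ℂ (f i) U)
    (hne : ∀ i, ∀ z ∈ U, f i z ≠ 0)
    (hfg : TendstoLocallyUniformlyOn f g l U) {z₀ : ℂ} (hz₀ : z₀ ∈ U) (hg : g z₀ = 0) :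
    ∀ᶠ z in 𝓝 z₀, g z = 0 := by
  have hgd : DifferentiableOn ℂ g U := hfg.differentiableOn (.of_forall hf) hU
  have hga : AnalyticAt ℂ g z₀ := hgd.analyticAt (hU.mem_nhds hz₀)
  rcases hga.eventually_eq_zero_or_eventually_ne_zero with h | h
  · exact h
  exfalso
  obtain ⟨r, hr, hrU⟩ : ∃ r > 0, closedBall z₀ r ⊆ U ∩ {z | z ≠ z₀ → g z ≠ 0} := by
    rw [eventually_nhdsWithin_iff] at h
    exact nhds_basis_closedBall.mem_iff.mp (inter_mem (hU.mem_nhds hz₀) h)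
  have hgc : ContinuousOn g (sphere z₀ r) :=
    hgd.continuousOn.mono fun z hz => (hrU (sphere_subset_closedBall hz)).1
  obtain ⟨x, hx, hxm⟩ := (isCompact_sphere z₀ r).exists_isMinOn
    (NormedSpace.sphere_nonempty.mpr hr.le) hgc.norm
  have hm : 0 < ‖g x‖ := norm_pos_iff.mpr ((hrU (sphere_subset_closedBall hx)).2
    (ne_of_mem_sphere hx hr.ne'))
  have hunif := (tendstoLocallyUniformlyOn_iff_forall_isCompact hU).mp hfg _
    (fun z hz => (hrU hz).1) (isCompact_closedBall z₀ r)
  rw [Metric.tendstoUniformlyOn_iff] at hunif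
  obtain ⟨i, hi⟩ := (hunif (‖g x‖ / 8) (by positivity)).exists
  have h0 : ‖f i z₀‖ < ‖g x‖ / 8 := by
    have := hi z₀ (mem_closedBall_self hr.le)
    rwa [hg, dist_zero_left] at this
  have hsph : ∀ z ∈ sphere z₀ r, ‖g x‖ / 2 ≤ ‖f i z - f i z₀‖ := by
    intro z hz
    have h1 := hi z (sphere_subset_closedBall hz)
    have h2 : ‖g x‖ ≤ ‖g z‖ := hxm hz
    rw [dist_eq_norm] at h1
    have h3 : ‖g z‖ ≤ ‖g z - f i z‖ + ‖f i z - f i z₀‖ + ‖f i z₀‖ := by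
      calc ‖g z‖ = ‖(g z - f i z) + (f i z - f i z₀) + f i z₀‖ := by congr 1; ring
        _ ≤ _ := norm_add₃_le
    linarith
  have hD : DiffContOnCl ℂ (f i) (ball z₀ r) := by
    apply DifferentiableOn.diffContOnCl
    rw [closure_ball z₀ hr.ne']
    exact (hf i).mono fun z hz => (hrU hz).1
  have hfreq : ∃ᶠ z in 𝓝 z₀, f i z ≠ f i z₀ := by
    intro hcon
    simp only [not_not] at hcon
    have ha : AnalyticOnNhd ℂ (f i) (closedBall z₀ r) := fun z hz =>
      (hf i).analyticAt (hU.mem_nhds (hrU hz).1)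
    have := ha.eqOn_of_preconnected_of_eventuallyEq (g := fun _ => f i z₀)
      (fun _ _ => analyticAt_const)
      (convex_closedBall z₀ r).isPreconnected (mem_closedBall_self hr.le) hcon
      (sphere_subset_closedBall hx)
    have h1 := hsph x hx
    rw [this] at h1
    rw [sub_self, norm_zero] at h1
    linarith
  obtain ⟨z, hz, hz0⟩ := hD.ball_subset_image_closedBall hr hsph hfreq
    (show (0 : ℂ) ∈ ball (f i z₀) (‖g x‖ / 2 / 2) by
      rw [mem_ball, dist_zero_left]; linarith)
  exact hne i z (hrU hz).1 hz0

/-- Montel: along any ultrafilter a bounded sequence of holomorphic functions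
converges locally uniformly. -/
lemma montel_ultrafilter {ι : Type*} (l : Ultrafilter ι) {f : ι → ℂ → ℂ} {U : Set ℂ}
    (hU : IsOpen U) (hf : ∀ i, DifferentiableOn ℂ (f i) U)
    (hb : ∀ i, MapsTo (f i) U (ball 0 1)) :
    ∃ g : ℂ → ℂ, TendstoLocallyUniformlyOn f g l U ∧ MapsTo g U (closedBall 0 1) := by
  have hlim : ∀ z ∈ U, ∃ w ∈ closedBall (0 : ℂ) 1, Tendsto (fun i => f i z) l (𝓝 w) := by
    intro z hz
    have := (isCompact_closedBall (0 : ℂ) 1).ultrafilter_le_nhds (l.map fun i => f i z) (by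
      rw [le_principal_iff]
      exact Filter.mem_map.mpr (univ_mem' fun i => ball_subset_closedBall (hb i hz)))
    exact this
  choose! g hg1 hg2 using hlim
  refine ⟨g, ?_, fun z hz => hg1 z hz⟩
  rw [Metric.tendstoLocallyUniformlyOn_iff]
  intro ε hε z₀ hz₀
  obtain ⟨R, hR, hRU⟩ := Metric.isOpen_iff.mp hU z₀ hz₀
  have hlip : ∀ i, ∀ z ∈ ball z₀ R, dist (f i z) (f i z₀) ≤ 2 / R * dist z z₀ := by
    intro i z hz
    apply dist_le_div_mul_dist_of_mapsTo_ball ((hf i).mono hRU) _ hz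
    intro w hw
    have h1 := hb i (hRU hw)
    have h2 := hb i hz₀
    rw [mem_ball_zero_iff] at h1 h2
    rw [mem_closedBall, dist_eq_norm]
    exact (norm_sub_le _ _).trans (by linarith)
  have hglip : ∀ z ∈ ball z₀ R, dist (g z) (g z₀) ≤ 2 / R * dist z z₀ := by
    intro z hz
    exact le_of_tendsto ((hg2 z (hRU hz)).dist (hg2 z₀ hz₀)) (.of_forall fun i => hlip i z hz)
  set δ := min R (ε * R / 8) with hδ
  have hδ0 : 0 < δ := by positivity
  refine ⟨ball z₀ δ, mem_nhdsWithin_of_mem_nhds (ball_mem_nhds z₀ hδ0), ?_⟩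
  have h3 := (Metric.tendsto_nhds.mp (hg2 z₀ hz₀)) (ε / 4) (by positivity)
  filter_upwards [h3] with i hi z hz
  have hzR : z ∈ ball z₀ R := ball_subset_ball (min_le_left _ _) hz
  have hzd : 2 / R * dist z z₀ ≤ ε / 4 := by
    have : dist z z₀ ≤ ε * R / 8 := (mem_ball.mp hz).le.trans (min_le_right _ _)
    calc 2 / R * dist z z₀ ≤ 2 / R * (ε * R / 8) := by gcongr
      _ = ε / 4 := by field_simp; ring
  calc dist (g z) (f i z) ≤ dist (g z) (g z₀) + dist (g z₀) (f i z₀) + dist (f i z₀) (f i z) :=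
        dist_triangle4 _ _ _ _
    _ < ε := by
      rw [dist_comm (g z₀), dist_comm (f i z₀) (f i z)]
      have := hlip i z hzR
      have := hglip z hzR
      linarith

structure IsSchlicht (Ω : Set ℂ) (p : ℂ) (g : ℂ → ℂ) : Prop where
  diff : DifferentiableOn ℂ g Ω
  maps : MapsTo g Ω (ball 0 1)
  inj : InjOn g Ω
  dne : ∀ z ∈ Ω, deriv g z ≠ 0
  zero : g p = 0

lemma exists_schlicht {Ω : Set ℂ} (hb : Bornology.IsBounded Ω) (p : ℂ) :
    ∃ g, IsSchlicht Ω p g := by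
  obtain ⟨R, hR, hRΩ⟩ := hb.subset_ball_lt 0 p
  have hR' : (R : ℂ) ≠ 0 := by exact_mod_cast hR.ne'
  have hd : ∀ z, HasDerivAt (fun z => (z - p) / (R : ℂ)) (1 / R) z := fun z =>
    ((hasDerivAt_id z).sub_const p).div_const _
  refine ⟨fun z => (z - p) / R, ⟨fun z _ => (hd z).differentiableAt.differentiableWithinAt,
    fun z hz => ?_, fun z _ z' _ h => ?_, fun z _ => ?_, by simp⟩⟩
  · rw [mem_ball_zero_iff, norm_div, Complex.norm_real, Real.norm_of_nonneg hR.le, div_lt_one hR]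
    simpa [dist_eq_norm] using hRΩ hz
  · simpa [hR', sub_left_inj, div_left_inj'] using h
  · rw [(hd z).deriv]
    simp [hR']

lemma schlicht_improve {Ω : Set ℂ} (hΩ : IsOpen Ω) (hsc : IsSimplyConnected Ω) {p : ℂ}
    (hp : p ∈ Ω) {g : ℂ → ℂ} (hg : IsSchlicht Ω p g) {c : ℂ} (hc : ‖c‖ < 1)
    (hcg : c ∉ g '' Ω) : ∃ H, IsSchlicht Ω p H ∧ ‖deriv g p‖ < ‖deriv H p‖ := by
  have hc0 : c ≠ 0 := fun h => hcg (h ▸ ⟨p, hp, hg.zero⟩)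
  have hgz : ∀ z ∈ Ω, ‖g z‖ < 1 := fun z hz => mem_ball_zero_iff.mp (hg.maps hz)
  have hgd : ∀ z ∈ Ω, HasDerivAt g (deriv g z) z := fun z hz =>
    ((hg.diff z hz).differentiableAt (hΩ.mem_nhds hz)).hasDerivAt
  set ψ : ℂ → ℂ := fun z => mob c (g z) with hψ
  have hψd : ∀ z ∈ Ω, HasDerivAt ψ ((1 - (‖c‖ : ℂ) ^ 2) / (1 - (starRingEnd ℂ) c * g z) ^ 2 *
      deriv g z) z := fun z hz => (hasDerivAt_mob hc (hgz z hz)).comp z (hgd z hz)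
  have hψ0 : ∀ z ∈ Ω, ψ z ≠ 0 := fun z hz h =>
    hcg ⟨z, hz, ball_subset_of_mob_image hc h (hgz z hz)⟩
  have hψ1 : ∀ z ∈ Ω, ‖ψ z‖ < 1 := fun z hz => norm_mob_lt hc (hgz z hz)
  obtain ⟨h, hhc, hh⟩ := exists_continuousOn_pow_eq hsc hΩ
    (fun z hz => (hψd z hz).continuousAt.continuousWithinAt : ContinuousOn ψ Ω)
    (by rintro ⟨z, hz, h⟩; exact hψ0 z hz h) two_ne_zero
  have hh0 : ∀ z ∈ Ω, h z ≠ 0 := fun z hz h0 => hψ0 z hz (by rw [← hh z, h0]; simp)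
  have hh1 : ∀ z ∈ Ω, ‖h z‖ < 1 := fun z hz => by
    have := hψ1 z hz
    rw [← hh z, norm_pow] at this
    exact lt_of_pow_lt_pow_left₀ 2 zero_le_one (by simpa using this)
  set s := h p with hs
  have hs1 : ‖s‖ < 1 := hh1 p hp
  have hs2 : s ^ 2 = -c := by
    rw [hs, hh p, hψ]; simp [mob, hg.zero]
  have hs0 : 0 < ‖s‖ := norm_pos_iff.mpr (hh0 p hp)
  have hhd : ∀ z ∈ Ω, HasDerivAt h ((2 * h z)⁻¹ * ((1 - (‖c‖ : ℂ) ^ 2) /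
      (1 - (starRingEnd ℂ) c * g z) ^ 2 * deriv g z)) z := by
    intro z hz
    have h1 : HasDerivAt (fun w : ℂ => w ^ 2) (2 * h z) (h z) := by
      simpa using hasDerivAt_pow 2 (h z)
    have hne : 2 * h z ≠ 0 := mul_ne_zero two_ne_zero (hh0 z hz)
    have h2 := (hhc.continuousAt (hΩ.mem_nhds hz))
    have h3 : HasStrictDerivAt (fun w : ℂ => w ^ 2) (2 * h z) (h z) := by
      simpa using hasStrictDerivAt_pow 2 (h z)
    set inv := h3.localInverse _ _ _ hne
    have h4 : ∀ᶠ w in 𝓝 z, inv (ψ w) = h w := by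
      have := h3.eventually_left_inverse hne
      filter_upwards [h2.eventually this] with w hw
      rw [← hw, hh w]
    have h5 : HasDerivAt inv (2 * h z)⁻¹ (ψ z) := by
      have := (h3.to_localInverse hne).hasDerivAt
      rwa [hh z] at this
    exact (h5.comp z (hψd z hz)).congr_of_eventuallyEq (h4.mono fun w hw => hw.symm)
  have hc2 : (1 - (‖c‖ : ℂ) ^ 2) ≠ 0 := by
    norm_cast
    nlinarith [norm_nonneg c]
  have hs2' : (1 - (‖s‖ : ℂ) ^ 2) ≠ 0 := by
    norm_cast
    nlinarith [norm_nonneg s]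
  have hHd : ∀ z ∈ Ω, HasDerivAt (fun z => mob s (h z)) ((1 - (‖s‖ : ℂ) ^ 2) /
      (1 - (starRingEnd ℂ) s * h z) ^ 2 * ((2 * h z)⁻¹ * ((1 - (‖c‖ : ℂ) ^ 2) /
      (1 - (starRingEnd ℂ) c * g z) ^ 2 * deriv g z))) z := fun z hz =>
    (hasDerivAt_mob hs1 (hh1 z hz)).comp z (hhd z hz)
  refine ⟨fun z => mob s (h z), ⟨fun z hz => (hHd z hz).differentiableAt.differentiableWithinAt,
    fun z hz => mem_ball_zero_iff.mpr (norm_mob_lt hs1 (hh1 z hz)), ?_, ?_, ?_⟩, ?_⟩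
  · intro z hz z' hz' heq
    have h1 := mob_injOn hs1 (mem_ball_zero_iff.mpr (hh1 z hz))
      (mem_ball_zero_iff.mpr (hh1 z' hz')) heq
    have h2 : ψ z = ψ z' := by rw [← hh z, ← hh z', h1]
    have h3 := mob_injOn hc (hg.maps hz) (hg.maps hz') h2
    exact hg.inj hz hz' h3
  · intro z hz
    rw [(hHd z hz).deriv]
    have := mob_den_ne hs1 (hh1 z hz)
    have := mob_den_ne hc (hgz z hz)
    have := hh0 z hz
    have := hg.dne z hz
    refine mul_ne_zero (div_ne_zero hs2' (pow_ne_zero _ ‹_›)) (mul_ne_zero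
      (inv_ne_zero (mul_ne_zero two_ne_zero ‹_›)) (mul_ne_zero
      (div_ne_zero hc2 (pow_ne_zero _ ‹_›)) ‹_›))
  · simp [mob, ← hs]
  · rw [(hHd p hp).deriv, ← hs, hg.zero]
    have hcs : ‖c‖ = ‖s‖ ^ 2 := by rw [← norm_pow, hs2, norm_neg]
    have e1 : (1 - (starRingEnd ℂ) s * s) = 1 - (‖s‖ : ℂ) ^ 2 := by rw [Complex.conj_mul']
    have e2 : ‖(1 - (‖s‖ : ℂ) ^ 2)‖ = 1 - ‖s‖ ^ 2 := by
      rw [show (1 - (‖s‖ : ℂ) ^ 2) = ((1 - ‖s‖ ^ 2 : ℝ) : ℂ) by push_cast; ring,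
        Complex.norm_real, Real.norm_of_nonneg]
      nlinarith [norm_nonneg s]
    have e3 : ‖(1 - (‖c‖ : ℂ) ^ 2)‖ = 1 - ‖s‖ ^ 4 := by
      rw [show (1 - (‖c‖ : ℂ) ^ 2) = ((1 - ‖c‖ ^ 2 : ℝ) : ℂ) by push_cast; ring,
        Complex.norm_real, Real.norm_of_nonneg, hcs]
      · ring
      · nlinarith [norm_nonneg c]
    rw [e1]
    simp only [norm_mul, norm_div, norm_inv, norm_pow, e2, e3, mul_zero, sub_zero,
      one_pow, div_one, Complex.norm_ofNat]
    have hpos : 0 < ‖deriv g p‖ := norm_pos_iff.mpr (hg.dne p hp)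
    have h1 : 0 < 1 - ‖s‖ ^ 2 := by nlinarith
    have : (1 - ‖s‖ ^ 2) / (1 - ‖s‖ ^ 2) ^ 2 * ((2 * ‖s‖)⁻¹ * ((1 - ‖s‖ ^ 4) * ‖deriv g p‖))
        = ((1 + ‖s‖ ^ 2) / (2 * ‖s‖)) * ‖deriv g p‖ := by
      field_simp
      ring
    rw [this]
    have h2 : 1 < (1 + ‖s‖ ^ 2) / (2 * ‖s‖) := by
      rw [one_lt_div (by positivity)]
      nlinarith
    nlinarith

lemma exists_schlicht_extremal {Ω : Set ℂ} (hΩ : IsOpen Ω) (hconn : IsPreconnected Ω)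
    (hb : Bornology.IsBounded Ω) {p : ℂ} (hp : p ∈ Ω) :
    ∃ g, IsSchlicht Ω p g ∧ ∀ h, IsSchlicht Ω p h → ‖deriv h p‖ ≤ ‖deriv g p‖ := by
  obtain ⟨g₀, hg₀⟩ := exists_schlicht hb p
  obtain ⟨R, hR, hRΩ⟩ := Metric.isOpen_iff.mp hΩ p hp
  set S := {x : ℝ | ∃ h, IsSchlicht Ω p h ∧ x = ‖deriv h p‖} with hS
  have hSb : BddAbove S := by
    refine ⟨1 / R, ?_⟩
    rintro _ ⟨h, hh, rfl⟩
    refine norm_deriv_le_div_of_mapsTo_ball (hh.diff.mono hRΩ) ?_ hR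
    rw [hh.zero]
    exact fun z hz => ball_subset_closedBall (hh.maps (hRΩ hz))
  have hSne : S.Nonempty := ⟨_, g₀, hg₀, rfl⟩
  obtain ⟨x, -, hx, hxS⟩ := exists_seq_tendsto_sSup hSne hSb
  choose f hf hfx using hxS
  set l : Ultrafilter ℕ := hyperfilter ℕ
  have hl : (l : Filter ℕ) ≤ atTop := Nat.hyperfilter_le_atTop
  obtain ⟨g, hg, hgm⟩ := montel_ultrafilter l hΩ (fun i => (hf i).diff) (fun i => (hf i).maps)
  have hgd : DifferentiableOn ℂ g Ω := hg.differentiableOn (.of_forall fun i => (hf i).diff) hΩ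
  have hgdat : ∀ z ∈ Ω, DifferentiableAt ℂ g z := fun z hz =>
    (hgd z hz).differentiableAt (hΩ.mem_nhds hz)
  have hga : AnalyticOnNhd ℂ g Ω := hgd.analyticOnNhd hΩ
  have hder := hg.deriv (.of_forall fun i => (hf i).diff) hΩ
  have hdp : ‖deriv g p‖ = sSup S := by
    have h1 := (hder.tendsto_at hp).norm
    have h2 := hx.mono_left hl
    refine tendsto_nhds_unique h1 (h2.congr fun i => ?_)
    rw [hfx i]; rfl
  have hdpos : 0 < ‖deriv g p‖ := by
    rw [hdp]
    exact (norm_pos_iff.mpr (hg₀.dne p hp)).trans_le (le_csSup hSb ⟨g₀, hg₀, rfl⟩)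
  have hdga : AnalyticOnNhd ℂ (deriv g) Ω := hga.deriv
  have hdnz : ∀ z ∈ Ω, ¬ ∀ᶠ w in 𝓝 z, deriv g w = 0 := by
    intro z hz h
    have := hdga.eqOn_zero_of_preconnected_of_eventuallyEq_zero hconn hz h hp
    rw [this] at hdpos
    simp at hdpos
  refine ⟨g, ⟨hgd, ?_, ?_, ?_, ?_⟩, ?_⟩
  · intro z hz
    by_contra hcon
    have hz1 : ‖g z‖ = 1 := le_antisymm (by simpa using hgm hz) (by simpa using hcon)
    have hmax : IsMaxOn (norm ∘ g) Ω z := fun w hw => by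
      have : ‖g w‖ ≤ 1 := by simpa using hgm hw
      simpa [hz1] using this
    have := Complex.eqOn_of_isPreconnected_of_isMaxOn_norm hconn hΩ hgd hz hmax
    apply hdnz z hz
    filter_upwards [hΩ.mem_nhds hz] with w hw
    have : g =ᶠ[𝓝 w] fun _ => g z := by
      filter_upwards [hΩ.mem_nhds hw] with w' hw' using this hw'
    rw [this.deriv_eq]; simp
  · intro a ha b hbΩ hab
    by_contra hne
    obtain ⟨r, hr, hrΩ⟩ := Metric.isOpen_iff.mp (hΩ.sdiff isClosed_singleton : IsOpen (Ω \ {b})) a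
      ⟨ha, hne⟩
    have hbt : TendstoLocallyUniformlyOn (fun i z => f i z - f i b) (fun z => g z - g b) l
        (ball a r) := by
      have h1 := hg.mono (hrΩ.trans sdiff_subset)
      rw [Metric.tendstoLocallyUniformlyOn_iff] at h1 ⊢
      intro ε hε z hz
      obtain ⟨t, ht, ht'⟩ := h1 (ε / 2) (by positivity) z hz
      refine ⟨t, ht, ?_⟩
      have h2 := (Metric.tendsto_nhds.mp (hg.tendsto_at hbΩ)) (ε / 2) (by positivity)
      filter_upwards [ht', h2] with i hi hi2 w hw
      have h3 := hi w hw
      calc dist (g w - g b) (f i w - f i b) ≤ dist (g w) (f i w) + dist (g b) (f i b) :=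
            dist_sub_sub_le _ _ _ _
        _ < ε := by rw [dist_comm (g b)]; linarith
    have := hurwitz isOpen_ball
      (fun i => ((hf i).diff.mono (hrΩ.trans sdiff_subset)).sub_const (f i b))
      (fun i z hz h => (hrΩ hz).2 ((hf i).inj (hrΩ hz).1 hbΩ (sub_eq_zero.mp h))) hbt
      (mem_ball_self hr) (by rw [hab, sub_self])
    apply hdnz a ha
    rw [← eventually_eventually_nhds] at this
    filter_upwards [this] with w hw
    have : g =ᶠ[𝓝 w] fun _ => g b := by
      filter_upwards [hw] with w' hw' using sub_eq_zero.mp hw'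
    rw [this.deriv_eq]; simp
  · intro z hz h
    exact hdnz z hz (hurwitz hΩ (fun i => (hf i).diff.deriv hΩ) (fun i w hw => (hf i).dne w hw)
      hder hz h)
  · have h1 := hg.tendsto_at hp
    refine tendsto_nhds_unique h1 ?_
    simp [(hf _).zero]
  · intro h hh
    rw [hdp]
    exact le_csSup hSb ⟨h, hh, rfl⟩

/-- Riemann mapping theorem for bounded domains. -/
theorem riemann_mapping {Ω : Set ℂ} (hΩ : IsOpen Ω) (hsc : IsSimplyConnected Ω)
    (hb : Bornology.IsBounded Ω) :
    ∃ F : ℂ → ℂ, DifferentiableOn ℂ F (ball 0 1) ∧ InjOn F (ball 0 1) ∧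
      F '' ball 0 1 = Ω ∧ ∀ z ∈ ball (0 : ℂ) 1, deriv F z ≠ 0 := by
  obtain ⟨p, hp⟩ := hsc.nonempty
  obtain ⟨g, hg, hmax⟩ := exists_schlicht_extremal hΩ
    hsc.isPathConnected.isConnected.isPreconnected hb hp
  have hsurj : g '' Ω = ball 0 1 := by
    refine Subset.antisymm hg.maps.image_subset fun c hc => ?_
    by_contra hcon
    obtain ⟨H, hH, hlt⟩ := schlicht_improve hΩ hsc hp hg (mem_ball_zero_iff.mp hc) hcon
    exact absurd (hmax H hH) (not_le.mpr hlt)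
  set F := Function.invFunOn g Ω with hF
  have hFmem : ∀ w ∈ ball (0 : ℂ) 1, F w ∈ Ω ∧ g (F w) = w := fun w hw => by
    rw [← hsurj] at hw
    exact ⟨Function.invFunOn_mem hw, Function.invFunOn_eq hw⟩
  have hFg : ∀ z ∈ Ω, F (g z) = z := fun z hz => hg.inj.leftInvOn_invFunOn hz
  have hFd : ∀ w ∈ ball (0 : ℂ) 1, HasDerivAt F (deriv g (F w))⁻¹ w := by
    intro w hw
    obtain ⟨hm, he⟩ := hFmem w hw
    have hsd : HasStrictDerivAt g (deriv g (F w)) (F w) :=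
      ((hg.diff.analyticAt (hΩ.mem_nhds hm))).hasStrictDerivAt
    have hne := hg.dne _ hm
    set inv := hsd.localInverse _ _ _ hne
    have h5 : HasDerivAt inv (deriv g (F w))⁻¹ w := by
      have := (hsd.to_localInverse hne).hasDerivAt
      rwa [he] at this
    refine h5.congr_of_eventuallyEq ?_
    have h6 : ∀ᶠ z in 𝓝 (F w), F (g z) = inv (g z) := by
      filter_upwards [hsd.eventually_left_inverse hne, hΩ.mem_nhds hm] with z hz hzΩ
      rw [hFg z hzΩ]; exact hz.symm
    have h7 := hsd.map_nhds_eq hne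
    rw [he] at h7
    change ∀ᶠ x in 𝓝 w, F x = inv x
    rw [← h7]
    exact h6
  refine ⟨F, fun w hw => (hFd w hw).differentiableAt.differentiableWithinAt, ?_, ?_, ?_⟩
  · intro w hw w' hw' h
    rw [← (hFmem w hw).2, h, (hFmem w' hw').2]
  · refine Subset.antisymm ?_ fun z hz => ⟨g z, hg.maps hz, hFg z hz⟩
    rintro _ ⟨w, hw, rfl⟩
    exact (hFmem w hw).1
  · intro w hw
    rw [(hFd w hw).deriv]
    exact inv_ne_zero (hg.dne _ (hFmem w hw).1)

end RiemannMapping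

section PartialDerivatives

open Filter Topology

variable {E : Type*} [NormedAddCommGroup E] [NormedSpace ℝ E]

/-- Directional derivative of `f` at `z` in the direction `v`. -/
noncomputable def pd (v : E) (f : E → ℝ) (z : E) : ℝ := fderiv ℝ f z v

/-- Smoothness in a neighbourhood of a point. -/
def SmAt (f : E → ℝ) (z : E) : Prop := ∀ᶠ w in 𝓝 z, ContDiffAt ℝ ∞ f w

lemma SmAt.cd {f : E → ℝ} {z : E} (h : SmAt f z) : ContDiffAt ℝ ∞ f z := h.self_of_nhds

lemma SmAt.continuousAt {f : E → ℝ} {z : E} (h : SmAt f z) : ContinuousAt f z := h.cd.continuousAt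

lemma SmAt.const (c : ℝ) (z : E) : SmAt (fun _ => c) z := .of_forall fun _ => contDiffAt_const

lemma SmAt.add {f g : E → ℝ} {z : E} (hf : SmAt f z) (hg : SmAt g z) :
    SmAt (fun z => f z + g z) z := (hf.and hg).mono fun _ h => h.1.add h.2

lemma SmAt.sub {f g : E → ℝ} {z : E} (hf : SmAt f z) (hg : SmAt g z) :
    SmAt (fun z => f z - g z) z := (hf.and hg).mono fun _ h => h.1.sub h.2

lemma SmAt.mul {f g : E → ℝ} {z : E} (hf : SmAt f z) (hg : SmAt g z) :
    SmAt (fun z => f z * g z) z := (hf.and hg).mono fun _ h => h.1.mul h.2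

lemma SmAt.pow {f : E → ℝ} {z : E} (hf : SmAt f z) (n : ℕ) :
    SmAt (fun z => f z ^ n) z := hf.mono fun _ h => h.pow n

lemma SmAt.exp {f : E → ℝ} {z : E} (hf : SmAt f z) :
    SmAt (fun z => exp (f z)) z := hf.mono fun _ h => h.exp

lemma SmAt.log {f : E → ℝ} {z : E} (hf : SmAt f z) (h : f z ≠ 0) :
    SmAt (fun z => log (f z)) z :=
  (hf.and (hf.continuousAt.eventually_ne h)).mono fun _ h => h.1.log h.2

lemma SmAt.inv {f : E → ℝ} {z : E} (hf : SmAt f z) (h : f z ≠ 0) :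
    SmAt (fun z => (f z)⁻¹) z :=
  (hf.and (hf.continuousAt.eventually_ne h)).mono fun _ h => h.1.inv h.2

lemma SmAt.congr {f g : E → ℝ} {z : E} (hf : SmAt f z) (h : g =ᶠ[𝓝 z] f) : SmAt g z :=
  (hf.and (eventually_eventually_nhds.mpr h)).mono fun _ h => h.1.congr_of_eventuallyEq h.2

lemma SmAt.diff {f : E → ℝ} {z : E} (h : SmAt f z) : DifferentiableAt ℝ f z :=
  h.cd.differentiableAt (by simp)

lemma SmAt.ev {f : E → ℝ} {z : E} (h : SmAt f z) : ∀ᶠ w in 𝓝 z, SmAt f w :=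
  eventually_eventually_nhds.mpr h

lemma SmAt.pd {f : E → ℝ} {z : E} (h : SmAt f z) (v : E) : SmAt (pd v f) z :=
  h.mono fun _ h => (ContDiffAt.fderiv_right h (m := ∞) (by simp)).clm_apply contDiffAt_const

lemma pd_congr {f g : E → ℝ} {z : E} (v : E) (h : f =ᶠ[𝓝 z] g) : pd v f z = pd v g z := by
  simp only [pd, h.fderiv_eq]

lemma pd_congr' {f g : E → ℝ} {z : E} (v : E) (h : f =ᶠ[𝓝 z] g) : pd v f =ᶠ[𝓝 z] pd v g := by
  have h' := eventually_eventually_nhds.mpr h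
  filter_upwards [h'] with w hw using pd_congr v hw

lemma pd_const (v : E) (c : ℝ) (z : E) : pd v (fun _ => c) z = 0 := by
  simp [pd]

lemma pd_add {f g : E → ℝ} {z : E} (v : E) (hf : DifferentiableAt ℝ f z)
    (hg : DifferentiableAt ℝ g z) : pd v (fun z => f z + g z) z = pd v f z + pd v g z := by
  simp only [pd]
  rw [fderiv_fun_add hf hg]; rfl

lemma pd_sub {f g : E → ℝ} {z : E} (v : E) (hf : DifferentiableAt ℝ f z)
    (hg : DifferentiableAt ℝ g z) : pd v (fun z => f z - g z) z = pd v f z - pd v g z := by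
  simp only [pd]
  rw [fderiv_fun_sub hf hg]; rfl

lemma pd_mul {f g : E → ℝ} {z : E} (v : E) (hf : DifferentiableAt ℝ f z)
    (hg : DifferentiableAt ℝ g z) :
    pd v (fun z => f z * g z) z = pd v f z * g z + f z * pd v g z := by
  simp only [pd]
  rw [fderiv_fun_mul hf hg]
  simp
  ring

lemma pd_const_mul {f : E → ℝ} {z : E} (v : E) (c : ℝ) (hf : DifferentiableAt ℝ f z) :
    pd v (fun z => c * f z) z = c * pd v f z := by
  rw [pd_mul v (differentiableAt_const c) hf, pd_const]; ring

lemma pd_comp {f : E → ℝ} {z : E} (v : E) {φ : ℝ → ℝ} {φ' : ℝ} (hφ : HasDerivAt φ φ' (f z))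
    (hf : DifferentiableAt ℝ f z) : pd v (fun z => φ (f z)) z = φ' * pd v f z := by
  simp only [pd]
  have := hφ.comp_hasFDerivAt z hf.hasFDerivAt
  rw [show (fun z => φ (f z)) = φ ∘ f from rfl, this.fderiv]; rfl

lemma pd_exp {f : E → ℝ} {z : E} (v : E) (hf : DifferentiableAt ℝ f z) :
    pd v (fun z => exp (f z)) z = exp (f z) * pd v f z :=
  pd_comp v (Real.hasDerivAt_exp _) hf

lemma pd_log {f : E → ℝ} {z : E} (v : E) (hf : DifferentiableAt ℝ f z) (h : f z ≠ 0) :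
    pd v (fun z => log (f z)) z = pd v f z / f z := by
  rw [pd_comp v (Real.hasDerivAt_log h) hf]; ring

lemma pd_inv {f : E → ℝ} {z : E} (v : E) (hf : DifferentiableAt ℝ f z) (h : f z ≠ 0) :
    pd v (fun z => (f z)⁻¹) z = - pd v f z / f z ^ 2 := by
  rw [pd_comp v (hasDerivAt_inv h) hf]; ring

lemma pd_sq {f : E → ℝ} {z : E} (v : E) (hf : DifferentiableAt ℝ f z) :
    pd v (fun z => f z ^ 2) z = 2 * f z * pd v f z := by
  rw [pd_comp v (φ := fun x => x ^ 2) (by simpa using hasDerivAt_pow 2 (f z)) hf]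

lemma pd_pd {f : E → ℝ} {z : E} (v w : E) (h : SmAt f z) :
    pd v (pd w f) z = fderiv ℝ (fderiv ℝ f) z v w := by
  have : ContDiffAt ℝ ∞ (fderiv ℝ f) z := ContDiffAt.fderiv_right h.cd (m := ∞) (by simp)
  have h2 : DifferentiableAt ℝ (fderiv ℝ f) z := this.differentiableAt (by simp)
  simp only [pd]
  change fderiv ℝ (fun z => fderiv ℝ f z w) z v = _
  rw [fderiv_clm_apply h2 (differentiableAt_const w)]
  simp

lemma pd_symm {f : E → ℝ} {z : E} (v w : E) (h : SmAt f z) :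
    pd v (pd w f) z = pd w (pd v f) z := by
  rw [pd_pd v w h, pd_pd w v h]
  have h2 : IsSymmSndFDerivAt ℝ f z := ContDiffAt.isSymmSndFDerivAt h.cd (by
    simp only [minSmoothness_of_isRCLikeNormedField]; exact WithTop.coe_le_coe.mpr le_top)
  exact h2 v w

end PartialDerivatives

section Laplacian

open Filter Topology

/-- The Laplacian on the plane. -/
noncomputable def lap2 (f : ℂ → ℝ) (z : ℂ) : ℝ :=
  pd 1 (pd 1 f) z + pd Complex.I (pd Complex.I f) z

lemma lap2_add {f g : ℂ → ℝ} {z : ℂ} (hf : SmAt f z) (hg : SmAt g z) :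
    lap2 (fun z => f z + g z) z = lap2 f z + lap2 g z := by
  have key : ∀ v, pd v (pd v (fun z => f z + g z)) z = pd v (pd v f) z + pd v (pd v g) z := by
    intro v
    rw [← pd_add v (hf.pd v).diff (hg.pd v).diff]
    apply pd_congr
    filter_upwards [hf.ev, hg.ev] with w h1 h2 using pd_add v h1.diff h2.diff
  rw [lap2, key, key, lap2, lap2]; ring

lemma lap2_const_mul {f : ℂ → ℝ} {z : ℂ} (c : ℝ) (hf : SmAt f z) :
    lap2 (fun z => c * f z) z = c * lap2 f z := by
  have key : ∀ v, pd v (pd v (fun z => c * f z)) z = c * pd v (pd v f) z := by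
    intro v
    rw [← pd_const_mul v c (hf.pd v).diff]
    apply pd_congr
    filter_upwards [hf.ev] with w h1 using pd_const_mul v c h1.diff
  rw [lap2, key, key, lap2]; ring

lemma lap2_sub {f g : ℂ → ℝ} {z : ℂ} (hf : SmAt f z) (hg : SmAt g z) :
    lap2 (fun z => f z - g z) z = lap2 f z - lap2 g z := by
  have h1 : (fun z => f z - g z) = fun z => f z + (-1) * g z := by ext; ring
  rw [h1, lap2_add hf ((SmAt.const _ _).mul hg), lap2_const_mul _ hg]; ring

lemma SmAt.lap2 {f : ℂ → ℝ} {z : ℂ} (hf : SmAt f z) : SmAt (lap2 f) z :=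
  ((hf.pd _).pd _).add ((hf.pd _).pd _)

lemma pd_lap2 {f : ℂ → ℝ} {z : ℂ} (hf : SmAt f z) (v : ℂ) :
    pd v (lap2 f) z = lap2 (pd v f) z := by
  have key : ∀ w, pd v (pd w (pd w f)) z = pd w (pd w (pd v f)) z := by
    intro w
    rw [pd_symm v w (hf.pd w)]
    apply pd_congr
    filter_upwards [hf.ev] with x hx using pd_symm v w hx
  have : lap2 f = fun z => pd 1 (pd 1 f) z + pd Complex.I (pd Complex.I f) z := rfl
  rw [this, pd_add v ((hf.pd _).pd _).diff ((hf.pd _).pd _).diff, key, key]; rfl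

lemma lap2_log {f : ℂ → ℝ} {z : ℂ} (hf : SmAt f z) (h : f z ≠ 0) :
    lap2 (fun z => log (f z)) z =
      (f z * lap2 f z - (pd 1 f z ^ 2 + pd Complex.I f z ^ 2)) / f z ^ 2 := by
  have key : ∀ v, pd v (pd v (fun z => log (f z))) z =
      (f z * pd v (pd v f) z - pd v f z ^ 2) / f z ^ 2 := by
    intro v
    have h1 : pd v (fun z => log (f z)) =ᶠ[𝓝 z] fun z => pd v f z * (f z)⁻¹ := by
      filter_upwards [hf.ev, hf.continuousAt.eventually_ne h] with w h1 h2
      rw [pd_log v h1.diff h2]; rfl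
    rw [pd_congr v h1, pd_mul v (hf.pd v).diff (hf.inv h).diff, pd_inv v hf.diff h]
    field_simp
    ring
  rw [lap2, key, key, lap2]; ring

lemma lap2_mul {f g : ℂ → ℝ} {z : ℂ} (hf : SmAt f z) (hg : SmAt g z) :
    lap2 (fun z => f z * g z) z = lap2 f z * g z + f z * lap2 g z +
      2 * (pd 1 f z * pd 1 g z + pd Complex.I f z * pd Complex.I g z) := by
  have key : ∀ v, pd v (pd v (fun z => f z * g z)) z =
      pd v (pd v f) z * g z + 2 * (pd v f z * pd v g z) + f z * pd v (pd v g) z := by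
    intro v
    have h1 : pd v (fun z => f z * g z) =ᶠ[𝓝 z] fun z => pd v f z * g z + f z * pd v g z := by
      filter_upwards [hf.ev, hg.ev] with w h1 h2 using pd_mul v h1.diff h2.diff
    rw [pd_congr v h1, pd_add v ((hf.pd v).mul hg).diff (hf.mul (hg.pd v)).diff,
      pd_mul v (hf.pd v).diff hg.diff, pd_mul v hf.diff (hg.pd v).diff]
    ring
  rw [lap2, key, key, lap2, lap2]; ring

lemma lap2_sq {f : ℂ → ℝ} {z : ℂ} (hf : SmAt f z) :
    lap2 (fun z => f z ^ 2) z = 2 * f z * lap2 f z +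
      2 * (pd 1 f z ^ 2 + pd Complex.I f z ^ 2) := by
  simp only [sq]
  rw [lap2_mul hf hf]; ring

lemma lap2_exp {f : ℂ → ℝ} {z : ℂ} (hf : SmAt f z) :
    lap2 (fun z => exp (f z)) z =
      exp (f z) * (lap2 f z + (pd 1 f z ^ 2 + pd Complex.I f z ^ 2)) := by
  have key : ∀ v, pd v (pd v (fun z => exp (f z))) z =
      exp (f z) * (pd v (pd v f) z + pd v f z ^ 2) := by
    intro v
    have h1 : pd v (fun z => exp (f z)) =ᶠ[𝓝 z] fun z => exp (f z) * pd v f z := by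
      filter_upwards [hf.ev] with w h1 using pd_exp v h1.diff
    rw [pd_congr v h1, pd_mul v hf.diff.exp (hf.pd v).diff, pd_exp v hf.diff]
    ring
  rw [lap2, key, key, lap2]; ring

end Laplacian

section PointwiseInequality

open Filter Topology
open Complex (I)

/-- A pair of solutions of `Δ v = -e^{2v} + F` on the plane. -/
structure LPair (v₁ v₂ F : ℂ → ℝ) : Prop where
  sm1 : ∀ z, SmAt v₁ z
  sm2 : ∀ z, SmAt v₂ z
  eq1 : ∀ z, lap2 v₁ z = -exp (v₁ z) ^ 2 + F z
  eq2 : ∀ z, lap2 v₂ z = -exp (v₂ z) ^ 2 + F z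
  pos : ∀ z, 0 < F z

/-- The difference `e^{v₂} - e^{v₁}`. -/
noncomputable def ediff (v₁ v₂ : ℂ → ℝ) (z : ℂ) : ℝ := exp (v₂ z) - exp (v₁ z)

/-- The density `e^{2v₁} + e^{2v₂}`. -/
noncomputable def etot (v₁ v₂ : ℂ → ℝ) (z : ℂ) : ℝ := exp (v₁ z) ^ 2 + exp (v₂ z) ^ 2

/-- The function `|∇(v₂ - v₁)|² + (e^{v₂} - e^{v₁})²`. -/
noncomputable def enorm2 (v₁ v₂ : ℂ → ℝ) (z : ℂ) : ℝ :=
  pd 1 (fun z => v₂ z - v₁ z) z ^ 2 + pd I (fun z => v₂ z - v₁ z) z ^ 2 + ediff v₁ v₂ z ^ 2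

variable {v₁ v₂ F : ℂ → ℝ}

lemma LPair.symm (h : LPair v₁ v₂ F) : LPair v₂ v₁ F := ⟨h.sm2, h.sm1, h.eq2, h.eq1, h.pos⟩

lemma LPair.smw (h : LPair v₁ v₂ F) (z : ℂ) : SmAt (fun z => v₂ z - v₁ z) z :=
  (h.sm2 z).sub (h.sm1 z)

lemma LPair.smD (h : LPair v₁ v₂ F) (z : ℂ) : SmAt (ediff v₁ v₂) z :=
  (h.sm2 z).exp.sub (h.sm1 z).exp

lemma LPair.smT (h : LPair v₁ v₂ F) (z : ℂ) : SmAt (etot v₁ v₂) z :=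
  ((h.sm1 z).exp.pow 2).add ((h.sm2 z).exp.pow 2)

lemma LPair.smN (h : LPair v₁ v₂ F) (z : ℂ) : SmAt (enorm2 v₁ v₂) z :=
  (((((h.smw z).pd 1)).pow 2).add (((h.smw z).pd I).pow 2)).add ((h.smD z).pow 2)

lemma LPair.lap_w (h : LPair v₁ v₂ F) (z : ℂ) :
    lap2 (fun z => v₂ z - v₁ z) z = exp (v₁ z) ^ 2 - exp (v₂ z) ^ 2 := by
  rw [lap2_sub (h.sm2 z) (h.sm1 z), h.eq1, h.eq2]; ring

lemma LPair.lap_pd_w (h : LPair v₁ v₂ F) (z v : ℂ) :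
    lap2 (pd v (fun z => v₂ z - v₁ z)) z =
      2 * exp (v₁ z) ^ 2 * pd v v₁ z - 2 * exp (v₂ z) ^ 2 * pd v v₂ z := by
  rw [← pd_lap2 (h.smw z), show lap2 (fun z => v₂ z - v₁ z) = _ from funext h.lap_w,
    pd_sub v ((h.sm1 z).exp.pow 2).diff ((h.sm2 z).exp.pow 2).diff,
    pd_sq v (h.sm1 z).exp.diff, pd_sq v (h.sm2 z).exp.diff, pd_exp v (h.sm1 z).diff,
    pd_exp v (h.sm2 z).diff]
  ring

lemma LPair.lap_ediff (h : LPair v₁ v₂ F) (z : ℂ) :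
    lap2 (ediff v₁ v₂) z =
      exp (v₂ z) * (-exp (v₂ z) ^ 2 + F z + (pd 1 v₂ z ^ 2 + pd I v₂ z ^ 2)) -
      exp (v₁ z) * (-exp (v₁ z) ^ 2 + F z + (pd 1 v₁ z ^ 2 + pd I v₁ z ^ 2)) := by
  change lap2 (fun z => exp (v₂ z) - exp (v₁ z)) z = _
  rw [lap2_sub (h.sm2 z).exp (h.sm1 z).exp, lap2_exp (h.sm2 z), lap2_exp (h.sm1 z), h.eq1, h.eq2]

lemma LPair.pd_ediff (h : LPair v₁ v₂ F) (z v : ℂ) :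
    pd v (ediff v₁ v₂) z = exp (v₂ z) * pd v v₂ z - exp (v₁ z) * pd v v₁ z := by
  change pd v (fun z => exp (v₂ z) - exp (v₁ z)) z = _
  rw [pd_sub v (h.sm2 z).exp.diff (h.sm1 z).exp.diff, pd_exp v (h.sm2 z).diff,
    pd_exp v (h.sm1 z).diff]

lemma LPair.pd_enorm2 (h : LPair v₁ v₂ F) (z v : ℂ) :
    pd v (enorm2 v₁ v₂) z = 2 * pd 1 (fun z => v₂ z - v₁ z) z * pd v (pd 1 (fun z => v₂ z - v₁ z)) z
      + 2 * pd I (fun z => v₂ z - v₁ z) z * pd v (pd I (fun z => v₂ z - v₁ z)) z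
      + 2 * ediff v₁ v₂ z * pd v (ediff v₁ v₂) z := by
  have s1 := (h.smw z).pd 1
  have s2 := (h.smw z).pd I
  have s3 := h.smD z
  change pd v (fun z => (pd 1 (fun z => v₂ z - v₁ z) z ^ 2 + pd I (fun z => v₂ z - v₁ z) z ^ 2) +
    ediff v₁ v₂ z ^ 2) z = _
  rw [pd_add v ((s1.pow 2).add (s2.pow 2)).diff (s3.pow 2).diff,
    pd_add v (s1.pow 2).diff (s2.pow 2).diff, pd_sq v s1.diff, pd_sq v s2.diff, pd_sq v s3.diff]

lemma LPair.lap_enorm2 (h : LPair v₁ v₂ F) (z : ℂ) :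
    lap2 (enorm2 v₁ v₂) z =
      2 * pd 1 (fun z => v₂ z - v₁ z) z * lap2 (pd 1 (fun z => v₂ z - v₁ z)) z
      + 2 * (pd 1 (pd 1 (fun z => v₂ z - v₁ z)) z ^ 2 + pd I (pd 1 (fun z => v₂ z - v₁ z)) z ^ 2)
      + (2 * pd I (fun z => v₂ z - v₁ z) z * lap2 (pd I (fun z => v₂ z - v₁ z)) z
      + 2 * (pd 1 (pd I (fun z => v₂ z - v₁ z)) z ^ 2 + pd I (pd I (fun z => v₂ z - v₁ z)) z ^ 2))
      + (2 * ediff v₁ v₂ z * lap2 (ediff v₁ v₂) z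
      + 2 * (pd 1 (ediff v₁ v₂) z ^ 2 + pd I (ediff v₁ v₂) z ^ 2)) := by
  have s1 := (h.smw z).pd 1
  have s2 := (h.smw z).pd I
  have s3 := h.smD z
  change lap2 (fun z => (pd 1 (fun z => v₂ z - v₁ z) z ^ 2 + pd I (fun z => v₂ z - v₁ z) z ^ 2) +
    ediff v₁ v₂ z ^ 2) z = _
  rw [lap2_add ((s1.pow 2).add (s2.pow 2)) (s3.pow 2), lap2_add (s1.pow 2) (s2.pow 2),
    lap2_sq s1, lap2_sq s2, lap2_sq s3]

lemma LPair.key (h : LPair v₁ v₂ F) (z : ℂ) :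
    pd 1 (enorm2 v₁ v₂) z ^ 2 + pd I (enorm2 v₁ v₂) z ^ 2 - enorm2 v₁ v₂ z ^ 2 * etot v₁ v₂ z
      + 2 * enorm2 v₁ v₂ z * F z * ediff v₁ v₂ z ^ 2 ≤
    enorm2 v₁ v₂ z * lap2 (enorm2 v₁ v₂) z := by
  have hsymm := pd_symm I 1 (h.smw z)
  have hlap := h.lap_w z
  rw [lap2] at hlap
  rw [h.lap_enorm2, h.pd_enorm2, h.pd_enorm2, h.lap_pd_w, h.lap_pd_w, h.lap_ediff, h.pd_ediff,
    h.pd_ediff, hsymm]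
  simp only [enorm2, etot, ediff]
  rw [pd_sub 1 (h.sm2 z).diff (h.sm1 z).diff, pd_sub I (h.sm2 z).diff (h.sm1 z).diff]
  generalize pd 1 (pd 1 (fun z => v₂ z - v₁ z)) z = p at *
  generalize pd I (pd I (fun z => v₂ z - v₁ z)) z = q at *
  generalize pd 1 (pd I (fun z => v₂ z - v₁ z)) z = β at *
  generalize exp (v₁ z) = e₁ at *
  generalize exp (v₂ z) = e₂ at *
  generalize pd 1 v₁ z = x₁ at *
  generalize pd 1 v₂ z = x₂ at *
  generalize pd I v₁ z = y₁ at *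
  generalize pd I v₂ z = y₂ at *
  generalize F z = f at *
  have hq : q = e₁ ^ 2 - e₂ ^ 2 - p := by linarith
  subst hq
  have hs : 0 ≤ 4 * (e₂ - e₁) ^ 2 * ((p + (e₂ ^ 2 - e₁ ^ 2) / 2
      - ((x₂ - x₁) * ((x₁ + x₂) / 2) - (y₂ - y₁) * ((y₁ + y₂) / 2))) ^ 2
      + (β - ((x₂ - x₁) * ((y₁ + y₂) / 2) + (y₂ - y₁) * ((x₁ + x₂) / 2))) ^ 2) := by positivity
  linear_combination hs

lemma LPair.lap_log_enorm2 (h : LPair v₁ v₂ F) {z : ℂ} (hz : 0 < enorm2 v₁ v₂ z) :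
    -etot v₁ v₂ z + 2 * F z * ediff v₁ v₂ z ^ 2 / enorm2 v₁ v₂ z ≤
      lap2 (fun z => log (enorm2 v₁ v₂ z)) z := by
  rw [lap2_log (h.smN z) hz.ne', le_div_iff₀ (by positivity)]
  have := h.key z
  have e : (-etot v₁ v₂ z + 2 * F z * ediff v₁ v₂ z ^ 2 / enorm2 v₁ v₂ z) * enorm2 v₁ v₂ z ^ 2
    = - enorm2 v₁ v₂ z ^ 2 * etot v₁ v₂ z + 2 * enorm2 v₁ v₂ z * F z * ediff v₁ v₂ z ^ 2 := by
    field_simp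
  rw [e]; linarith

end PointwiseInequality

section PeriodicLog

open Filter Topology Set Metric
open Complex (I)

/-- `f` has a continuous `2π`-periodic logarithm. -/
def PLog (f : ℝ → ℂ) : Prop :=
  ∃ l : ℝ → ℂ, Continuous l ∧ (∀ t, l (t + 2 * π) = l t) ∧ ∀ t, Complex.exp (l t) = f t

lemma PLog.mul {f g : ℝ → ℂ} (hf : PLog f) (hg : PLog g) : PLog (fun t => f t * g t) := by
  obtain ⟨l, h1, h2, h3⟩ := hf
  obtain ⟨m, k1, k2, k3⟩ := hg
  exact ⟨fun t => l t + m t, h1.add k1, fun t => congrArg₂ (· + ·) (h2 t) (k2 t), fun t => by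
    rw [Complex.exp_add, h3, k3]⟩

lemma PLog.const {c : ℂ} (hc : c ≠ 0) : PLog (fun _ => c) :=
  ⟨fun _ => Complex.log c, continuous_const, fun _ => rfl, fun _ => Complex.exp_log hc⟩

lemma PLog.of_slit {f : ℝ → ℂ} (hc : Continuous f) (hp : ∀ t, f (t + 2 * π) = f t)
    (hs : ∀ t, f t ∈ Complex.slitPlane) : PLog f :=
  ⟨fun t => Complex.log (f t), hc.clog hs, fun t => congrArg Complex.log (hp t),
    fun t => Complex.exp_log (Complex.slitPlane_ne_zero (hs t))⟩

/-- The gradient of a function on the plane as a complex number. -/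
noncomputable def cgrad (W : ℂ → ℝ) (z : ℂ) : ℂ := ⟨pd 1 W z, pd I W z⟩

lemma pd_eq (W : ℂ → ℝ) (z v : ℂ) : pd v W z = v.re * pd 1 W z + v.im * pd I W z := by
  have : v = v.re • (1 : ℂ) + v.im • I := by
    simp [Complex.re_add_im]
  conv_lhs => rw [this]
  simp only [pd, map_add, map_smul, smul_eq_mul]

lemma sq_norm_cgrad (W : ℂ → ℝ) (z : ℂ) : ‖cgrad W z‖ ^ 2 = pd 1 W z ^ 2 + pd I W z ^ 2 := by
  rw [← Complex.normSq_eq_norm_sq, Complex.normSq_apply]; simp [cgrad]; ring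

lemma pd_cgrad (W : ℂ → ℝ) (z v : ℂ) : pd v W z = (cgrad W z).re * v.re + (cgrad W z).im * v.im := by
  rw [pd_eq]; simp [cgrad]; ring

lemma re_im_le (a b : ℂ) : -(‖a‖ * ‖b‖) ≤ a.re * b.re + a.im * b.im := by
  have h := Complex.abs_re_le_norm (a * (starRingEnd ℂ) b)
  simp only [Complex.mul_re, Complex.conj_re, Complex.conj_im, norm_mul, Complex.norm_conj] at h
  have := neg_abs_le (a.re * b.re - a.im * -b.im)
  linarith

lemma ascent_step {W : ℂ → ℝ} (hW : ∀ z ∈ ball (0 : ℂ) 1, SmAt W z) {ρ : ℝ} (hρ0 : 0 < ρ)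
    (hρ : ρ < 1) : ∃ h > 0, ∀ x ∈ closedBall (0 : ℂ) ρ, ∀ s ∈ Icc (0 : ℝ) 1,
      x + ((s * h : ℝ) : ℂ) * cgrad W x ∈ ball (0 : ℂ) 1 ∧
      W x + s * (h / 2 * ‖cgrad W x‖ ^ 2) ≤ W (x + ((s * h : ℝ) : ℂ) * cgrad W x) := by
  set ρ' := (1 + ρ) / 2 with hρ'
  have hsub : closedBall (0 : ℂ) ρ' ⊆ ball 0 1 := closedBall_subset_ball (by linarith)
  have hlip : ∀ v, ∃ K, LipschitzOnWith K (pd v W) (closedBall 0 ρ') := fun v =>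
    ContDiffOn.exists_lipschitzOnWith (n := ∞)
      (fun z hz => ((hW z (hsub hz)).pd v).cd.contDiffWithinAt)
      (by simp) (convex_closedBall _ _) (isCompact_closedBall _ _)
  obtain ⟨K1, hK1⟩ := hlip 1
  obtain ⟨K2, hK2⟩ := hlip I
  set L : ℝ := K1 + K2 + 1 with hL
  have hLpos : 0 < L := by positivity
  have hgl : ∀ x ∈ closedBall (0 : ℂ) ρ', ∀ y ∈ closedBall (0 : ℂ) ρ',
      ‖cgrad W x - cgrad W y‖ ≤ L * ‖x - y‖ := by
    intro x hx y hy
    have h1 := hK1.dist_le_mul x hx y hy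
    have h2 := hK2.dist_le_mul x hx y hy
    rw [Real.dist_eq, dist_eq_norm] at h1 h2
    refine (Complex.norm_le_abs_re_add_abs_im _).trans ?_
    simp only [cgrad, Complex.sub_re, Complex.sub_im]
    rw [hL]
    nlinarith [norm_nonneg (x - y)]
  have hcont : ContinuousOn (cgrad W) (closedBall 0 ρ') := by
    have : LipschitzOnWith (K1 + K2 + 1) (cgrad W) (closedBall 0 ρ') :=
      LipschitzOnWith.of_dist_le_mul fun x hx y hy => by
        rw [dist_eq_norm, dist_eq_norm]; exact_mod_cast hgl x hx y hy
    exact this.continuousOn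
  obtain ⟨B, hB⟩ := (isCompact_closedBall (0 : ℂ) ρ').exists_bound_of_continuousOn hcont
  have hB0 : 0 ≤ B := (norm_nonneg _).trans (hB 0 (mem_closedBall_self (by linarith)))
  obtain ⟨h, hh0, hhB, hhL⟩ : ∃ h > 0, h * B ≤ (1 - ρ) / 2 ∧ h * L ≤ 1 / 2 := by
    refine ⟨min ((1 - ρ) / 2 / (B + 1)) (1 / (2 * L)), ?_, ?_, ?_⟩
    · have : 0 < 1 - ρ := by linarith
      positivity
    · calc _ ≤ (1 - ρ) / 2 / (B + 1) * (B + 1) := by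
            have : 0 < 1 - ρ := by linarith
            exact mul_le_mul (min_le_left _ _) (by linarith) hB0 (by positivity)
        _ = _ := by field_simp
    · calc _ ≤ 1 / (2 * L) * L := by
            gcongr
            exact min_le_right _ _
        _ = _ := by field_simp
  refine ⟨h, hh0, fun x hx => ?_⟩
  have hx' : x ∈ closedBall (0 : ℂ) ρ' := closedBall_subset_closedBall (by linarith) hx
  set X := cgrad W x with hX
  have hmem : ∀ s ∈ Icc (0 : ℝ) 1, x + ((s * h : ℝ) : ℂ) * X ∈ closedBall (0 : ℂ) ρ' := by
    intro s hs
    rw [mem_closedBall_zero_iff] at hx ⊢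
    calc ‖x + ((s * h : ℝ) : ℂ) * X‖ ≤ ‖x‖ + ‖((s * h : ℝ) : ℂ) * X‖ := norm_add_le _ _
      _ = ‖x‖ + s * h * ‖X‖ := by
        rw [norm_mul, Complex.norm_real, Real.norm_of_nonneg (mul_nonneg hs.1 hh0.le)]
      _ ≤ ρ + 1 * h * B := by
        gcongr
        · exact hs.2
        · exact hB x hx'
      _ ≤ ρ' := by rw [hρ']; linarith
  have hder : ∀ s ∈ Icc (0 : ℝ) 1, HasDerivAt (fun s : ℝ => W (x + ((s * h : ℝ) : ℂ) * X))
      (pd ((h : ℂ) * X) W (x + ((s * h : ℝ) : ℂ) * X)) s := by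
    intro s hs
    have h1 : HasDerivAt (fun s : ℝ => x + ((s * h : ℝ) : ℂ) * X) ((h : ℂ) * X) s := by
      have h2 : HasDerivAt (fun s : ℝ => ((s * h : ℝ) : ℂ)) (h : ℂ) s := by
        have := ((hasDerivAt_id s).mul_const h).ofReal_comp
        simpa using this
      exact (h2.mul_const X).const_add x
    exact ((hW _ (hsub (hmem s hs))).diff.hasFDerivAt).comp_hasDerivAt s h1
  have hbd : ∀ s ∈ Icc (0 : ℝ) 1, h / 2 * ‖X‖ ^ 2 ≤
      pd ((h : ℂ) * X) W (x + ((s * h : ℝ) : ℂ) * X) := by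
    intro s hs
    rw [pd_cgrad]
    set Y := cgrad W (x + ((s * h : ℝ) : ℂ) * X)
    have h1 := hgl _ (hmem s hs) _ hx'
    have h2 : ‖Y - X‖ ≤ L * (h * ‖X‖) := by
      refine h1.trans ?_
      rw [add_sub_cancel_left, norm_mul, Complex.norm_real,
        Real.norm_of_nonneg (mul_nonneg hs.1 hh0.le)]
      gcongr
      nlinarith [hs.2]
    have h3 := re_im_le (Y - X) X
    have h4 : ‖Y - X‖ * ‖X‖ ≤ 1 / 2 * ‖X‖ ^ 2 := by
      calc ‖Y - X‖ * ‖X‖ ≤ L * (h * ‖X‖) * ‖X‖ := by gcongr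
        _ = h * L * ‖X‖ ^ 2 := by ring
        _ ≤ _ := by gcongr
    have h5 : ‖X‖ ^ 2 = X.re * X.re + X.im * X.im := by
      rw [← Complex.normSq_eq_norm_sq, Complex.normSq_apply]
    simp only [Complex.sub_re, Complex.sub_im] at h3
    simp only [Complex.re_ofReal_mul, Complex.im_ofReal_mul]
    have h6 : 1 / 2 * ‖X‖ ^ 2 ≤ Y.re * X.re + Y.im * X.im := by nlinarith
    nlinarith
  intro s hs
  refine ⟨hsub (hmem s hs), ?_⟩
  have hmv := (convex_Icc (0 : ℝ) 1).mul_sub_le_image_sub_of_le_deriv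
    (f := fun s : ℝ => W (x + ((s * h : ℝ) : ℂ) * X))
    (fun s hs => (hder s hs).continuousAt.continuousWithinAt)
    (fun s hs => (hder s (interior_subset hs)).differentiableAt.differentiableWithinAt)
    (C := h / 2 * ‖X‖ ^ 2)
    (fun s hs => by rw [(hder s (interior_subset hs)).deriv]; exact hbd s (interior_subset hs))
    0 (by simp) s hs hs.1
  simp only [zero_mul, Complex.ofReal_zero, add_zero, sub_zero] at hmv
  linarith

lemma one_sub_div_mem_slit {x a b : ℂ} (hx : x ≠ 0)
    (hseg : ∀ s ∈ Icc (0 : ℝ) 1, a + (s : ℂ) * (b - a) ≠ x) :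
    (1 - a / x) / (1 - b / x) ∈ Complex.slitPlane := by
  have hb : b ≠ x := by simpa using hseg 1 (by simp)
  have hbx : 1 - b / x ≠ 0 := by
    rw [sub_ne_zero]; intro h; exact hb (by rw [eq_div_iff hx] at h; simpa using h.symm)
  by_contra hcon
  rw [Complex.mem_slitPlane_iff, not_or, not_lt, not_not] at hcon
  set q := (1 - a / x) / (1 - b / x) with hq
  obtain ⟨h1, h2⟩ := hcon
  have hqr : q = (q.re : ℂ) := by apply Complex.ext <;> simp [h2]
  set t := -q.re with ht
  have ht0 : 0 ≤ t := by rw [ht]; linarith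
  have e : x - a = -(t : ℂ) * (x - b) := by
    have : 1 - a / x = q * (1 - b / x) := by rw [hq]; field_simp
    rw [hqr] at this
    field_simp at this
    rw [this, ht]; push_cast; ring
  apply hseg (t / (1 + t)) ⟨by positivity, by rw [div_le_one (by positivity)]; linarith⟩
  have h1t : (1 + (t : ℂ)) ≠ 0 := by norm_cast; positivity
  push_cast
  field_simp
  linear_combination -e

lemma exists_plog_grad {W : ℂ → ℝ} (hW : ∀ z ∈ ball (0 : ℂ) 1, SmAt W z)
    (hpos : ∀ z ∈ ball (0 : ℂ) 1, 0 < W z)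
    (hbd : ∀ ε : ℝ, 0 < ε → ∃ ρ : ℝ, ρ < 1 ∧ ∀ z ∈ ball (0 : ℂ) 1, ρ ≤ ‖z‖ → W z < ε)
    (hcrit : ∃ ε : ℝ, 0 < ε ∧ ∀ z ∈ ball (0 : ℂ) 1, W z ≤ ε → cgrad W z ≠ 0) :
    ∃ ρ : ℝ, ρ < 1 ∧ ∀ r : ℝ, ρ < r → r < 1 → 0 < r →
      PLog (fun t => (starRingEnd ℂ) ((r : ℂ) * Complex.exp (t * I)) *
        cgrad W ((r : ℂ) * Complex.exp (t * I))) := by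
  obtain ⟨ε, hε, hcrit⟩ := hcrit
  obtain ⟨ρ, hρ, hρW⟩ := hbd ε hε
  refine ⟨ρ, hρ, fun r hρr hr1 hr0 => ?_⟩
  set x : ℝ → ℂ := fun t => (r : ℂ) * Complex.exp (t * I) with hxdef
  have hxc : Continuous x := by fun_prop
  have hxp : ∀ t, x (t + 2 * π) = x t := by
    intro t
    simp only [hxdef]
    push_cast
    rw [add_mul, Complex.exp_add, Complex.exp_two_pi_mul_I, mul_one]
  have hxn : ∀ t, ‖x t‖ = r := by
    intro t
    simp [hxdef, Complex.norm_exp_ofReal_mul_I, abs_of_pos hr0]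
  have hx0 : ∀ t, x t ≠ 0 := fun t h => by have := hxn t; rw [h, norm_zero] at this; linarith
  have hxb : ∀ t, x t ∈ ball (0 : ℂ) 1 := fun t => by rw [mem_ball_zero_iff, hxn]; exact hr1
  have hWc : ContinuousOn W (ball 0 1) := fun z hz => (hW z hz).continuousAt.continuousWithinAt
  obtain ⟨z₀, hz₀, hmin⟩ := (isCompact_sphere (0 : ℂ) r).exists_isMinOn
    (NormedSpace.sphere_nonempty.mpr hr0.le) (hWc.mono (sphere_subset_closedBall.trans
      (closedBall_subset_ball hr1)))
  set m := W z₀ with hm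
  have hm0 : 0 < m := hpos z₀ (closedBall_subset_ball hr1 (sphere_subset_closedBall hz₀))
  have hxm : ∀ t, m ≤ W (x t) := fun t => hmin (by simp [hxn t])
  obtain ⟨ρ₁, hρ₁, hρ₁W⟩ := hbd m hm0
  set ρ₂ := max ρ₁ (1 / 2) with hρ₂
  have hρ₂1 : ρ₂ < 1 := max_lt hρ₁ (by norm_num)
  have hρ₂0 : 0 < ρ₂ := lt_max_of_lt_right (by norm_num)
  set K := {z | z ∈ ball (0 : ℂ) 1 ∧ m ≤ W z} with hK
  have hKρ : K ⊆ closedBall 0 ρ₂ := by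
    intro z hz
    rw [mem_closedBall_zero_iff]
    by_contra hcon
    have := hρ₁W z hz.1 ((le_max_left _ _).trans (not_le.mp hcon).le)
    linarith [hz.2]
  obtain ⟨h, hh0, hstep⟩ := ascent_step hW hρ₂0 hρ₂1
  set φ : ℂ → ℂ := fun z => z + (h : ℂ) * cgrad W z with hφ
  have hφseg : ∀ z ∈ K, ∀ s ∈ Icc (0 : ℝ) 1, z + (s : ℂ) * (φ z - z) ∈ ball (0 : ℂ) 1 ∧
      W z + s * (h / 2 * ‖cgrad W z‖ ^ 2) ≤ W (z + (s : ℂ) * (φ z - z)) := by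
    intro z hz s hs
    have := hstep z (hKρ hz) s hs
    have e : z + (s : ℂ) * (φ z - z) = z + ((s * h : ℝ) : ℂ) * cgrad W z := by
      simp only [hφ]; push_cast; ring
    rwa [e]
  have hφK : ∀ z ∈ K, φ z ∈ K ∧ W z + h / 2 * ‖cgrad W z‖ ^ 2 ≤ W (φ z) := by
    intro z hz
    have := hφseg z hz 1 (by simp)
    simp only [Complex.ofReal_one, one_mul, add_sub_cancel] at this
    refine ⟨⟨this.1, hz.2.trans (le_trans ?_ this.2)⟩, this.2⟩
    have : 0 ≤ h / 2 * ‖cgrad W z‖ ^ 2 := by positivity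
    linarith
  have hgc : ContinuousOn (cgrad W) (ball 0 1) := by
    intro z hz
    have h1 := ((hW z hz).pd 1).continuousAt
    have h2 := ((hW z hz).pd I).continuousAt
    have : cgrad W = fun z => (pd 1 W z : ℂ) + (pd I W z : ℂ) * I := by
      ext z; simp [cgrad, Complex.mk_eq_add_mul_I]
    rw [this]
    exact ((Complex.continuous_ofReal.continuousAt.comp h1).add
      ((Complex.continuous_ofReal.continuousAt.comp h2).mul_const I)).continuousWithinAt
  have hxK : ∀ t, x t ∈ K := fun t => ⟨hxb t, hxm t⟩
  have hitK : ∀ k t, φ^[k] (x t) ∈ K := by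
    intro k t
    induction k with
    | zero => exact hxK t
    | succ k ih => rw [Function.iterate_succ_apply']; exact (hφK _ ih).1
  have hitc : ∀ k, Continuous fun t => φ^[k] (x t) := by
    intro k
    induction k with
    | zero => exact hxc
    | succ k ih =>
      simp only [Function.iterate_succ_apply']
      have : ContinuousOn φ K := by
        apply ContinuousOn.add continuousOn_id
        exact continuousOn_const.mul (hgc.mono fun z hz => hz.1)
      exact this.comp_continuous ih fun t => hitK k t
  have hWx : ∀ t, W (x t) ≤ ε := fun t => (hρW _ (hxb t) (by rw [hxn]; exact hρr.le)).le
  have hfirst : ∀ k t, W (x t) < W (φ^[k + 1] (x t)) := by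
    intro k t
    induction k with
    | zero =>
      have h1 := (hφK _ (hxK t)).2
      have h2 : 0 < ‖cgrad W (x t)‖ := norm_pos_iff.mpr (hcrit _ (hxb t) (hWx t))
      have : 0 < h / 2 * ‖cgrad W (x t)‖ ^ 2 := by positivity
      simp only [Function.iterate_succ_apply', Function.iterate_zero, id]
      linarith
    | succ k ih =>
      rw [Function.iterate_succ_apply']
      have h1 := (hφK _ (hitK (k + 1) t)).2
      have : 0 ≤ h / 2 * ‖cgrad W (φ^[k + 1] (x t))‖ ^ 2 := by positivity
      linarith
  have hKc : IsCompact (K ∩ {z | W z ≤ ε}) := by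
    have h1 : ContinuousOn W (closedBall 0 ρ₂) := hWc.mono (closedBall_subset_ball hρ₂1)
    have h2 := h1.preimage_isClosed_of_isClosed isClosed_closedBall (isClosed_Icc (a := m) (b := ε))
    have e : K ∩ {z | W z ≤ ε} = closedBall 0 ρ₂ ∩ W ⁻¹' Icc m ε := by
      ext z
      constructor
      · rintro ⟨h1, h2⟩
        exact ⟨hKρ h1, h1.2, h2⟩
      · rintro ⟨h1, h2, h3⟩
        exact ⟨⟨closedBall_subset_ball hρ₂1 h1, h2⟩, h3⟩
    rw [e]
    exact (isCompact_closedBall (0 : ℂ) ρ₂).of_isClosed_subset h2 inter_subset_left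
  obtain ⟨δ, hδ0, hδ⟩ : ∃ δ > 0, ∀ z ∈ K ∩ {z | W z ≤ ε}, δ ≤ h / 2 * ‖cgrad W z‖ ^ 2 := by
    obtain ⟨z₁, hz₁, hz₁m⟩ := hKc.exists_isMinOn ⟨x 0, hxK 0, hWx 0⟩
      ((hgc.mono fun z (hz : z ∈ K ∩ {z | W z ≤ ε}) => hz.1.1).norm.pow 2)
    have : 0 < ‖cgrad W z₁‖ := norm_pos_iff.mpr (hcrit _ hz₁.1.1 hz₁.2)
    refine ⟨h / 2 * ‖cgrad W z₁‖ ^ 2, by positivity, fun z hz => ?_⟩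
    have h5 : ‖cgrad W z₁‖ ^ 2 ≤ ‖cgrad W z‖ ^ 2 := hz₁m hz
    gcongr
  have hgrow : ∀ (k : ℕ) (t : ℝ), min (ε + δ) (m + k * δ) ≤ W (φ^[k] (x t)) ∨ ε < W (φ^[k] (x t)) := by
    intro k t
    induction k with
    | zero => left; simp only [Nat.cast_zero, zero_mul, add_zero]; exact (min_le_right _ _).trans (hxm t)
    | succ k ih =>
      rw [Function.iterate_succ_apply']
      have h1 := (hφK _ (hitK k t)).2
      by_cases h2 : W (φ^[k] (x t)) ≤ ε
      · left
        have h3 := hδ _ ⟨hitK k t, h2⟩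
        rcases ih with h4 | h4
        · rcases min_le_iff.mp h4 with h5 | h5
          · linarith
          · refine (min_le_right _ _).trans ?_
            push_cast
            linarith
        · linarith
      · right
        have : 0 ≤ h / 2 * ‖cgrad W (φ^[k] (x t))‖ ^ 2 := by positivity
        linarith
  obtain ⟨n, hn⟩ := exists_nat_gt ((ε + δ - m) / δ)
  have hn' : ∀ t, ε < W (φ^[n + 1] (x t)) := by
    intro t
    have hn2 : ε + δ ≤ m + ((n + 1 : ℕ) : ℝ) * δ := by
      rw [div_lt_iff₀ hδ0] at hn
      push_cast
      nlinarith
    rcases hgrow (n + 1) t with h1 | h1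
    · rw [min_eq_left hn2] at h1; linarith
    · exact h1
  have hinside : ∀ t, ‖φ^[n + 1] (x t)‖ < r := by
    intro t
    by_contra hcon
    have := hρW _ (hitK (n + 1) t).1 (hρr.le.trans (not_lt.mp hcon))
    linarith [hn' t]
  set f : ℕ → ℝ → ℂ := fun k t => 1 - φ^[k] (x t) / x t with hf
  have hfc : ∀ k, Continuous (f k) := fun k => continuous_const.sub ((hitc k).div hxc hx0)
  have hfp : ∀ k t, f k (t + 2 * π) = f k t := fun k t => by simp only [hf, hxp]
  have hfne : ∀ k t, f (k + 1) t ≠ 0 := by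
    intro k t h0
    have h1 : φ^[k + 1] (x t) = x t := by
      have := sub_eq_zero.mp h0
      rw [eq_div_iff (hx0 t)] at this
      simpa using this.symm
    have := hfirst k t
    rw [h1] at this
    exact lt_irrefl _ this
  have hPn : PLog (f (n + 1)) := by
    refine PLog.of_slit (hfc _) (hfp _) fun t => Or.inl ?_
    have h1 : ‖φ^[n + 1] (x t) / x t‖ < 1 := by
      rw [norm_div, hxn, div_lt_one hr0]; exact hinside t
    have h2 := (Complex.re_le_norm (φ^[n + 1] (x t) / x t)).trans_lt h1
    simp only [hf, Complex.sub_re, Complex.one_re]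
    linarith
  have hPstep : ∀ k, PLog (f (k + 1 + 1)) → PLog (f (k + 1)) := by
    intro k hk
    have hq : PLog (fun t => f (k + 1) t / f (k + 1 + 1) t) := by
      refine PLog.of_slit ((hfc _).div (hfc _) (hfne _)) (fun t => by rw [hfp, hfp]) fun t => ?_
      refine one_sub_div_mem_slit (hx0 t) fun s hs heq => ?_
      rw [Function.iterate_succ_apply' φ (k + 1)] at heq
      have h1 := (hφseg _ (hitK (k + 1) t) s hs).2
      rw [heq] at h1
      have h2 := hfirst k t
      have h3 : 0 ≤ s * (h / 2 * ‖cgrad W (φ^[k + 1] (x t))‖ ^ 2) :=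
        mul_nonneg hs.1 (by positivity)
      linarith
    have := hq.mul hk
    refine (funext fun t => ?_ : (fun t => f (k + 1) t / f (k + 1 + 1) t * f (k + 1 + 1) t)
      = f (k + 1)) ▸ this
    field_simp [hfne (k + 1) t]
  have hP1 : PLog (f 1) := by
    have : ∀ k, PLog (f (k + 1)) → PLog (f 1) := by
      intro k
      induction k with
      | zero => exact id
      | succ k ih => exact fun hk => ih (hPstep k hk)
    exact this n hPn
  have hc : (-((r : ℂ) ^ 2 / h)) ≠ 0 := by
    have h1 : (r : ℂ) ≠ 0 := by exact_mod_cast hr0.ne'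
    have h2 : (h : ℂ) ≠ 0 := by exact_mod_cast hh0.ne'
    exact neg_ne_zero.mpr (div_ne_zero (pow_ne_zero _ h1) h2)
  have hfin := (PLog.const hc).mul hP1
  suffices e : (fun t => (starRingEnd ℂ) (x t) * cgrad W (x t)) =
      fun t => -((r : ℂ) ^ 2 / h) * f 1 t by
    change PLog (fun t => (starRingEnd ℂ) (x t) * cgrad W (x t))
    rw [e]
    exact hfin
  ext t
  simp only [hf, Function.iterate_one, hφ]
  have h2 : (h : ℂ) ≠ 0 := by exact_mod_cast hh0.ne'
  have h3 : (starRingEnd ℂ) (x t) * x t = (r : ℂ) ^ 2 := by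
    rw [Complex.conj_mul', hxn]
  have h4 := hx0 t
  field_simp
  rw [← h3]
  ring

end PeriodicLog

section StripDivergence

open Filter Topology Set
open Complex (I)

/-- The divergence theorem on a vertically periodic strip. -/
lemma strip_div {f g : ℂ → ℝ} {a b : ℝ} (hab : a ≤ b)
    (hf : ∀ s : ℂ, a ≤ s.re → s.re ≤ b → SmAt f s) (hg : ∀ s : ℂ, a ≤ s.re → s.re ≤ b → SmAt g s)
    (pg : ∀ s : ℂ, g (s + 2 * π * I) = g s) :
    (∫ t in (0 : ℝ)..2 * π, f (b + t * I)) - ∫ t in (0 : ℝ)..2 * π, f (a + t * I) =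
      ∫ x in a..b, ∫ t in (0 : ℝ)..2 * π, (pd 1 f (x + t * I) + pd I g (x + t * I)) := by
  set φ : ℝ × ℝ →L[ℝ] ℂ := (Complex.equivRealProdCLM.symm : ℝ × ℝ →L[ℝ] ℂ) with hφ
  have hφv : ∀ p : ℝ × ℝ, φ p = p.1 + p.2 * I := fun p => Complex.equivRealProdCLM_symm_apply p
  have hre : ∀ p : ℝ × ℝ, (φ p).re = p.1 := fun p => by simp [hφv]
  set S : Set (ℝ × ℝ) := uIcc a b ×ˢ uIcc 0 (2 * π) with hS
  have hSm : ∀ p ∈ S, a ≤ (φ p).re ∧ (φ p).re ≤ b := by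
    intro p hp
    have := hp.1
    rw [uIcc_of_le hab, mem_Icc] at this
    rwa [hre]
  have hd : ∀ {h : ℂ → ℝ}, (∀ s : ℂ, a ≤ s.re → s.re ≤ b → SmAt h s) → ∀ p ∈ S,
      HasFDerivAt (fun p => h (φ p)) ((fderiv ℝ h (φ p)).comp φ) p := by
    intro h hh p hp
    exact (hh _ (hSm p hp).1 (hSm p hp).2).diff.hasFDerivAt.comp p φ.hasFDerivAt
  have hsub : Ioo (min a b) (max a b) ×ˢ Ioo (min 0 (2 * π)) (max 0 (2 * π)) ⊆ S :=
    prod_mono Ioo_subset_Icc_self Ioo_subset_Icc_self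
  have hcont : ContinuousOn (fun p => pd 1 f (φ p) + pd I g (φ p)) S := by
    intro p hp
    have e1 := ((hf _ (hSm p hp).1 (hSm p hp).2).pd 1).continuousAt
    have e2 := ((hg _ (hSm p hp).1 (hSm p hp).2).pd I).continuousAt
    exact ((e1.comp φ.continuous.continuousAt).add
      (e2.comp φ.continuous.continuousAt)).continuousWithinAt
  have hScomp : IsCompact S := isCompact_uIcc.prod isCompact_uIcc
  have hi1 : φ (1, 0) = 1 := by simp [hφv]
  have hi2 : φ (0, 1) = I := by simp [hφv]
  have key := integral2_divergence_prod_of_hasFDerivAt (fun p => f (φ p)) (fun p => g (φ p))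
    (fun p => (fderiv ℝ f (φ p)).comp φ) (fun p => (fderiv ℝ g (φ p)).comp φ) a 0 b (2 * π)
    (fun p hp => (hd hf p hp).continuousAt.continuousWithinAt)
    (fun p hp => (hd hg p hp).continuousAt.continuousWithinAt)
    (fun p hp => hd hf p (hsub hp)) (fun p hp => hd hg p (hsub hp))
    (by
      simp only [ContinuousLinearMap.comp_apply, hi1, hi2]
      exact hcont.integrableOn_compact hScomp)
  simp only [ContinuousLinearMap.comp_apply, hi1, hi2, hφv] at key
  simp only [pd]
  rw [key]
  have : ∀ x : ℝ, g (x + ((2 * π : ℝ) : ℂ) * I) = g (x + ((0 : ℝ) : ℂ) * I) := by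
    intro x
    have e := pg (x + ((0 : ℝ) : ℂ) * I)
    rw [← e]; push_cast; congr 1; ring
  simp only [this]
  ring

/-- A fundamental rectangle of the periodic strip. -/
def pRect (a b : ℝ) : Set ℂ := Ioc a b ×ℂ Ioc 0 (2 * π)

lemma measurableSet_pRect (a b : ℝ) : MeasurableSet (pRect a b) :=
  (Complex.measurable_re measurableSet_Ioc).inter (Complex.measurable_im measurableSet_Ioc)

lemma pRect_subset (a b : ℝ) : pRect a b ⊆ Icc a b ×ℂ Icc 0 (2 * π) := fun _ hs =>
  ⟨Ioc_subset_Icc_self hs.1, Ioc_subset_Icc_self hs.2⟩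

lemma integrableOn_pRect {h : ℂ → ℝ} {a b : ℝ}
    (hh : ∀ s : ℂ, a ≤ s.re → s.re ≤ b → ContinuousAt h s) : IntegrableOn h (pRect a b) := by
  refine IntegrableOn.mono_set ?_ (pRect_subset a b)
  refine ContinuousOn.integrableOn_compact (isCompact_Icc.reProdIm isCompact_Icc) fun s hs => ?_
  exact (hh s hs.1.1 hs.1.2).continuousWithinAt

lemma pRect_integral {h : ℂ → ℝ} {a b : ℝ} (hab : a ≤ b)
    (hh : ∀ s : ℂ, a ≤ s.re → s.re ≤ b → ContinuousAt h s) :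
    ∫ x in a..b, ∫ t in (0 : ℝ)..2 * π, h (x + t * I) = ∫ s in pRect a b, h s := by
  have hpi : (0 : ℝ) ≤ 2 * π := by positivity
  have hmass := integrableOn_pRect hh
  have hpre : pRect a b = Complex.measurableEquivRealProd ⁻¹' (Ioc a b ×ˢ Ioc 0 (2 * π)) := rfl
  have e := Complex.volume_preserving_equiv_real_prod.symm
  have hv : ∀ p : ℝ × ℝ, Complex.measurableEquivRealProd.symm p = p.1 + p.2 * I := fun p => by
    rw [Complex.measurableEquivRealProd_symm_apply]; apply Complex.ext <;> simp
  have hpre2 : Complex.measurableEquivRealProd.symm ⁻¹' pRect a b = Ioc a b ×ˢ Ioc 0 (2 * π) := by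
    rw [hpre, ← preimage_comp]; simp
  rw [← e.setIntegral_preimage_emb Complex.measurableEquivRealProd.symm.measurableEmbedding, hpre2,
    Measure.volume_eq_prod, setIntegral_prod]
  · rw [intervalIntegral.integral_of_le hab]
    refine setIntegral_congr_fun measurableSet_Ioc fun x hx => ?_
    simp only [intervalIntegral.integral_of_le hpi, hv]
  · rw [← Measure.volume_eq_prod, ← hpre2]
    exact (e.integrableOn_comp_preimage
      Complex.measurableEquivRealProd.symm.measurableEmbedding).2 hmass

lemma strip_div' {f g : ℂ → ℝ} {a b : ℝ} (hab : a ≤ b)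
    (hf : ∀ s : ℂ, a ≤ s.re → s.re ≤ b → SmAt f s) (hg : ∀ s : ℂ, a ≤ s.re → s.re ≤ b → SmAt g s)
    (pg : ∀ s : ℂ, g (s + 2 * π * I) = g s) :
    (∫ t in (0 : ℝ)..2 * π, f (b + t * I)) - ∫ t in (0 : ℝ)..2 * π, f (a + t * I) =
      ∫ s in pRect a b, (pd 1 f s + pd I g s) := by
  rw [strip_div hab hf hg pg, ← pRect_integral hab (h := fun s => pd 1 f s + pd I g s)]
  intro s h1 h2
  exact ((hf s h1 h2).pd 1).continuousAt.add ((hg s h1 h2).pd I).continuousAt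

/-- A closed curve which has a periodic logarithm has total argument variation zero. -/
lemma PLog.integral_zero {a b a' b' : ℝ → ℝ} (hl : PLog (fun t => (⟨a t, b t⟩ : ℂ)))
    (ha : ∀ t, HasDerivAt a (a' t) t) (hb : ∀ t, HasDerivAt b (b' t) t)
    (ca : Continuous a') (cb : Continuous b') :
    ∫ t in (0 : ℝ)..2 * π, (a t * b' t - b t * a' t) / (a t ^ 2 + b t ^ 2) = 0 := by
  obtain ⟨l, hlc, hlp, hle⟩ := hl
  set m : ℝ → ℝ := fun t => (a t * b' t - b t * a' t) / (a t ^ 2 + b t ^ 2) with hm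
  have hre : ∀ t, a t = rexp (l t).re * cos (l t).im := by
    intro t; have := congrArg Complex.re (hle t); rw [Complex.exp_re] at this; exact this.symm
  have him : ∀ t, b t = rexp (l t).re * sin (l t).im := by
    intro t; have := congrArg Complex.im (hle t); rw [Complex.exp_im] at this; exact this.symm
  have hpos : ∀ t, a t ^ 2 + b t ^ 2 ≠ 0 := by
    intro t
    rw [hre, him]
    have : (rexp (l t).re * cos (l t).im) ^ 2 + (rexp (l t).re * sin (l t).im) ^ 2 =
      rexp (l t).re ^ 2 := by
      linear_combination rexp (l t).re ^ 2 * Real.sin_sq_add_cos_sq (l t).im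
    rw [this]; positivity
  set f : ℝ → ℂ := fun t => a t + b t * I with hf
  set f' : ℝ → ℂ := fun t => a' t + b' t * I with hf'
  have hfl : ∀ t, Complex.exp (l t) = f t := by
    intro t; rw [hle, hf]; apply Complex.ext <;> simp
  have hf0 : ∀ t, f t ≠ 0 := fun t => by rw [← hfl]; exact Complex.exp_ne_zero _
  have hda : Continuous a := continuous_iff_continuousAt.2 fun t => (ha t).continuousAt
  have hdb : Continuous b := continuous_iff_continuousAt.2 fun t => (hb t).continuousAt
  have hdf : ∀ t, HasDerivAt f (f' t) t := fun t =>
    (ha t).ofReal_comp.add ((hb t).ofReal_comp.mul_const I)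
  have hk : Continuous fun t => f' t / f t := by
    refine Continuous.div ?_ ?_ hf0 <;> fun_prop
  set M : ℝ → ℂ := fun t => ∫ x in (0 : ℝ)..t, f' x / f x with hM
  have hdM : ∀ t, HasDerivAt M (f' t / f t) t := fun t =>
    intervalIntegral.integral_hasDerivAt_right (hk.intervalIntegrable _ _)
      (hk.stronglyMeasurableAtFilter _ _) hk.continuousAt
  have hconst : ∀ t, f t * Complex.exp (-M t) = f 0 * Complex.exp (-M 0) := by
    intro t
    refine is_const_of_deriv_eq_zero (f := fun t => f t * Complex.exp (-M t))
      (fun t => ((hdf t).mul (hdM t).neg.cexp).differentiableAt) (fun t => ?_) t 0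
    have e : HasDerivAt (fun t => f t * Complex.exp (-M t)) _ t := (hdf t).mul (hdM t).neg.cexp
    rw [e.deriv]
    have := hf0 t
    simp only [Pi.neg_apply]
    field_simp
    ring
  have hloc : IsLocallyConstant fun t => l t - M t := by
    rw [IsLocallyConstant.iff_eventually_eq]
    intro t
    have hc : Continuous fun t => l t - M t :=
      hlc.sub (continuous_iff_continuousAt.2 fun t => (hdM t).continuousAt)
    filter_upwards [hc.continuousAt (x := t) (Metric.ball_mem_nhds _ Real.two_pi_pos)] with s hs
    have h1 : Complex.exp (l s - M s) = Complex.exp (l t - M t) := by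
      rw [sub_eq_add_neg, sub_eq_add_neg, Complex.exp_add, Complex.exp_add, hfl, hfl,
        hconst s, hconst t]
    obtain ⟨n, hn⟩ := Complex.exp_eq_exp_iff_exists_int.1 h1
    rw [mem_preimage, Metric.mem_ball, dist_eq_norm, hn] at hs
    have h2 : ‖(n : ℂ) * (2 * π * I)‖ = |(n : ℝ)| * (2 * π) := by
      simp [abs_of_pos Real.pi_pos]
    rw [add_sub_cancel_left, h2] at hs
    have h3 : |(n : ℝ)| < 1 := by
      by_contra h; push Not at h; nlinarith [Real.two_pi_pos]
    have h4 : n = 0 := Int.abs_lt_one_iff.1 (by exact_mod_cast h3)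
    rw [hn, h4]; simp
  have h5 := hloc.apply_eq_of_preconnectedSpace (2 * π) 0
  have h6 := hlp 0
  rw [zero_add] at h6
  rw [h6] at h5
  have h7 : M (2 * π) = M 0 := sub_right_injective h5
  have h8 : M 0 = 0 := by simp [hM]
  rw [h8] at h7
  have h9 := congrArg Complex.im h7
  have h10 : (M (2 * π)).im = ∫ t in (0 : ℝ)..2 * π, (f' t / f t).im :=
    (Complex.imCLM.intervalIntegral_comp_comm (hk.intervalIntegrable _ _)).symm
  rw [h10, Complex.zero_im] at h9
  refine Eq.trans ?_ h9
  refine intervalIntegral.integral_congr fun t _ => ?_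
  have e1 : Complex.normSq (f t) = a t ^ 2 + b t ^ 2 := by
    simp [hf, Complex.normSq_apply]; ring
  simp only [Complex.div_im, e1]
  simp [hf, hf']
  have := hpos t
  field_simp

end StripDivergence

section ConformalPullback

open Filter Topology Set
open Complex (I)

lemma SmAt.comp_hol {f : ℂ → ℝ} {E : ℂ → ℂ} {s : ℂ} (hf : SmAt f (E s)) (hE : AnalyticAt ℂ E s) :
    SmAt (fun z => f (E z)) s := by
  filter_upwards [hE.eventually_analyticAt, hE.continuousAt.eventually hf] with z hz hfz
  exact ContDiffAt.comp z hfz (hz.contDiffAt.restrict_scalars ℝ)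

lemma pd_comp_hol {f : ℂ → ℝ} {E : ℂ → ℂ} {s : ℂ} (hf : DifferentiableAt ℝ f (E s))
    (hE : DifferentiableAt ℂ E s) (v : ℂ) :
    pd v (fun z => f (E z)) s = pd (deriv E s * v) f (E s) := by
  have h1 : HasFDerivAt E ((fderiv ℂ E s).restrictScalars ℝ) s := hE.hasFDerivAt.restrictScalars ℝ
  have h2 : HasFDerivAt (fun z => f (E z)) _ s := hf.hasFDerivAt.comp s h1
  rw [pd, pd, h2.fderiv]
  simp [mul_comm]

lemma pd_re (v z : ℂ) : pd v Complex.re z = v.re := by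
  rw [pd, show Complex.re = Complex.reCLM from rfl, ContinuousLinearMap.fderiv]

lemma pd_im (v z : ℂ) : pd v Complex.im z = v.im := by
  rw [pd, show Complex.im = Complex.imCLM from rfl, ContinuousLinearMap.fderiv]

lemma smAt_re (z : ℂ) : SmAt Complex.re z :=
  .of_forall fun _ => Complex.reCLM.contDiff.contDiffAt

lemma smAt_im (z : ℂ) : SmAt Complex.im z :=
  .of_forall fun _ => Complex.imCLM.contDiff.contDiffAt

lemma lap2_comp_hol {f : ℂ → ℝ} {E : ℂ → ℂ} {s : ℂ} (hf : SmAt f (E s)) (hE : AnalyticAt ℂ E s) :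
    lap2 (fun z => f (E z)) s = ‖deriv E s‖ ^ 2 * lap2 f (E s) := by
  have hE' := hE.deriv
  have key : ∀ v : ℂ, pd v (fun z => f (E z)) =ᶠ[𝓝 s] fun z =>
      (deriv E z * v).re * pd 1 f (E z) + (deriv E z * v).im * pd I f (E z) := by
    intro v
    filter_upwards [hE.eventually_analyticAt, hE.continuousAt.eventually hf.ev] with z hz hfz
    rw [pd_comp_hol hfz.diff hz.differentiableAt, pd_eq]
  have key2 : ∀ v : ℂ, pd v (pd v (fun z => f (E z))) s =
      (deriv (deriv E) s * v * v).re * pd 1 f (E s) + (deriv E s * v).re *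
        ((deriv E s * v).re * pd 1 (pd 1 f) (E s) + (deriv E s * v).im * pd I (pd 1 f) (E s)) +
      ((deriv (deriv E) s * v * v).im * pd I f (E s) + (deriv E s * v).im *
        ((deriv E s * v).re * pd 1 (pd I f) (E s) + (deriv E s * v).im * pd I (pd I f) (E s))) := by
    intro v
    have a1 : AnalyticAt ℂ (fun z => deriv E z * v) s := hE'.mul analyticAt_const
    have d1 : deriv (fun z => deriv E z * v) s = deriv (deriv E) s * v :=
      deriv_mul_const hE'.differentiableAt v
    have s1 : SmAt (fun z => (deriv E z * v).re) s := SmAt.comp_hol (smAt_re _) a1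
    have s2 : SmAt (fun z => (deriv E z * v).im) s := SmAt.comp_hol (smAt_im _) a1
    have s3 : SmAt (fun z => pd 1 f (E z)) s := SmAt.comp_hol (hf.pd 1) hE
    have s4 : SmAt (fun z => pd I f (E z)) s := SmAt.comp_hol (hf.pd I) hE
    rw [pd_congr v (key v), pd_add v (s1.mul s3).diff (s2.mul s4).diff, pd_mul v s1.diff s3.diff,
      pd_mul v s2.diff s4.diff,
      pd_comp_hol (f := Complex.re) (smAt_re _).diff a1.differentiableAt,
      pd_comp_hol (f := Complex.im) (smAt_im _).diff a1.differentiableAt,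
      pd_comp_hol (hf.pd 1).diff hE.differentiableAt, pd_comp_hol (hf.pd I).diff hE.differentiableAt,
      pd_re, pd_im, d1, pd_eq (pd 1 f), pd_eq (pd I f)]
  have hn : ‖deriv E s‖ ^ 2 = (deriv E s).re ^ 2 + (deriv E s).im ^ 2 := by
    rw [Complex.sq_norm, Complex.normSq_apply]; ring
  rw [lap2, key2, key2, lap2, hn, pd_symm I 1 hf]
  simp
  ring

lemma sq_norm_re_im (z : ℂ) : ‖z‖ ^ 2 = z.re ^ 2 + z.im ^ 2 := by
  rw [Complex.sq_norm, Complex.normSq_apply]; ring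

lemma smAt_log_norm {z : ℂ} (hz : z ≠ 0) : SmAt (fun z => Real.log ‖z‖) z := by
  filter_upwards [isOpen_ne.mem_nhds hz] with x hx
  exact (contDiffAt_norm ℝ hx).log (norm_ne_zero_iff.2 hx)

lemma lap2_log_norm {z : ℂ} (hz : z ≠ 0) : lap2 (fun z => Real.log ‖z‖) z = 0 := by
  have sm : SmAt (fun z : ℂ => z.re ^ 2 + z.im ^ 2) z := ((smAt_re z).pow 2).add ((smAt_im z).pow 2)
  have e : (fun z : ℂ => Real.log ‖z‖) = fun z => 1 / 2 * Real.log (z.re ^ 2 + z.im ^ 2) := by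
    funext z
    rw [← sq_norm_re_im, Real.log_pow]; push_cast; ring
  have hq : z.re ^ 2 + z.im ^ 2 ≠ 0 := by
    rw [← sq_norm_re_im]; positivity
  rw [e, lap2_const_mul _ (sm.log hq), lap2_log sm hq]
  have p : ∀ v x : ℂ, pd v (fun z : ℂ => z.re ^ 2 + z.im ^ 2) x = 2 * x.re * v.re + 2 * x.im * v.im := by
    intro v x
    rw [pd_add v ((smAt_re x).pow 2).diff ((smAt_im x).pow 2).diff, pd_sq v (smAt_re x).diff,
      pd_sq v (smAt_im x).diff, pd_re, pd_im]
  rw [lap2, show pd 1 (fun z : ℂ => z.re ^ 2 + z.im ^ 2) = fun x => 2 * x.re by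
    funext x; rw [p]; simp, show pd I (fun z : ℂ => z.re ^ 2 + z.im ^ 2) = fun x => 2 * x.im by
    funext x; rw [p]; simp, pd_const_mul _ _ (smAt_re z).diff, pd_const_mul _ _ (smAt_im z).diff,
    pd_re, pd_im]
  field_simp
  simp
  ring

end ConformalPullback

section ExponentialCoordinates

open Filter Topology Set Metric
open Complex (I)

lemma integrableOn_image_hol {E : ℂ → ℂ} {S : Set ℂ} (hS : MeasurableSet S)
    (hE : ∀ s ∈ S, DifferentiableAt ℂ E s) (hinj : InjOn E S) (h : ℂ → ℝ) :
    (IntegrableOn h (E '' S) ↔ IntegrableOn (fun s => ‖deriv E s‖ ^ 2 * h (E s)) S) ∧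
    ∫ z in E '' S, h z = ∫ s in S, ‖deriv E s‖ ^ 2 * h (E s) := by
  have h1 : ∀ s ∈ S, HasFDerivWithinAt E ((fderiv ℂ E s).restrictScalars ℝ) S s := fun s hs =>
    ((hE s hs).hasFDerivAt.restrictScalars ℝ).hasFDerivWithinAt
  have h2 : ∀ s, |((fderiv ℂ E s).restrictScalars ℝ).det| = ‖deriv E s‖ ^ 2 := by
    intro s
    have : (((fderiv ℂ E s).restrictScalars ℝ : ℂ →L[ℝ] ℂ) : ℂ →ₗ[ℝ] ℂ) =
        ((fderiv ℂ E s : ℂ →ₗ[ℂ] ℂ)).restrictScalars ℝ := rfl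
    rw [ContinuousLinearMap.det, this, LinearMap.det_restrictScalars, LinearMap.det_ring]
    simp [Algebra.norm_complex_eq, Complex.normSq_eq_norm_sq]
  have a := integrableOn_image_iff_integrableOn_abs_det_fderiv_smul volume hS h1 hinj h
  have b := integral_image_eq_integral_abs_det_fderiv_smul volume hS h1 hinj h
  simp only [h2, smul_eq_mul] at a b
  exact ⟨a, b⟩

/-- A conformal embedding of the unit disc. -/
structure DiscMap (φ : ℂ → ℂ) : Prop where
  hol : DifferentiableOn ℂ φ (ball 0 1)
  inj : InjOn φ (ball 0 1)
  ne : ∀ z ∈ ball (0 : ℂ) 1, deriv φ z ≠ 0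

/-- A disc map in logarithmic coordinates. -/
noncomputable def lmap (φ : ℂ → ℂ) (s : ℂ) : ℂ := φ (Complex.exp s)

variable {φ : ℂ → ℂ} {s : ℂ}

lemma exp_mem_ball (hs : s.re < 0) : Complex.exp s ∈ ball (0 : ℂ) 1 := by
  rw [mem_ball_zero_iff, Complex.norm_exp]; rwa [Real.exp_lt_one_iff]

lemma lmap_periodic (φ : ℂ → ℂ) (s : ℂ) : lmap φ (s + 2 * π * I) = lmap φ s := by
  rw [lmap, lmap, Complex.exp_periodic]

lemma DiscMap.analyticAt (h : DiscMap φ) {z : ℂ} (hz : z ∈ ball (0 : ℂ) 1) : AnalyticAt ℂ φ z :=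
  h.hol.analyticAt (isOpen_ball.mem_nhds hz)

lemma DiscMap.lmap_analyticAt (h : DiscMap φ) (hs : s.re < 0) : AnalyticAt ℂ (lmap φ) s :=
  (h.analyticAt (exp_mem_ball hs)).comp analyticAt_cexp

lemma DiscMap.deriv_lmap (h : DiscMap φ) (hs : s.re < 0) :
    deriv (lmap φ) s = deriv φ (Complex.exp s) * Complex.exp s :=
  ((h.analyticAt (exp_mem_ball hs)).differentiableAt.hasDerivAt.comp s
    (Complex.hasDerivAt_exp s)).deriv

lemma DiscMap.deriv_lmap_ne (h : DiscMap φ) (hs : s.re < 0) : deriv (lmap φ) s ≠ 0 := by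
  rw [h.deriv_lmap hs]; exact mul_ne_zero (h.ne _ (exp_mem_ball hs)) (Complex.exp_ne_zero _)

/-- The half-infinite fundamental strip. -/
def halfStrip : Set ℂ := {s | s.re < 0 ∧ 0 < s.im ∧ s.im ≤ 2 * π}

lemma measurableSet_halfStrip : MeasurableSet halfStrip :=
  (measurableSet_lt Complex.measurable_re measurable_const).inter
    ((measurableSet_lt measurable_const Complex.measurable_im).inter
      (measurableSet_le Complex.measurable_im measurable_const))

lemma DiscMap.lmap_injOn (h : DiscMap φ) : InjOn (lmap φ) halfStrip := by
  intro s hs t ht e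
  have e1 := h.inj (exp_mem_ball hs.1) (exp_mem_ball ht.1) e
  obtain ⟨n, hn⟩ := Complex.exp_eq_exp_iff_exists_int.1 e1
  have h2 := congrArg Complex.im hn
  simp at h2
  have h3 : |(n : ℝ)| < 1 := by
    rw [abs_lt]
    have := hs.2; have := ht.2; have := Real.two_pi_pos
    constructor <;> nlinarith
  have h4 : n = 0 := Int.abs_lt_one_iff.1 (by exact_mod_cast h3)
  rw [hn, h4]; simp

lemma lmap_image_subset (φ : ℂ → ℂ) {S : Set ℂ} (hS : S ⊆ halfStrip) :
    lmap φ '' S ⊆ φ '' ball 0 1 := by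
  rintro _ ⟨s, hs, rfl⟩
  exact ⟨_, exp_mem_ball (hS hs).1, rfl⟩

lemma DiscMap.integrableOn_lmap (hφ : DiscMap φ) {S : Set ℂ} (hS : MeasurableSet S)
    (hS' : S ⊆ halfStrip) {h : ℂ → ℝ} (hi : IntegrableOn h (φ '' ball 0 1)) :
    IntegrableOn (fun s => ‖deriv (lmap φ) s‖ ^ 2 * h (lmap φ s)) S :=
  (integrableOn_image_hol hS (fun _ hs => (hφ.lmap_analyticAt (hS' hs).1).differentiableAt)
    (hφ.lmap_injOn.mono hS') h).1.1 (hi.mono_set (lmap_image_subset φ hS'))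

lemma DiscMap.setIntegral_lmap_le (hφ : DiscMap φ) {S : Set ℂ} (hS : MeasurableSet S)
    (hS' : S ⊆ halfStrip) {h : ℂ → ℝ} (hi : IntegrableOn h (φ '' ball 0 1)) (h0 : ∀ z, 0 ≤ h z) :
    ∫ s in S, ‖deriv (lmap φ) s‖ ^ 2 * h (lmap φ s) ≤ ∫ z in φ '' ball 0 1, h z := by
  rw [← (integrableOn_image_hol hS (fun _ hs => (hφ.lmap_analyticAt (hS' hs).1).differentiableAt)
    (hφ.lmap_injOn.mono hS') h).2]
  exact setIntegral_mono_set hi (.of_forall h0) (lmap_image_subset φ hS').eventuallyLE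

lemma pRect_subset_halfStrip {a b : ℝ} (hb : b < 0) : pRect a b ⊆ halfStrip := fun _ hs =>
  ⟨hs.1.2.trans_lt hb, hs.2.1, hs.2.2⟩

/-- The tail of the area vanishes near the boundary. -/
lemma DiscMap.exists_tail_lt (hφ : DiscMap φ) (hb : Bornology.IsBounded (φ '' ball 0 1)) {ε : ℝ}
    (hε : 0 < ε) : ∃ a₀ : ℝ, a₀ < 0 ∧ ∀ a b : ℝ, a₀ ≤ a → b < 0 →
      ∫ s in pRect a b, ‖deriv (lmap φ) s‖ ^ 2 < ε := by
  have hi : IntegrableOn (fun _ : ℂ => (1 : ℝ)) (φ '' ball 0 1) :=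
    integrableOn_const hb.measure_lt_top.ne
  have hI := hφ.integrableOn_lmap measurableSet_halfStrip subset_rfl hi
  simp only [mul_one] at hI
  set T : ℕ → Set ℂ := fun n => halfStrip ∩ {s | -(1 / ((n : ℝ) + 1)) < s.re} with hT
  have hTm : ∀ n, MeasurableSet (T n) := fun n =>
    measurableSet_halfStrip.inter (measurableSet_lt measurable_const Complex.measurable_re)
  have hanti : Antitone T := by
    intro m n hmn s hs
    refine ⟨hs.1, ?_⟩
    have h2 : -(1 / ((n : ℝ) + 1)) < s.re := hs.2
    change -(1 / ((m : ℝ) + 1)) < s.re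
    have : 1 / ((n : ℝ) + 1) ≤ 1 / ((m : ℝ) + 1) := Nat.one_div_le_one_div hmn
    linarith
  have hemp : ⋂ n, T n = ∅ := by
    rw [eq_empty_iff_forall_notMem]
    intro s hs
    rw [mem_iInter] at hs
    obtain ⟨n, hn⟩ := exists_nat_one_div_lt (show 0 < -s.re by have := (hs 0).1.1; linarith)
    have : -(1 / ((n : ℝ) + 1)) < s.re := (hs n).2
    linarith
  have ht := tendsto_setIntegral_of_antitone hTm hanti ⟨0, hI.mono_set inter_subset_left⟩
  rw [hemp, setIntegral_empty] at ht
  obtain ⟨n, hn⟩ := (ht.eventually (gt_mem_nhds hε)).exists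
  refine ⟨-(1 / ((n : ℝ) + 1)), by have : 0 < 1 / ((n : ℝ) + 1) := by positivity
                                   linarith, fun a b ha hb => lt_of_le_of_lt ?_ hn⟩
  refine setIntegral_mono_set (hI.mono_set inter_subset_left) (.of_forall fun s => by positivity)
    (LE.le.eventuallyLE ?_)
  intro s hs
  exact ⟨pRect_subset_halfStrip hb hs, ha.trans_lt hs.1.1⟩

end ExponentialCoordinates

section LogDensity

open Filter Topology Set Metric
open Complex (I)

variable {φ : ℂ → ℂ} {v₁ v₂ F : ℂ → ℝ} {s : ℂ}

lemma continuous_line {h : ℂ → ℝ} {a : ℝ} (hh : ∀ s : ℂ, s.re = a → ContinuousAt h s) :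
    Continuous fun t : ℝ => h (a + t * I) := by
  refine continuous_iff_continuousAt.2 fun t => ?_
  have h1 : Continuous fun t : ℝ => (a : ℂ) + t * I := by fun_prop
  exact ContinuousAt.comp (f := fun t : ℝ => (a : ℂ) + t * I) (hh _ (by simp)) h1.continuousAt

lemma enorm2_pos_of_lt {z : ℂ} (h : v₁ z < v₂ z) : 0 < enorm2 v₁ v₂ z := by
  have h1 : 0 < ediff v₁ v₂ z := sub_pos.2 (Real.exp_lt_exp.2 h)
  rw [enorm2]; positivity

/-- Logarithm of the pulled back density in logarithmic coordinates. -/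
noncomputable def ldens (φ : ℂ → ℂ) (v₁ v₂ : ℂ → ℝ) (s : ℂ) : ℝ :=
  1 / 2 * Real.log (enorm2 v₁ v₂ (lmap φ s)) + Real.log ‖deriv (lmap φ) s‖

lemma ldens_periodic (s : ℂ) : ldens φ v₁ v₂ (s + 2 * π * I) = ldens φ v₁ v₂ s := by
  have : deriv (lmap φ) (s + 2 * π * I) = deriv (lmap φ) s := by
    rw [← deriv_comp_add_const]
    simp only [lmap_periodic]
  rw [ldens, ldens, lmap_periodic, this]

lemma lmap_mem (φ : ℂ → ℂ) (hs : s.re < 0) : lmap φ s ∈ φ '' ball 0 1 :=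
  ⟨_, exp_mem_ball hs, rfl⟩

lemma smAt_ldens (hφ : DiscMap φ) (h : LPair v₁ v₂ F) (hpos : ∀ z ∈ φ '' ball 0 1, v₁ z < v₂ z)
    (hs : s.re < 0) : SmAt (ldens φ v₁ v₂) s := by
  have h1 : SmAt (fun s => enorm2 v₁ v₂ (lmap φ s)) s := (h.smN _).comp_hol (hφ.lmap_analyticAt hs)
  have h2 : SmAt (fun s => Real.log ‖deriv (lmap φ) s‖) s :=
    SmAt.comp_hol (smAt_log_norm (hφ.deriv_lmap_ne hs)) (hφ.lmap_analyticAt hs).deriv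
  exact ((SmAt.const (1 / 2) s).mul
    (h1.log (enorm2_pos_of_lt (hpos _ (lmap_mem φ hs))).ne')).add h2

lemma lap2_ldens (hφ : DiscMap φ) (h : LPair v₁ v₂ F) (hpos : ∀ z ∈ φ '' ball 0 1, v₁ z < v₂ z)
    (hs : s.re < 0) : ‖deriv (lmap φ) s‖ ^ 2 * (-(1 / 2) * etot v₁ v₂ (lmap φ s) +
      F (lmap φ s) * ediff v₁ v₂ (lmap φ s) ^ 2 / enorm2 v₁ v₂ (lmap φ s)) ≤
    lap2 (ldens φ v₁ v₂) s := by
  have hN := enorm2_pos_of_lt (hpos _ (lmap_mem φ hs))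
  have ha := hφ.lmap_analyticAt hs
  have h1 : SmAt (fun z => Real.log (enorm2 v₁ v₂ z)) (lmap φ s) := (h.smN _).log hN.ne'
  have h2 : SmAt (fun s => Real.log ‖deriv (lmap φ) s‖) s :=
    SmAt.comp_hol (smAt_log_norm (hφ.deriv_lmap_ne hs)) ha.deriv
  have e : lap2 (ldens φ v₁ v₂) s =
      1 / 2 * (‖deriv (lmap φ) s‖ ^ 2 * lap2 (fun z => Real.log (enorm2 v₁ v₂ z)) (lmap φ s)) := by
    rw [show ldens φ v₁ v₂ = fun s => 1 / 2 * (fun s => Real.log (enorm2 v₁ v₂ (lmap φ s))) s +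
      Real.log ‖deriv (lmap φ) s‖ from rfl,
      lap2_add ((SmAt.const _ s).mul (h1.comp_hol ha)) h2, lap2_const_mul _ (h1.comp_hol ha),
      lap2_comp_hol h1 ha, lap2_comp_hol (f := fun z => Real.log ‖z‖)
      (smAt_log_norm (hφ.deriv_lmap_ne hs)) ha.deriv, lap2_log_norm (hφ.deriv_lmap_ne hs)]
    ring
  rw [e]
  have k := h.lap_log_enorm2 hN
  have := mul_le_mul_of_nonneg_left k (sq_nonneg ‖deriv (lmap φ) s‖)
  refine le_trans (le_of_eq ?_) (mul_le_mul_of_nonneg_left this (by norm_num : (0 : ℝ) ≤ 1 / 2))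
  ring

lemma exists_flux_near (hφ : DiscMap φ) (h : LPair v₁ v₂ F) (hpos : ∀ z ∈ φ '' ball 0 1, v₁ z < v₂ z)
    (B : ℝ) {ε : ℝ} (hε : 0 < ε) : ∃ a : ℝ, a < 0 ∧ a ≤ B ∧
    2 * π - ε ≤ ∫ t in (0 : ℝ)..2 * π, pd 1 (ldens φ v₁ v₂) (a + t * I) := by
  set g : ℂ → ℝ := fun z => 1 / 2 * Real.log (enorm2 v₁ v₂ (φ z)) + Real.log ‖deriv φ z‖ with hg
  have hgsm : ∀ z ∈ ball (0 : ℂ) 1, SmAt g z := by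
    intro z hz
    have h1 : SmAt (fun s => enorm2 v₁ v₂ (φ s)) z := (h.smN _).comp_hol (hφ.analyticAt hz)
    have h2 : SmAt (fun s => Real.log ‖deriv φ s‖) z :=
      SmAt.comp_hol (smAt_log_norm (hφ.ne z hz)) (hφ.analyticAt hz).deriv
    exact ((SmAt.const (1 / 2) z).mul
      (h1.log (enorm2_pos_of_lt (hpos _ ⟨z, hz, rfl⟩)).ne')).add h2
  have hgl : ∀ s : ℂ, s.re < 0 → ldens φ v₁ v₂ s = g (Complex.exp s) + s.re := by
    intro s hs
    rw [ldens, hφ.deriv_lmap hs, norm_mul, Real.log_mul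
      (norm_ne_zero_iff.2 (hφ.ne _ (exp_mem_ball hs))) (norm_ne_zero_iff.2 (Complex.exp_ne_zero _)),
      Complex.norm_exp, Real.log_exp, hg]
    simp only [lmap]; ring
  have hpd : ∀ s : ℂ, s.re < 0 →
      pd 1 (ldens φ v₁ v₂) s = pd (Complex.exp s) g (Complex.exp s) + 1 := by
    intro s hs
    have ev : ldens φ v₁ v₂ =ᶠ[𝓝 s] fun s => g (Complex.exp s) + s.re := by
      filter_upwards [(isOpen_Iio.preimage Complex.continuous_re).mem_nhds hs] with t ht
        using hgl t ht
    have hs1 := hgsm _ (exp_mem_ball hs)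
    rw [pd_congr _ ev, pd_add _ (hs1.comp_hol analyticAt_cexp).diff (smAt_re s).diff,
      pd_comp_hol hs1.diff Complex.differentiableAt_exp, pd_re, Complex.deriv_exp]
    simp
  have hcont : ContinuousAt (fderiv ℝ g) 0 :=
    ((hgsm 0 (by simp)).cd.fderiv_right (m := ∞) (by simp)).continuousAt
  set K := ‖fderiv ℝ g 0‖ + 1 with hK
  have hK0 : 0 < K := by positivity
  have hKb : ∀ᶠ z in 𝓝 (0 : ℂ), ‖fderiv ℝ g z‖ < K :=
    hcont.norm.eventually (gt_mem_nhds (by simp [hK]))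
  obtain ⟨δ, hδ, hδb⟩ := Metric.eventually_nhds_iff.1 hKb
  have hlim := Real.tendsto_exp_atBot
  have hev : ∀ᶠ a : ℝ in atBot, a < 0 ∧ a ≤ B ∧ rexp a < δ ∧ rexp a < ε / (K * (2 * π)) := by
    filter_upwards [eventually_lt_atBot 0, eventually_le_atBot B, hlim.eventually (gt_mem_nhds hδ),
      hlim.eventually (gt_mem_nhds (show 0 < ε / (K * (2 * π)) by positivity))] with a h1 h2 h3 h4
      using ⟨h1, h2, h3, h4⟩
  obtain ⟨a, ha, haB, haδ, haε⟩ := hev.exists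
  refine ⟨a, ha, haB, ?_⟩
  have hre : ∀ t : ℝ, ((a : ℂ) + t * I).re = a := by intro t; simp
  have hn : ∀ t : ℝ, ‖Complex.exp (a + t * I)‖ = rexp a := by
    intro t; rw [Complex.norm_exp, hre]
  have hlow : ∀ t : ℝ, 1 - K * rexp a ≤ pd 1 (ldens φ v₁ v₂) (a + t * I) := by
    intro t
    rw [hpd _ (by rw [hre]; exact ha)]
    have h1 := (fderiv ℝ g (Complex.exp (a + t * I))).le_opNorm (Complex.exp (a + t * I))
    have h2 := hδb (show dist (Complex.exp (a + t * I)) 0 < δ by rw [dist_zero_right, hn]; exact haδ)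
    rw [hn, Real.norm_eq_abs] at h1
    have h3 := neg_abs_le (fderiv ℝ g (Complex.exp (a + t * I)) (Complex.exp (a + t * I)))
    have h4 : ‖fderiv ℝ g (Complex.exp (a + t * I))‖ * rexp a ≤ K * rexp a := by gcongr
    rw [pd]
    linarith
  have hc : Continuous fun t : ℝ => pd 1 (ldens φ v₁ v₂) (a + t * I) :=
    continuous_line fun s hs => ((smAt_ldens hφ h hpos (by rw [hs]; exact ha)).pd 1).continuousAt
  have hm := intervalIntegral.integral_mono_on Real.two_pi_pos.le
    (continuous_const.intervalIntegrable (μ := volume) 0 (2 * π)) (hc.intervalIntegrable _ _)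
    fun t _ => hlow t
  rw [intervalIntegral.integral_const] at hm
  refine le_trans ?_ hm
  rw [lt_div_iff₀ (by positivity)] at haε
  simp only [sub_zero, smul_eq_mul]
  linarith

end LogDensity

section LogFlux

open Filter Topology Set Metric
open Complex (I)

variable {φ : ℂ → ℂ} {v₁ v₂ F : ℂ → ℝ} {s : ℂ}

/-- Difference of the two functions in logarithmic coordinates. -/
noncomputable def ldiff (φ : ℂ → ℂ) (v₁ v₂ : ℂ → ℝ) (s : ℂ) : ℝ := v₂ (lmap φ s) - v₁ (lmap φ s)

lemma smAt_ldiff (hφ : DiscMap φ) (h : LPair v₁ v₂ F)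
    (hs : s.re < 0) : SmAt (ldiff φ v₁ v₂) s :=
  SmAt.comp_hol (f := fun z => v₂ z - v₁ z) (h.smw _) (hφ.lmap_analyticAt hs)


lemma ldiff_grad (hφ : DiscMap φ) (h : LPair v₁ v₂ F)
    (hs : s.re < 0) :
    pd 1 (ldiff φ v₁ v₂) s ^ 2 + pd I (ldiff φ v₁ v₂) s ^ 2 =
      ‖deriv (lmap φ) s‖ ^ 2 * ‖cgrad (fun z => v₂ z - v₁ z) (lmap φ s)‖ ^ 2 := by
  have e : ∀ v, pd v (ldiff φ v₁ v₂) s = pd (deriv (lmap φ) s * v) (fun z => v₂ z - v₁ z) (lmap φ s) :=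
    fun v => pd_comp_hol (f := fun z => v₂ z - v₁ z) (h.smw _).diff
      (hφ.lmap_analyticAt hs).differentiableAt v
  rw [e, e, pd_eq, pd_eq _ _ (_ * I), sq_norm_cgrad, sq_norm_re_im]
  simp
  ring

lemma cgrad_disc (hφ : DiscMap φ) (h : LPair v₁ v₂ F)
    {z : ℂ} (hz : z ∈ ball (0 : ℂ) 1) :
    cgrad (fun z => v₂ (φ z) - v₁ (φ z)) z =
      (starRingEnd ℂ) (deriv φ z) * cgrad (fun z => v₂ z - v₁ z) (φ z) := by
  have e : ∀ v, pd v (fun z => v₂ (φ z) - v₁ (φ z)) z = pd (deriv φ z * v) (fun z => v₂ z - v₁ z) (φ z) :=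
    fun v => pd_comp_hol (f := fun z => v₂ z - v₁ z) (h.smw _).diff
      (hφ.analyticAt hz).differentiableAt v
  rw [cgrad, e, e, pd_eq, pd_eq _ _ (_ * I), cgrad]
  apply Complex.ext <;> simp
  ring

lemma ldiff_curve (hφ : DiscMap φ) (h : LPair v₁ v₂ F)
    (hs : s.re < 0) :
    (starRingEnd ℂ) (Complex.exp s) * cgrad (fun z => v₂ (φ z) - v₁ (φ z)) (Complex.exp s) =
      ⟨pd 1 (ldiff φ v₁ v₂) s, pd I (ldiff φ v₁ v₂) s⟩ := by
  have hz := exp_mem_ball hs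
  have hsm : SmAt (fun z => v₂ (φ z) - v₁ (φ z)) (Complex.exp s) :=
    SmAt.comp_hol (h.smw _) (hφ.analyticAt hz)
  have e : ∀ v, pd v (ldiff φ v₁ v₂) s =
      pd (Complex.exp s * v) (fun z => v₂ (φ z) - v₁ (φ z)) (Complex.exp s) := by
    intro v
    have := pd_comp_hol (f := fun z => v₂ (φ z) - v₁ (φ z)) hsm.diff
      (Complex.differentiableAt_exp (x := s)) v
    rw [Complex.deriv_exp] at this
    exact this
  rw [e, e, pd_eq, pd_eq _ _ (_ * I), cgrad]
  apply Complex.ext <;> simp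
  ring

lemma lap2_ldiff (hφ : DiscMap φ) (h : LPair v₁ v₂ F)
    (hs : s.re < 0) : lap2 (ldiff φ v₁ v₂) s =
    ‖deriv (lmap φ) s‖ ^ 2 * lap2 (fun z => v₂ z - v₁ z) (lmap φ s) :=
  lap2_comp_hol (f := fun z => v₂ z - v₁ z) (h.smw _) (hφ.lmap_analyticAt hs)

lemma pd_periodic {f : ℂ → ℝ} (hf : ∀ s, f (s + 2 * π * I) = f s) (v s : ℂ) :
    pd v f (s + 2 * π * I) = pd v f s := by
  rw [pd, pd, ← fderiv_comp_add_right]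
  simp only [hf]

lemma ldens_flux (hφ : DiscMap φ) (h : LPair v₁ v₂ F) (hpos : ∀ z ∈ φ '' ball 0 1, v₁ z < v₂ z)
    (hb : Bornology.IsBounded (φ '' ball 0 1)) (hmass : ∫ z in φ '' ball 0 1, etot v₁ v₂ z ≤ 4 * π) :
    ∃ c : ℝ, 0 < c ∧ ∀ b : ℝ, -1 ≤ b → b < 0 →
      c ≤ ∫ t in (0 : ℝ)..2 * π, pd 1 (ldens φ v₁ v₂) (b + t * I) := by
  set q : ℂ → ℝ := fun s => ‖deriv (lmap φ) s‖ ^ 2 *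
    (F (lmap φ s) * ediff v₁ v₂ (lmap φ s) ^ 2 / enorm2 v₁ v₂ (lmap φ s)) with hq
  have hqpos : ∀ s : ℂ, s.re < 0 → 0 < q s := by
    intro s hs
    have h1 := enorm2_pos_of_lt (hpos _ (lmap_mem φ hs))
    have h2 := h.pos (lmap φ s)
    have h3 : 0 < ediff v₁ v₂ (lmap φ s) := sub_pos.2 (Real.exp_lt_exp.2 (hpos _ (lmap_mem φ hs)))
    have h4 := norm_pos_iff.2 (hφ.deriv_lmap_ne hs)
    positivity
  have hEc : ∀ s : ℂ, s.re < 0 → ContinuousAt (fun s => ‖deriv (lmap φ) s‖ ^ 2) s := fun s hs =>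
    ((hφ.lmap_analyticAt hs).deriv.continuousAt.norm).pow 2
  have hTc : ∀ s : ℂ, s.re < 0 → ContinuousAt (fun s => etot v₁ v₂ (lmap φ s)) s := fun s hs =>
    (SmAt.comp_hol (h.smT _) (hφ.lmap_analyticAt hs)).continuousAt
  have hFs : ∀ z, ContinuousAt F z := by
    intro z
    have : F = fun z => lap2 v₁ z + Real.exp (v₁ z) ^ 2 := by
      funext z; rw [h.eq1]; ring
    rw [this]
    exact ((h.sm1 z).lap2.add ((h.sm1 z).exp.pow 2)).continuousAt
  have hqc : ∀ s : ℂ, s.re < 0 → ContinuousAt q s := by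
    intro s hs
    have ha := (hφ.lmap_analyticAt hs).continuousAt
    refine (hEc s hs).mul ((ContinuousAt.mul ?_ ?_).div ?_ (enorm2_pos_of_lt (hpos _ (lmap_mem φ hs))).ne')
    · exact ContinuousAt.comp (g := F) (hFs _) ha
    · exact (SmAt.comp_hol (h.smD _) (hφ.lmap_analyticAt hs)).continuousAt.pow 2
    · exact (SmAt.comp_hol (h.smN _) (hφ.lmap_analyticAt hs)).continuousAt
  have hq0 : ∀ a b, b < 0 → IntegrableOn q (pRect a b) := fun a b hb0 =>
    integrableOn_pRect fun s _ hs => hqc s (hs.trans_lt hb0)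
  refine ⟨∫ s in pRect (-2) (-1), q s, ?_, ?_⟩
  · rw [setIntegral_pos_iff_support_of_nonneg_ae]
    · refine lt_of_lt_of_le ?_ (measure_mono (s := Ioo (-2) (-1) ×ℂ Ioo 0 (2 * π)) ?_)
      · refine IsOpen.measure_pos _ (isOpen_Ioo.reProdIm isOpen_Ioo) ⟨⟨-3 / 2, π⟩, ?_⟩
        have := Real.pi_pos
        refine ⟨⟨?_, ?_⟩, ⟨?_, ?_⟩⟩ <;> simp only <;> linarith
      · intro s hs
        have h1 := hs.1; have h2 := hs.2
        refine ⟨(hqpos s ?_).ne', ⟨⟨h1.1, h1.2.le⟩, ⟨h2.1, h2.2.le⟩⟩⟩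
        have : s.re < -1 := h1.2
        linarith
    · refine (ae_restrict_iff' (measurableSet_pRect _ _)).2 (.of_forall fun s hs => (hqpos s ?_).le)
      have : s.re ≤ -1 := hs.1.2
      linarith
    · exact hq0 _ _ (by norm_num)
  intro b hb1 hb0
  refine le_of_forall_pos_le_add fun ε hε => ?_
  obtain ⟨a, ha0, haB, hflux⟩ := exists_flux_near hφ h hpos (-2) hε
  have hab : a ≤ b := by linarith
  have hre : ∀ s : ℂ, s.re ≤ b → s.re < 0 := fun s hs => hs.trans_lt hb0
  have hdiv := strip_div' (f := pd 1 (ldens φ v₁ v₂)) (g := pd I (ldens φ v₁ v₂)) hab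
    (fun s _ hs => (smAt_ldens hφ h hpos (hre s hs)).pd 1)
    (fun s _ hs => (smAt_ldens hφ h hpos (hre s hs)).pd I) (pd_periodic ldens_periodic I)
  have hTint : IntegrableOn (etot v₁ v₂) (φ '' ball 0 1) := by
    obtain ⟨R, hR⟩ := hb.subset_closedBall 0
    refine IntegrableOn.mono_set ?_ hR
    exact ContinuousOn.integrableOn_compact (isCompact_closedBall _ _)
      fun z _ => (h.smT z).continuousAt.continuousWithinAt
  have hT := hφ.setIntegral_lmap_le (measurableSet_pRect a b) (pRect_subset_halfStrip hb0) hTint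
    (fun z => by rw [etot]; positivity)
  have hTi : IntegrableOn (fun s => ‖deriv (lmap φ) s‖ ^ 2 * etot v₁ v₂ (lmap φ s)) (pRect a b) :=
    integrableOn_pRect fun s _ hs => (hEc s (hre s hs)).mul (hTc s (hre s hs))
  have hmono : ∫ s in pRect a b, (q s - 1 / 2 * (‖deriv (lmap φ) s‖ ^ 2 * etot v₁ v₂ (lmap φ s))) ≤
      ∫ s in pRect a b, (pd 1 (pd 1 (ldens φ v₁ v₂)) s + pd I (pd I (ldens φ v₁ v₂)) s) := by
    refine setIntegral_mono_on ((hq0 a b hb0).sub (hTi.const_mul _))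
      (integrableOn_pRect fun s _ hs => (smAt_ldens hφ h hpos (hre s hs)).lap2.continuousAt)
      (measurableSet_pRect a b) fun s hs => ?_
    refine le_trans (le_of_eq ?_) (lap2_ldens hφ h hpos (hre s hs.1.2))
    simp only [hq]; ring
  rw [integral_sub (hq0 a b hb0) (hTi.const_mul _), integral_const_mul] at hmono
  have hqm : ∫ s in pRect (-2) (-1), q s ≤ ∫ s in pRect a b, q s := by
    refine setIntegral_mono_set (hq0 a b hb0) ?_ (LE.le.eventuallyLE fun s hs => ?_)
    · exact (ae_restrict_iff' (measurableSet_pRect _ _)).2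
        (.of_forall fun s hs => (hqpos s (hre s hs.1.2)).le)
    · exact ⟨⟨haB.trans_lt hs.1.1, hs.1.2.trans hb1⟩, hs.2⟩
  linarith

end LogFlux

section GradientGrowth

open Filter Topology Set Metric
open Complex (I)

variable {φ : ℂ → ℂ} {v₁ v₂ F : ℂ → ℝ} {s : ℂ}

/-- Squared gradient of `ldiff`. -/
noncomputable def lgrad (φ : ℂ → ℂ) (v₁ v₂ : ℂ → ℝ) (s : ℂ) : ℝ :=
  pd 1 (ldiff φ v₁ v₂) s ^ 2 + pd I (ldiff φ v₁ v₂) s ^ 2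

lemma annulus_estimate {σ x : ℝ} (h1 : -1 ≤ σ) (h0 : σ < 0) (hx : 0 ≤ x) :
    x * (1 - rexp σ ^ 2) ≤ 6 * (-σ) * (x * rexp σ) := by
  have e1 : 1 + σ ≤ rexp σ := by linarith [Real.add_one_le_exp σ]
  have e2 : rexp σ < 1 := Real.exp_lt_one_iff.2 h0
  have e3 : rexp (-1) ≤ rexp σ := Real.exp_le_exp.2 h1
  have e4 : (1 : ℝ) / 3 ≤ rexp (-1) := by
    rw [Real.exp_neg, one_div]
    exact inv_anti₀ (Real.exp_pos 1) (by linarith [Real.exp_one_lt_d9])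
  have e5 : 1 - rexp σ ^ 2 ≤ 6 * (-σ) * rexp σ := by nlinarith
  nlinarith

lemma grad_log_growth (hφ : DiscMap φ) (h : LPair v₁ v₂ F) {C a b : ℝ} (hab : a ≤ b) (ha : -1 ≤ a)
    (hb : b < 0) (hC : 0 ≤ C)
    (hne : ∀ s : ℂ, a ≤ s.re → s.re < 0 → cgrad (fun z => v₂ z - v₁ z) (lmap φ s) ≠ 0)
    (hlap : ∀ s : ℂ, a ≤ s.re → s.re < 0 → |lap2 (fun z => v₂ z - v₁ z) (lmap φ s)| ≤
      C * (‖deriv φ (Complex.exp s)‖ * (1 - ‖Complex.exp s‖ ^ 2)) *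
        ‖cgrad (fun z => v₂ z - v₁ z) (lmap φ s)‖)
    (hpl : ∀ σ : ℝ, a ≤ σ → σ < 0 → PLog (fun t : ℝ =>
      (⟨pd 1 (ldiff φ v₁ v₂) (σ + t * I), pd I (ldiff φ v₁ v₂) (σ + t * I)⟩ : ℂ))) :
    (∫ t in (0 : ℝ)..2 * π, 1 / 2 * Real.log (lgrad φ v₁ v₂ (b + t * I))) -
      (∫ t in (0 : ℝ)..2 * π, 1 / 2 * Real.log (lgrad φ v₁ v₂ (a + t * I))) ≤
      6 * C * (-a) * ∫ s in pRect a b, ‖deriv (lmap φ) s‖ ^ 2 := by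
  set W := ldiff φ v₁ v₂ with hW
  set w : ℂ → ℝ := fun z => v₂ z - v₁ z with hw
  have hWs : ∀ s : ℂ, s.re < 0 → SmAt W s := fun s hs => smAt_ldiff hφ h hs
  have hgr : ∀ s : ℂ, s.re < 0 → lgrad φ v₁ v₂ s =
      ‖deriv (lmap φ) s‖ ^ 2 * ‖cgrad w (lmap φ s)‖ ^ 2 := fun s hs => ldiff_grad hφ h hs
  have hgpos : ∀ s : ℂ, a ≤ s.re → s.re < 0 → 0 < lgrad φ v₁ v₂ s := by
    intro s h1 h2
    have := norm_pos_iff.2 (hφ.deriv_lmap_ne h2)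
    have := norm_pos_iff.2 (hne s h1 h2)
    rw [hgr s h2]; positivity
  have hgs : ∀ s : ℂ, s.re < 0 → SmAt (lgrad φ v₁ v₂) s := fun s hs =>
    (((hWs s hs).pd 1).pow 2).add (((hWs s hs).pd I).pow 2)
  have hls : ∀ s : ℂ, a ≤ s.re → s.re < 0 → SmAt (fun s => 1 / 2 * Real.log (lgrad φ v₁ v₂ s)) s :=
    fun s h1 h2 => (SmAt.const _ s).mul ((hgs s h2).log (hgpos s h1 h2).ne')
  -- the two pieces of the logarithmic derivative
  set P : ℂ → ℝ := fun s => pd 1 W s * lap2 W s / lgrad φ v₁ v₂ s with hP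
  set Q : ℂ → ℝ := fun s => (pd 1 W s * pd I (pd I W) s - pd I W s * pd I (pd 1 W) s) /
    (pd 1 W s ^ 2 + pd I W s ^ 2) with hQ
  have hder : ∀ s : ℂ, a ≤ s.re → s.re < 0 →
      pd 1 (fun s => 1 / 2 * Real.log (lgrad φ v₁ v₂ s)) s = P s - Q s := by
    intro s h1 h2
    have hx := (hWs s h2).pd 1
    have hy := (hWs s h2).pd I
    have hp := hgpos s h1 h2
    rw [pd_const_mul _ _ ((hgs s h2).log hp.ne').diff, pd_log _ (hgs s h2).diff hp.ne']
    have e : pd 1 (lgrad φ v₁ v₂) s =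
        2 * pd 1 W s * pd 1 (pd 1 W) s + 2 * pd I W s * pd 1 (pd I W) s := by
      rw [show lgrad φ v₁ v₂ = fun s => pd 1 W s ^ 2 + pd I W s ^ 2 from rfl,
        pd_add _ (hx.pow 2).diff (hy.pow 2).diff, pd_sq _ hx.diff, pd_sq _ hy.diff]
    rw [e, pd_symm 1 I (hWs s h2)]
    simp only [hP, hQ, lap2]
    rw [show pd 1 W s ^ 2 + pd I W s ^ 2 = lgrad φ v₁ v₂ s from rfl]
    field_simp
    ring
  have hPc : ∀ s : ℂ, a ≤ s.re → s.re < 0 → ContinuousAt P s := fun s h1 h2 =>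
    (((hWs s h2).pd 1).mul (hWs s h2).lap2).continuousAt.div (hgs s h2).continuousAt (hgpos s h1 h2).ne'
  have hQc : ∀ s : ℂ, a ≤ s.re → s.re < 0 → ContinuousAt Q s := fun s h1 h2 =>
    ((((hWs s h2).pd 1).mul (((hWs s h2).pd I).pd I)).sub
      (((hWs s h2).pd I).mul (((hWs s h2).pd 1).pd I))).continuousAt.div
      (hgs s h2).continuousAt (hgpos s h1 h2).ne'
  have hline : ∀ (σ t : ℝ), ((σ : ℂ) + t * I).re = σ := fun σ t => by simp
  have hQ0 : ∀ σ : ℝ, a ≤ σ → σ < 0 → ∫ t in (0 : ℝ)..2 * π, Q (σ + t * I) = 0 := by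
    intro σ h1 h2
    have hd : ∀ (f : ℂ → ℝ), (∀ s : ℂ, s.re < 0 → SmAt f s) → ∀ t : ℝ,
        HasDerivAt (fun t : ℝ => f (σ + t * I)) (pd I f (σ + t * I)) t := by
      intro f hf t
      have h3 := (hf (σ + t * I) (by rw [hline]; exact h2)).diff.hasFDerivAt
      have h4 : HasDerivAt (fun t : ℝ => (σ : ℂ) + t * I) I t := by
        simpa using ((Complex.ofRealCLM.hasDerivAt (x := t)).mul_const I).const_add (σ : ℂ)
      exact h3.comp_hasDerivAt t h4
    exact PLog.integral_zero (hpl σ h1 h2) (hd _ fun s hs => (hWs s hs).pd 1)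
      (hd _ fun s hs => (hWs s hs).pd I)
      (continuous_line fun s hs => (((hWs s (hs ▸ h2)).pd 1).pd I).continuousAt)
      (continuous_line fun s hs => (((hWs s (hs ▸ h2)).pd I).pd I).continuousAt)
  have key := strip_div (f := fun s => 1 / 2 * Real.log (lgrad φ v₁ v₂ s)) (g := fun _ => (0 : ℝ)) hab
    (fun s h1 h2 => hls s h1 (h2.trans_lt hb)) (fun s _ _ => SmAt.const 0 s) (fun _ => rfl)
  rw [key]
  have e1 : ∫ x in a..b, ∫ t in (0 : ℝ)..2 * π,
      (pd 1 (fun s => 1 / 2 * Real.log (lgrad φ v₁ v₂ s)) (x + t * I) +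
        pd I (fun _ => (0 : ℝ)) (x + t * I)) =
      ∫ x in a..b, ∫ t in (0 : ℝ)..2 * π, P (x + t * I) := by
    refine intervalIntegral.integral_congr fun x hx => ?_
    rw [uIcc_of_le hab] at hx
    have hx0 := hx.2.trans_lt hb
    have hPi : Continuous fun t : ℝ => P (x + t * I) :=
      continuous_line fun s hs => hPc s (hs ▸ hx.1) (hs ▸ hx0)
    have hQi : Continuous fun t : ℝ => Q (x + t * I) :=
      continuous_line fun s hs => hQc s (hs ▸ hx.1) (hs ▸ hx0)
    simp only [pd_const, add_zero]
    rw [intervalIntegral.integral_congr (g := fun t : ℝ => P (x + t * I) - Q (x + t * I))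
      fun t _ => hder _ (by rw [hline]; exact hx.1) (by rw [hline]; exact hx0),
      intervalIntegral.integral_sub (hPi.intervalIntegrable _ _) (hQi.intervalIntegrable _ _),
      hQ0 x hx.1 hx0, sub_zero]
  rw [e1, pRect_integral hab fun s h1 h2 => hPc s h1 (h2.trans_lt hb), ← integral_const_mul]
  refine setIntegral_mono_on (integrableOn_pRect fun s h1 h2 => hPc s h1 (h2.trans_lt hb))
    ((integrableOn_pRect fun s _ h2 => ?_).const_mul _) (measurableSet_pRect a b) fun s hs => ?_
  · exact (hφ.lmap_analyticAt (h2.trans_lt hb)).deriv.continuousAt.norm.pow 2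
  have hs1 : a ≤ s.re := hs.1.1.le
  have hs2 : s.re < 0 := lt_of_le_of_lt hs.1.2 hb
  set e := ‖deriv (lmap φ) s‖ with he
  set g := ‖cgrad w (lmap φ s)‖ with hg
  have hepos : 0 < e := norm_pos_iff.2 (hφ.deriv_lmap_ne hs2)
  have hgpos' : 0 < g := norm_pos_iff.2 (hne s hs1 hs2)
  have hl := hlap s hs1 hs2
  rw [← hg] at hl
  have hed : e = ‖deriv φ (Complex.exp s)‖ * rexp s.re := by
    rw [he, hφ.deriv_lmap hs2, norm_mul, Complex.norm_exp]
  have hann := annulus_estimate (ha.trans hs1) hs2 (norm_nonneg (deriv φ (Complex.exp s)))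
  rw [← hed] at hann
  rw [Complex.norm_exp] at hl
  have hl2 : |lap2 w (lmap φ s)| ≤ C * (6 * (-a) * e) * g := by
    refine hl.trans (mul_le_mul_of_nonneg_right (mul_le_mul_of_nonneg_left (hann.trans ?_) hC)
      hgpos'.le)
    nlinarith
  have hp1 : |pd 1 W s| ≤ e * g := by
    refine abs_le_of_sq_le_sq ?_ (by positivity)
    have := hgr s hs2
    have h3 : lgrad φ v₁ v₂ s = pd 1 W s ^ 2 + pd I W s ^ 2 := rfl
    nlinarith [sq_nonneg (pd I W s)]
  have hfin : |P s| ≤ 6 * C * (-a) * e ^ 2 := by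
    simp only [hP]
    rw [abs_div, abs_of_pos (hgpos s hs1 hs2), div_le_iff₀ (hgpos s hs1 hs2), abs_mul,
      lap2_ldiff hφ h hs2, hgr s hs2, abs_mul, abs_of_nonneg (sq_nonneg e)]
    calc |pd 1 W s| * (e ^ 2 * |lap2 w (lmap φ s)|) ≤ (e * g) * (e ^ 2 * (C * (6 * (-a) * e) * g)) := by
          gcongr
      _ = _ := by ring
  exact (le_abs_self _).trans hfin

end GradientGrowth

section DiscArea

open Filter Topology Set Metric
open Complex (I)

variable {φ : ℂ → ℂ} {v₁ v₂ F : ℂ → ℝ} {s : ℂ}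

lemma disc_area (hφ : DiscMap φ) (h : LPair v₁ v₂ F) (hpos : ∀ z ∈ φ '' ball 0 1, v₁ z < v₂ z)
    (hb : Bornology.IsBounded (φ '' ball 0 1))
    (hbd : ∀ ε : ℝ, 0 < ε → ∃ ρ : ℝ, ρ < 1 ∧ ∀ z ∈ ball (0 : ℂ) 1, ρ ≤ ‖z‖ → v₂ (φ z) - v₁ (φ z) < ε)
    (hcr : ∃ ε : ℝ, 0 < ε ∧ ∀ z ∈ ball (0 : ℂ) 1, v₂ (φ z) - v₁ (φ z) ≤ ε →
      cgrad (fun z => v₂ z - v₁ z) (φ z) ≠ 0)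
    (hlap : ∃ C ρ : ℝ, ρ < 1 ∧ ∀ z ∈ ball (0 : ℂ) 1, ρ ≤ ‖z‖ →
      |lap2 (fun z => v₂ z - v₁ z) (φ z)| ≤
        C * (‖deriv φ z‖ * (1 - ‖z‖ ^ 2)) * ‖cgrad (fun z => v₂ z - v₁ z) (φ z)‖)
    (hrat : ∀ ε : ℝ, 0 < ε → ∃ ρ : ℝ, ρ < 1 ∧ ∀ z ∈ ball (0 : ℂ) 1, ρ ≤ ‖z‖ →
      |ediff v₁ v₂ (φ z)| ≤ ε * ‖cgrad (fun z => v₂ z - v₁ z) (φ z)‖) :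
    4 * π < ∫ z in φ '' ball 0 1, etot v₁ v₂ z := by
  by_contra! hmass
  obtain ⟨c, hc, hflux⟩ := ldens_flux hφ h hpos hb hmass
  set w : ℂ → ℝ := fun z => v₂ z - v₁ z with hw
  obtain ⟨ε₁, hε₁, hcr⟩ := hcr
  obtain ⟨C, ρ₂, hρ₂, hlap⟩ := hlap
  have hWsm : ∀ z ∈ ball (0 : ℂ) 1, SmAt (fun z => w (φ z)) z := fun z hz =>
    SmAt.comp_hol (h.smw _) (hφ.analyticAt hz)
  obtain ⟨ρ₃, hρ₃, hplog⟩ := exists_plog_grad hWsm (fun z hz => sub_pos.2 (hpos _ ⟨z, hz, rfl⟩)) hbd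
    ⟨ε₁, hε₁, fun z hz hle => by
      rw [show (fun z => w (φ z)) = fun z => v₂ (φ z) - v₁ (φ z) from rfl, cgrad_disc hφ h hz]
      exact mul_ne_zero ((map_ne_zero _).2 (hφ.ne z hz)) (hcr z hz hle)⟩
  obtain ⟨ρ₁, hρ₁, hbd1⟩ := hbd ε₁ hε₁
  -- pass to logarithmic radius
  set C' := max C 0 with hC'
  obtain ⟨a₀, ha₀, htail⟩ := hφ.exists_tail_lt hb
    (show 0 < c / (2 * (6 * C' + 1)) by positivity)
  have hexp : ∀ {ρ : ℝ}, ρ < 1 → ∃ x : ℝ, x < 0 ∧ ∀ σ, x ≤ σ → ρ < rexp σ := by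
    intro ρ hρ
    have : ∀ᶠ x in 𝓝[<] (0 : ℝ), ρ < rexp x :=
      nhdsWithin_le_nhds (Real.continuous_exp.continuousAt.eventually
        (lt_mem_nhds (by rwa [Real.exp_zero])))
    obtain ⟨x, hx, hx0⟩ := (this.and self_mem_nhdsWithin).exists
    exact ⟨x, hx0, fun σ hσ => hx.trans_le (Real.exp_le_exp.2 hσ)⟩
  obtain ⟨x₁, hx₁, hx₁'⟩ := hexp hρ₁
  obtain ⟨x₂, hx₂, hx₂'⟩ := hexp hρ₂
  obtain ⟨x₃, hx₃, hx₃'⟩ := hexp hρ₃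
  obtain ⟨a, ha, ha0⟩ : ∃ a : ℝ, max (max (-1) a₀) (max x₁ (max x₂ x₃)) ≤ a ∧ a < 0 :=
    ⟨_, le_rfl, by simp [ha₀, hx₁, hx₂, hx₃]⟩
  simp only [max_le_iff] at ha
  obtain ⟨⟨ha1, haa₀⟩, hax₁, hax₂, hax₃⟩ := ha
  have hne : ∀ s : ℂ, a ≤ s.re → s.re < 0 → cgrad w (lmap φ s) ≠ 0 := by
    intro s h1 h2
    refine hcr _ (exp_mem_ball h2) (hbd1 _ (exp_mem_ball h2) ?_).le
    rw [Complex.norm_exp]; exact (hx₁' _ (hax₁.trans h1)).le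
  have hlap' : ∀ s : ℂ, a ≤ s.re → s.re < 0 → |lap2 w (lmap φ s)| ≤
      C' * (‖deriv φ (Complex.exp s)‖ * (1 - ‖Complex.exp s‖ ^ 2)) * ‖cgrad w (lmap φ s)‖ := by
    intro s h1 h2
    refine (hlap _ (exp_mem_ball h2) ?_).trans ?_
    · rw [Complex.norm_exp]; exact (hx₂' _ (hax₂.trans h1)).le
    · have h3 := exp_mem_ball h2
      rw [mem_ball_zero_iff] at h3
      have : 0 ≤ 1 - ‖Complex.exp s‖ ^ 2 := by nlinarith [norm_nonneg (Complex.exp s)]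
      have h4 : C ≤ C' := le_max_left _ _
      gcongr
      rfl
  have hpl : ∀ σ : ℝ, a ≤ σ → σ < 0 → PLog (fun t : ℝ =>
      (⟨pd 1 (ldiff φ v₁ v₂) (σ + t * I), pd I (ldiff φ v₁ v₂) (σ + t * I)⟩ : ℂ)) := by
    intro σ h1 h2
    have := hplog (rexp σ) (hx₃' _ (hax₃.trans h1)) (Real.exp_lt_one_iff.2 h2) (Real.exp_pos σ)
    have e : ∀ t : ℝ, ((rexp σ : ℝ) : ℂ) * Complex.exp (t * I) = Complex.exp (σ + t * I) := by
      intro t; rw [Complex.exp_add, Complex.ofReal_exp]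
    simp only [e] at this
    convert this using 2 with t
    exact (ldiff_curve hφ h (by simpa using h2)).symm
  -- the auxiliary error
  set er : ℂ → ℝ := fun s => ldens φ v₁ v₂ s - 1 / 2 * Real.log (lgrad φ v₁ v₂ s) with her
  have hgr : ∀ s : ℂ, s.re < 0 → lgrad φ v₁ v₂ s =
      ‖deriv (lmap φ) s‖ ^ 2 * ‖cgrad w (lmap φ s)‖ ^ 2 := fun s hs => ldiff_grad hφ h hs
  have hgpos : ∀ s : ℂ, a ≤ s.re → s.re < 0 → 0 < lgrad φ v₁ v₂ s := by
    intro s h1 h2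
    have := norm_pos_iff.2 (hφ.deriv_lmap_ne h2)
    have := norm_pos_iff.2 (hne s h1 h2)
    rw [hgr s h2]; positivity
  have hgs : ∀ s : ℂ, s.re < 0 → SmAt (lgrad φ v₁ v₂) s := fun s hs =>
    (((smAt_ldiff hφ h hs).pd 1).pow 2).add (((smAt_ldiff hφ h hs).pd I).pow 2)
  have hls : ∀ s : ℂ, a ≤ s.re → s.re < 0 → SmAt (fun s => 1 / 2 * Real.log (lgrad φ v₁ v₂ s)) s :=
    fun s h1 h2 => (SmAt.const _ s).mul ((hgs s h2).log (hgpos s h1 h2).ne')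
  have her_eq : ∀ s : ℂ, a ≤ s.re → s.re < 0 → er s =
      1 / 2 * Real.log (1 + ediff v₁ v₂ (lmap φ s) ^ 2 / ‖cgrad w (lmap φ s)‖ ^ 2) := by
    intro s h1 h2
    have p1 := norm_pos_iff.2 (hφ.deriv_lmap_ne h2)
    have p2 := norm_pos_iff.2 (hne s h1 h2)
    have p3 := enorm2_pos_of_lt (hpos _ (lmap_mem φ h2))
    have e1 : enorm2 v₁ v₂ (lmap φ s) = ‖cgrad w (lmap φ s)‖ ^ 2 + ediff v₁ v₂ (lmap φ s) ^ 2 := by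
      rw [sq_norm_cgrad]; rfl
    have e2 : 1 + ediff v₁ v₂ (lmap φ s) ^ 2 / ‖cgrad w (lmap φ s)‖ ^ 2 =
        enorm2 v₁ v₂ (lmap φ s) / ‖cgrad w (lmap φ s)‖ ^ 2 := by
      rw [e1]; field_simp
    rw [e2, Real.log_div p3.ne' (by positivity), her]
    simp only [ldens, hgr s h2]
    rw [Real.log_mul (by positivity) (by positivity), Real.log_pow, Real.log_pow]
    push_cast; ring
  have hlds : ∀ σ : ℝ, σ < 0 → IntervalIntegrable (fun t : ℝ => ldens φ v₁ v₂ (σ + t * I))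
      volume 0 (2 * π) := fun σ hσ => (continuous_line fun s hs =>
        (smAt_ldens hφ h hpos (hs ▸ hσ)).continuousAt).intervalIntegrable _ _
  have hlgs : ∀ σ : ℝ, a ≤ σ → σ < 0 → IntervalIntegrable
      (fun t : ℝ => 1 / 2 * Real.log (lgrad φ v₁ v₂ (σ + t * I))) volume 0 (2 * π) := fun σ h1 h2 =>
    (continuous_line (h := fun s => 1 / 2 * Real.log (lgrad φ v₁ v₂ s)) fun s hs =>
        (hls s (hs ▸ h1) (hs ▸ h2)).continuousAt).intervalIntegrable _ _
  have hsplit : ∀ σ : ℝ, a ≤ σ → σ < 0 → ∫ t in (0 : ℝ)..2 * π, er (σ + t * I) =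
      (∫ t in (0 : ℝ)..2 * π, ldens φ v₁ v₂ (σ + t * I)) -
        ∫ t in (0 : ℝ)..2 * π, 1 / 2 * Real.log (lgrad φ v₁ v₂ (σ + t * I)) := fun σ h1 h2 =>
    intervalIntegral.integral_sub (hlds σ h2) (hlgs σ h1 h2)
  have hline : ∀ (σ t : ℝ), ((σ : ℂ) + t * I).re = σ := fun σ t => by simp
  have her0 : 0 ≤ ∫ t in (0 : ℝ)..2 * π, er (a + t * I) := by
    refine intervalIntegral.integral_nonneg Real.two_pi_pos.le fun t _ => ?_
    rw [her_eq _ (by rw [hline]) (by rw [hline]; exact ha0)]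
    exact mul_nonneg (by norm_num) (Real.log_nonneg
      (le_add_of_nonneg_right (div_nonneg (sq_nonneg _) (sq_nonneg _))))
  -- choose b close to zero
  obtain ⟨η, hη, hηc⟩ : ∃ η : ℝ, 0 < η ∧ π * η ^ 2 < c * (-a) / 8 := by
    refine ⟨√(c * (-a) / (16 * π)), Real.sqrt_pos.2 ?_, ?_⟩
    · have : 0 < -a := by linarith
      positivity
    · have h0 : 0 < -a := by linarith
      rw [Real.sq_sqrt (by positivity)]
      have : π * (c * (-a) / (16 * π)) = c * (-a) / 16 := by field_simp
      rw [this]; nlinarith [mul_pos hc h0]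
  obtain ⟨ρ₄, hρ₄, hrat⟩ := hrat η hη
  obtain ⟨x₄, hx₄, hx₄'⟩ := hexp hρ₄
  obtain ⟨b, hb1, hb0⟩ : ∃ b : ℝ, max (a / 4) x₄ ≤ b ∧ b < 0 := ⟨_, le_rfl, by
    rw [max_lt_iff]; exact ⟨by linarith, hx₄⟩⟩
  rw [max_le_iff] at hb1
  have hab : a ≤ b := by linarith [hb1.1]
  have herb : ∫ t in (0 : ℝ)..2 * π, er (b + t * I) ≤ π * η ^ 2 := by
    have : ∀ t : ℝ, er (b + t * I) ≤ 1 / 2 * η ^ 2 := by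
      intro t
      have hs0 : ((b : ℂ) + t * I).re < 0 := by rw [hline]; exact hb0
      have hs1 : a ≤ ((b : ℂ) + t * I).re := by rw [hline]; exact hab
      rw [her_eq _ hs1 hs0]
      have p2 := norm_pos_iff.2 (hne _ hs1 hs0)
      have h5 := hrat _ (exp_mem_ball hs0)
        (by rw [Complex.norm_exp, hline]; exact (hx₄' _ hb1.2).le)
      have h6 : ediff v₁ v₂ (lmap φ (b + t * I)) ^ 2 / ‖cgrad w (lmap φ (b + t * I))‖ ^ 2 ≤ η ^ 2 := by
        rw [div_le_iff₀ (by positivity), ← mul_pow, ← sq_abs]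
        exact pow_le_pow_left₀ (abs_nonneg _) h5 2
      have h7 := Real.log_le_sub_one_of_pos (show 0 < 1 + ediff v₁ v₂ (lmap φ (b + t * I)) ^ 2 /
        ‖cgrad w (lmap φ (b + t * I))‖ ^ 2 by positivity)
      linarith
    have hm := intervalIntegral.integral_mono_on Real.two_pi_pos.le
      ((hlds b hb0).sub (hlgs b hab hb0))
      (continuous_const.intervalIntegrable (μ := volume) 0 (2 * π)) fun t _ => this t
    rw [intervalIntegral.integral_const] at hm
    refine hm.trans (le_of_eq ?_)
    simp only [sub_zero, smul_eq_mul]; ring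
  -- growth of the mean of `ldens`
  have hY : c * (b - a) ≤ (∫ t in (0 : ℝ)..2 * π, ldens φ v₁ v₂ (b + t * I)) -
      ∫ t in (0 : ℝ)..2 * π, ldens φ v₁ v₂ (a + t * I) := by
    have e := strip_div (f := ldens φ v₁ v₂) (g := fun _ => (0 : ℝ)) hab
      (fun s _ h2 => smAt_ldens hφ h hpos (h2.trans_lt hb0)) (fun s _ _ => SmAt.const 0 s)
      (fun _ => rfl)
    simp only [pd_const, add_zero] at e
    have hci : IntervalIntegrable (fun x : ℝ => ∫ t in (0 : ℝ)..2 * π,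
        pd 1 (ldens φ v₁ v₂) (x + t * I)) volume a b := by
      have hcc : Continuous (fun p : ℝ × ℝ =>
          pd 1 (ldens φ v₁ v₂) ((min p.1 b : ℝ) + p.2 * I)) := by
        refine continuous_iff_continuousAt.2 fun p => ?_
        have hc1 : Continuous fun p : ℝ × ℝ => ((min p.1 b : ℝ) : ℂ) + p.2 * I := by fun_prop
        have hc2 : ContinuousAt (pd 1 (ldens φ v₁ v₂)) (((min p.1 b : ℝ) : ℂ) + p.2 * I) :=
          ((smAt_ldens hφ h hpos (by
            rw [hline]; exact (min_le_right _ _).trans_lt hb0)).pd 1).continuousAt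
        exact hc2.comp (f := fun p : ℝ × ℝ => ((min p.1 b : ℝ) : ℂ) + p.2 * I) hc1.continuousAt
      have hcc2 := (intervalIntegral.continuous_parametric_intervalIntegral_of_continuous'
        (μ := volume) (f := fun x t : ℝ => pd 1 (ldens φ v₁ v₂) ((min x b : ℝ) + t * I))
        hcc 0 (2 * π)).intervalIntegrable (μ := volume) a b
      refine hcc2.congr fun x hx => ?_
      rw [uIoc_of_le hab] at hx
      simp only [min_eq_left hx.2]
    have hm := intervalIntegral.integral_mono_on hab
      (continuous_const.intervalIntegrable (μ := volume) a b) hci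
      fun x hx => hflux x (ha1.trans hx.1) (hx.2.trans_lt hb0)
    rw [intervalIntegral.integral_const, ← e] at hm
    refine le_trans (le_of_eq ?_) hm
    simp only [smul_eq_mul]; ring
  have hA := grad_log_growth hφ h hab ha1 hb0 (le_max_right C 0) hne hlap' hpl
  have ht := htail a b haa₀ hb0
  have hs1 := hsplit a le_rfl ha0
  have hs2 := hsplit b hab hb0
  have h0 : 0 < -a := by linarith
  have hC0 : 0 ≤ C' := le_max_right C 0
  have hfin : 6 * C' * (-a) * ∫ s in pRect a b, ‖deriv (lmap φ) s‖ ^ 2 ≤ (-a) * (c / 2) := by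
    have h1 : 6 * C' * ∫ s in pRect a b, ‖deriv (lmap φ) s‖ ^ 2 ≤ c / 2 := by
      have h2 : 6 * C' * ∫ s in pRect a b, ‖deriv (lmap φ) s‖ ^ 2 ≤
          6 * C' * (c / (2 * (6 * C' + 1))) := by gcongr
      refine h2.trans ?_
      rw [mul_div_assoc', div_le_div_iff₀ (by positivity) (by norm_num)]
      nlinarith
    calc _ = (-a) * (6 * C' * ∫ s in pRect a b, ‖deriv (lmap φ) s‖ ^ 2) := by ring
      _ ≤ _ := by gcongr
  have hb4 : c * (b - a) ≥ c * (-a) * (3 / 4) := by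
    have : b - a ≥ (-a) * (3 / 4) := by linarith [hb1.1]
    nlinarith
  nlinarith [mul_pos hc h0]

end DiscArea

section Vanishing

open Filter Topology Set Metric Asymptotics
open Complex (I)

lemma isBigO_of_fderiv {V : Type*} [NormedAddCommGroup V] [NormedSpace ℝ V] {K : ℂ → V} {p : ℂ}
    {k : ℕ} (hK : ∀ᶠ z in 𝓝 p, DifferentiableAt ℝ K z) (h0 : K p = 0)
    (h1 : (fun z => fderiv ℝ K z 1) =O[𝓝 p] fun z => ‖z - p‖ ^ k)
    (hI : (fun z => fderiv ℝ K z I) =O[𝓝 p] fun z => ‖z - p‖ ^ k) :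
    K =O[𝓝 p] fun z => ‖z - p‖ ^ (k + 1) := by
  obtain ⟨C₁, hC₁⟩ := h1.bound
  obtain ⟨C₂, hC₂⟩ := hI.bound
  obtain ⟨r, hr, hball⟩ := Metric.eventually_nhds_iff_ball.1 (hK.and (hC₁.and hC₂))
  refine IsBigO.of_bound (|C₁| + |C₂|) ?_
  filter_upwards [ball_mem_nhds p hr] with z hz
  have hsub : closedBall p ‖z - p‖ ⊆ ball p r :=
    closedBall_subset_ball (by rwa [← dist_eq_norm])
  have := (convex_closedBall p ‖z - p‖).norm_image_sub_le_of_norm_fderiv_le (𝕜 := ℝ) (f := K)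
    (C := (|C₁| + |C₂|) * ‖z - p‖ ^ k) (fun x hx => (hball x (hsub hx)).1) (fun x hx => ?_)
    (mem_closedBall_self (norm_nonneg _)) (by simp [dist_eq_norm] : z ∈ closedBall p ‖z - p‖)
  · rw [h0, sub_zero] at this
    refine this.trans (le_of_eq ?_)
    rw [norm_pow, norm_norm]; ring
  · obtain ⟨-, b1, b2⟩ := hball x (hsub hx)
    rw [mem_closedBall, dist_eq_norm] at hx
    have hle : ‖(‖x - p‖ ^ k : ℝ)‖ ≤ ‖z - p‖ ^ k := by
      rw [norm_pow, norm_norm]; gcongr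
    have hle1 : ‖fderiv ℝ K x 1‖ ≤ |C₁| * ‖z - p‖ ^ k := b1.trans
      (mul_le_mul (le_abs_self _) hle (norm_nonneg _) (abs_nonneg _))
    have hle2 : ‖fderiv ℝ K x I‖ ≤ |C₂| * ‖z - p‖ ^ k := b2.trans
      (mul_le_mul (le_abs_self _) hle (norm_nonneg _) (abs_nonneg _))
    refine ContinuousLinearMap.opNorm_le_bound _ (by positivity) fun v => ?_
    have e : v = v.re • (1 : ℂ) + v.im • I := by simp [Complex.re_add_im]
    conv_lhs => rw [e]
    rw [map_add, map_smul, map_smul]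
    refine (norm_add_le _ _).trans ?_
    rw [norm_smul, norm_smul, add_mul, add_mul]
    have h3 := Complex.abs_re_le_norm v
    have h4 := Complex.abs_im_le_norm v
    rw [Real.norm_eq_abs, Real.norm_eq_abs]
    have p1 : 0 ≤ |C₁| * ‖z - p‖ ^ k := by positivity
    have p2 : 0 ≤ |C₂| * ‖z - p‖ ^ k := by positivity
    have q1 := mul_le_mul h3 hle1 (norm_nonneg _) (norm_nonneg v)
    have q2 := mul_le_mul h4 hle2 (norm_nonneg _) (norm_nonneg v)
    linarith

/-- All derivatives of `f` of order less than `k` vanish at `p`. -/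
def Flat (p : ℂ) : ℕ → (ℂ → ℝ) → Prop
  | 0, _ => True
  | k + 1, f => f p = 0 ∧ ∀ v, Flat p k (pd v f)

variable {p : ℂ} {k : ℕ} {f g : ℂ → ℝ}

lemma Flat.pred (h : Flat p (k + 1) f) : Flat p k f := by
  induction k generalizing f with
  | zero => trivial
  | succ k ih => exact ⟨h.1, fun v => ih (h.2 v)⟩

lemma Flat.add (hf : ∀ z, SmAt f z) (hg : ∀ z, SmAt g z) (h : Flat p k f) (h' : Flat p k g) :
    Flat p k (fun z => f z + g z) := by
  induction k generalizing f g with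
  | zero => trivial
  | succ k ih =>
    refine ⟨by simp [h.1, h'.1], fun v => ?_⟩
    rw [show pd v (fun z => f z + g z) = _ from funext fun z => pd_add v (hf z).diff (hg z).diff]
    exact ih (fun z => (hf z).pd v) (fun z => (hg z).pd v) (h.2 v) (h'.2 v)

lemma Flat.mul (hf : ∀ z, SmAt f z) (hg : ∀ z, SmAt g z) (h : Flat p k f) :
    Flat p k (fun z => f z * g z) := by
  induction k generalizing f g with
  | zero => trivial
  | succ k ih =>
    refine ⟨by simp [h.1], fun v => ?_⟩
    rw [show pd v (fun z => f z * g z) = _ from funext fun z => pd_mul v (hf z).diff (hg z).diff]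
    exact (ih (fun z => (hf z).pd v) hg (h.2 v)).add (fun z => ((hf z).pd v).mul (hg z))
      (fun z => (hf z).mul ((hg z).pd v)) (ih hf (fun z => (hg z).pd v) h.pred)

lemma Flat.comb (hf : ∀ z, SmAt f z) (hg : ∀ z, SmAt g z) (h : Flat p k f) (h' : Flat p k g)
    (a b : ℝ) : Flat p k (fun z => f z * a + g z * b) :=
  (h.mul hf fun _ => SmAt.const a _).add (fun z => (hf z).mul (SmAt.const _ _))
    (fun z => (hg z).mul (SmAt.const _ _)) (h'.mul hg fun _ => SmAt.const b _)

lemma pd_eq_comb (v : ℂ) (f : ℂ → ℝ) : pd v f = fun z => pd 1 f z * v.re + pd I f z * v.im := by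
  ext z; rw [pd_eq]; ring

lemma Flat.exp_sub_one (hf : ∀ z, SmAt f z) (h : Flat p k f) :
    Flat p k (fun z => rexp (f z) - 1) := by
  cases k with
  | zero => trivial
  | succ k =>
    refine ⟨by simp [h.1], fun v => ?_⟩
    have : pd v (fun z => rexp (f z) - 1) = fun z => pd v f z * rexp (f z) := by
      ext z
      rw [pd_sub v (hf z).exp.diff (differentiableAt_const _), pd_exp v (hf z).diff, pd_const]; ring
    rw [this]
    exact (h.2 v).mul (fun z => (hf z).pd v) fun z => (hf z).exp

lemma Flat.isBigO (hf : ∀ z, SmAt f z) (h : Flat p k f) : f =O[𝓝 p] fun z => ‖z - p‖ ^ k := by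
  induction k generalizing f with
  | zero => simpa using (hf p).continuousAt.isBigO_one ℝ
  | succ k ih =>
    exact isBigO_of_fderiv (.of_forall fun z => (hf z).diff) h.1 (ih (fun z => (hf z).pd 1) (h.2 1))
      (ih (fun z => (hf z).pd I) (h.2 I))

lemma hasFDerivAt_sub_mul_pow (hf : ∀ z, SmAt f z) (hg : ∀ z, SmAt g z) (p b : ℂ) (n : ℕ) (z : ℂ) :
    HasFDerivAt (fun z => (f z : ℂ) - I * g z - b * (z - p) ^ n)
      (Complex.ofRealCLM.comp (fderiv ℝ f z) - I • Complex.ofRealCLM.comp (fderiv ℝ g z) -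
        (((b * (n * (z - p) ^ (n - 1) * 1)) : ℂ) • (1 : ℂ →L[ℝ] ℂ))) z := by
  have h1 := Complex.ofRealCLM.hasFDerivAt.comp z (hf z).diff.hasFDerivAt
  have h2 := Complex.ofRealCLM.hasFDerivAt.comp z (hg z).diff.hasFDerivAt
  have h3 := ((((hasDerivAt_id z).sub_const p).pow n).const_mul b).complexToReal_fderiv
  exact (h1.sub (h2.const_mul I)).sub h3

lemma fderiv_sub_mul_pow (hf : ∀ z, SmAt f z) (hg : ∀ z, SmAt g z) (p b : ℂ) (n : ℕ) (z v : ℂ) :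
    fderiv ℝ (fun z => (f z : ℂ) - I * g z - b * (z - p) ^ n) z v =
      (pd v f z : ℂ) - I * pd v g z - b * (n * (z - p) ^ (n - 1)) * v := by
  rw [(hasFDerivAt_sub_mul_pow hf hg p b n z).fderiv]
  simp [pd]

/-- Approximate solutions of the Cauchy-Riemann equations vanishing to order `k` have a
holomorphic leading term. -/
lemma Flat.leading (hf : ∀ z, SmAt f z) (hg : ∀ z, SmAt g z) (h : Flat p k f) (h' : Flat p k g)
    (e1 : Flat p k fun z => pd 1 f z + pd I g z) (e2 : Flat p k fun z => pd I f z - pd 1 g z) :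
    ∃ a : ℂ, ((fun z => (f z : ℂ) - I * g z - a * (z - p) ^ k) =O[𝓝 p] fun z => ‖z - p‖ ^ (k + 1)) ∧
      (a = 0 → Flat p (k + 1) f ∧ Flat p (k + 1) g) := by
  induction k generalizing f g with
  | zero =>
    refine ⟨(f p : ℂ) - I * g p, ?_, fun h0 => ?_⟩
    · have hc : ∀ v : ℂ, ContinuousAt (fun z => (pd v f z : ℂ) - I * pd v g z) p := fun v =>
        (Complex.continuous_ofReal.continuousAt.comp ((hf p).pd v).continuousAt).sub
          (continuousAt_const.mul (Complex.continuous_ofReal.continuousAt.comp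
            ((hg p).pd v).continuousAt))
      refine isBigO_of_fderiv
        (.of_forall fun z => (hasFDerivAt_sub_mul_pow hf hg _ _ _ z).differentiableAt) (by simp) ?_ ?_
      · refine ((hc 1).tendsto.isBigO_one ℝ).congr (fun z => ?_) fun z => (pow_zero _).symm
        rw [fderiv_sub_mul_pow hf hg]; simp
      · refine ((hc I).tendsto.isBigO_one ℝ).congr (fun z => ?_) fun z => (pow_zero _).symm
        rw [fderiv_sub_mul_pow hf hg]; simp
    · have h1 := congrArg Complex.re h0
      have h2 := congrArg Complex.im h0
      simp at h1 h2
      exact ⟨⟨h1, fun _ => trivial⟩, h2, fun _ => trivial⟩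
  | succ k ih =>
    have sf := fun v z => (hf z).pd v
    have sg := fun v z => (hg z).pd v
    have c1 : pd 1 (fun z => pd 1 f z + pd I g z) = fun z => pd 1 (pd 1 f) z + pd I (pd 1 g) z := by
      ext z; rw [pd_add 1 (sf 1 z).diff (sg I z).diff, pd_symm 1 I (hg z)]
    have c2 : pd 1 (fun z => pd I f z - pd 1 g z) = fun z => pd I (pd 1 f) z - pd 1 (pd 1 g) z := by
      ext z; rw [pd_sub 1 (sf I z).diff (sg 1 z).diff, pd_symm 1 I (hf z)]
    obtain ⟨a, ha, ha0⟩ := ih (sf 1) (sg 1) (h.2 1) (h'.2 1) (c1 ▸ e1.2 1) (c2 ▸ e2.2 1)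
    have b1 := e1.isBigO fun z => (sf 1 z).add (sg I z)
    have b2 := e2.isBigO fun z => (sf I z).sub (sg 1 z)
    refine ⟨a / (k + 1), ?_, fun h0 => ?_⟩
    · have hk : ((k : ℂ) + 1) ≠ 0 := by exact_mod_cast Nat.succ_ne_zero k
      refine isBigO_of_fderiv (.of_forall fun z => (hasFDerivAt_sub_mul_pow hf hg _ _ _ z).differentiableAt)
        (by simp [h.1, h'.1]) ?_ ?_
      · refine ha.congr_left fun z => ?_
        rw [fderiv_sub_mul_pow hf hg]; rw [show k + 1 - 1 = k from rfl]; push_cast; field_simp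
      · have hO : (fun z => ((pd I f z - pd 1 g z : ℝ) : ℂ) - I * ((pd 1 f z + pd I g z : ℝ) : ℂ))
            =O[𝓝 p] fun z => ‖z - p‖ ^ (k + 1) := by
          refine IsBigO.sub (IsBigO.of_norm_left ?_) (IsBigO.const_mul_left (IsBigO.of_norm_left ?_) _)
          · simpa only [Complex.norm_real] using b2.norm_left
          · simpa only [Complex.norm_real] using b1.norm_left
        refine ((ha.const_mul_left I).add hO).congr_left fun z => ?_
        rw [fderiv_sub_mul_pow hf hg]; rw [show k + 1 - 1 = k from rfl]; push_cast; field_simp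
        linear_combination (norm := ring_nf) (- (pd 1 g z : ℂ)) * Complex.I_sq
    · have ha' : a = 0 := by
        have hk : ((k : ℂ) + 1) ≠ 0 := by exact_mod_cast Nat.succ_ne_zero k
        simpa [hk] using h0
      obtain ⟨k1, k2⟩ := ha0 ha'
      have k3 : Flat p (k + 1) (pd I f) := by
        have := k2.add (sg 1) (fun z => (sf I z).sub (sg 1 z)) e2
        simpa using this
      have k4 : Flat p (k + 1) (pd I g) := by
        have := (k1.comb (sf 1) (fun z => (sf 1 z).add (sg I z)) e1 (-1) 1)
        simpa using this
      refine ⟨⟨h.1, fun v => ?_⟩, h'.1, fun v => ?_⟩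
      · rw [pd_eq_comb]; exact k1.comb (sf 1) (sf I) k3 _ _
      · rw [pd_eq_comb]; exact k2.comb (sg 1) (sg I) k4 _ _

end Vanishing

section UniqueContinuation

open Filter Topology Set Metric Asymptotics
open Complex (I)

lemma IsLocalMax.pd_pd_nonpos {f : ℂ → ℝ} {z : ℂ} (hf : SmAt f z) (h : IsLocalMax f z) (v : ℂ) :
    pd v (pd v f) z ≤ 0 := by
  by_contra! hpos
  have hl : ∀ t : ℝ, HasDerivAt (fun t : ℝ => z + t * v) v t := fun t => by
    simpa using ((hasDerivAt_id t).ofReal_comp.mul_const v).const_add z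
  have hd : ∀ (g : ℂ → ℝ) (t : ℝ), SmAt g (z + t * v) →
      HasDerivAt (fun t : ℝ => g (z + t * v)) (pd v g (z + t * v)) t := fun g t hg =>
    hg.diff.hasFDerivAt.comp_hasDerivAt t (hl t)
  have hc : Tendsto (fun t : ℝ => z + t * v) (𝓝 0) (𝓝 z) := by
    have := (hl 0).continuousAt.tendsto; simpa using this
  have hz : z + ((0 : ℝ) : ℂ) * v = z := by simp
  set g : ℝ → ℝ := fun t => f (z + t * v) with hg
  have hdg : deriv g =ᶠ[𝓝 0] fun t => pd v f (z + t * v) := by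
    filter_upwards [hc.eventually hf.ev] with t ht using (hd f t ht).deriv
  have hddg : deriv (deriv g) 0 = pd v (pd v f) z := by
    rw [hdg.deriv_eq, (hd (pd v f) 0 (by rw [hz]; exact hf.pd v)).deriv, hz]
  have hmax : IsLocalMax g 0 := by
    have := hc.eventually h
    filter_upwards [this] with t ht
    simpa [hg] using ht
  have hmin : IsLocalMin g 0 := isLocalMin_of_deriv_deriv_pos (by rwa [hddg]) hmax.deriv_eq_zero
    (hd f 0 (by rwa [hz])).continuousAt
  have hconst : g =ᶠ[𝓝 0] fun _ => g 0 := by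
    filter_upwards [hmax, hmin] with t h1 h2 using le_antisymm h1 h2
  have h1 : deriv g =ᶠ[𝓝 0] fun _ => 0 := by
    filter_upwards [hconst.eventuallyEq_nhds] with t ht
    rw [ht.deriv_eq]; simp
  have : deriv (deriv g) 0 = 0 := by rw [h1.deriv_eq]; simp
  linarith

variable {v₁ v₂ F : ℂ → ℝ} {p : ℂ}

lemma LPair.flat_ediff (h : LPair v₁ v₂ F) {k : ℕ} (hf : Flat p k fun z => v₂ z - v₁ z) :
    Flat p k (ediff v₁ v₂) := by
  have : ediff v₁ v₂ = fun z => (rexp (v₂ z - v₁ z) - 1) * rexp (v₁ z) := by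
    ext z; rw [ediff, sub_mul, ← Real.exp_add]; ring_nf
  rw [this]
  exact (hf.exp_sub_one h.smw).mul (fun z => (h.smw z).exp.sub (SmAt.const 1 z))
    fun z => (h.sm1 z).exp

lemma LPair.flat_enorm2 (h : LPair v₁ v₂ F) {k : ℕ} (hf : Flat p (k + 1) fun z => v₂ z - v₁ z) :
    Flat p k (enorm2 v₁ v₂) := by
  have s := fun v z => (h.smw z).pd v
  have : enorm2 v₁ v₂ = fun z => pd 1 (fun z => v₂ z - v₁ z) z * pd 1 (fun z => v₂ z - v₁ z) z +
      pd I (fun z => v₂ z - v₁ z) z * pd I (fun z => v₂ z - v₁ z) z +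
      ediff v₁ v₂ z * ediff v₁ v₂ z := by
    ext z; rw [enorm2]; ring
  rw [this]
  exact ((((hf.2 1).mul (s 1) (s 1)).add (fun z => (s 1 z).mul (s 1 z))
    (fun z => (s I z).mul (s I z)) ((hf.2 I).mul (s I) (s I)))).add
    (fun z => ((s 1 z).mul (s 1 z)).add ((s I z).mul (s I z)))
    (fun z => (h.smD z).mul (h.smD z)) ((h.flat_ediff hf.pred).mul h.smD h.smD)

lemma enorm2_nonneg (v₁ v₂ : ℂ → ℝ) (z : ℂ) : 0 ≤ enorm2 v₁ v₂ z := by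
  rw [enorm2]; positivity

lemma smAt_sq_norm_sub (p z : ℂ) : SmAt (fun z => ‖z - p‖ ^ 2) z :=
  .of_forall fun _ => (contDiffAt_id.sub contDiffAt_const).norm_sq ℝ

lemma pd_sq_norm_sub (p v z : ℂ) :
    pd v (fun z => ‖z - p‖ ^ 2) z = 2 * ((z.re - p.re) * v.re + (z.im - p.im) * v.im) := by
  have e : (fun z : ℂ => ‖z - p‖ ^ 2) = fun z => (z.re - p.re) ^ 2 + (z.im - p.im) ^ 2 := by
    ext z; rw [← Complex.normSq_eq_norm_sq, Complex.normSq_apply]; simp; ring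
  have s1 : SmAt (fun z : ℂ => z.re - p.re) z := (smAt_re z).sub (SmAt.const _ z)
  have s2 : SmAt (fun z : ℂ => z.im - p.im) z := (smAt_im z).sub (SmAt.const _ z)
  rw [e, pd_add v (s1.pow 2).diff (s2.pow 2).diff, pd_sq v s1.diff, pd_sq v s2.diff,
    pd_sub v (smAt_re z).diff (SmAt.const _ z).diff, pd_sub v (smAt_im z).diff (SmAt.const _ z).diff,
    pd_const, pd_const, pd_re, pd_im]
  ring

lemma lap2_sq_norm_sub (p z : ℂ) : lap2 (fun z => ‖z - p‖ ^ 2) z = 4 := by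
  have e1 : pd 1 (fun z : ℂ => ‖z - p‖ ^ 2) = fun z => 2 * (z.re - p.re) := by
    ext z; rw [pd_sq_norm_sub]; simp
  have e2 : pd I (fun z : ℂ => ‖z - p‖ ^ 2) = fun z => 2 * (z.im - p.im) := by
    ext z; rw [pd_sq_norm_sub]; simp
  have s1 : SmAt (fun z : ℂ => z.re - p.re) z := (smAt_re z).sub (SmAt.const _ z)
  have s2 : SmAt (fun z : ℂ => z.im - p.im) z := (smAt_im z).sub (SmAt.const _ z)
  rw [lap2, e1, e2, pd_const_mul _ _ s1.diff, pd_const_mul _ _ s2.diff,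
    pd_sub _ (smAt_re z).diff (SmAt.const _ z).diff, pd_sub _ (smAt_im z).diff (SmAt.const _ z).diff,
    pd_const, pd_const, pd_re, pd_im]
  simp; norm_num

/-- A difference of two solutions cannot vanish to infinite order at `p` without vanishing nearby. -/
lemma LPair.eventually_eq (h : LPair v₁ v₂ F) (hf : ∀ k, Flat p k fun z => v₂ z - v₁ z) {z₀ : ℂ}
    (hz₀ : z₀ ∈ ball p 1) : v₁ z₀ = v₂ z₀ := by
  by_contra hne
  have hN0 : 0 < enorm2 v₁ v₂ z₀ := by
    have : ediff v₁ v₂ z₀ ≠ 0 := by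
      rw [ediff, sub_ne_zero]; exact fun h => hne (Real.exp_injective h).symm
    rw [enorm2]; positivity
  have hz₀p : z₀ ≠ p := by
    rintro rfl; exact hne (by linarith [(hf 1).1])
  have hTc : Continuous (etot v₁ v₂) := continuous_iff_continuousAt.2 fun z => (h.smT z).continuousAt
  have hNc : Continuous (enorm2 v₁ v₂) := continuous_iff_continuousAt.2 fun z => (h.smN z).continuousAt
  obtain ⟨M, hM⟩ := ((isCompact_closedBall p 1).bddAbove_image hTc.continuousOn)
  obtain ⟨B, hB⟩ := ((isCompact_closedBall p 1).bddAbove_image hNc.continuousOn)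
  have hM' : ∀ z ∈ closedBall p 1, etot v₁ v₂ z ≤ M := fun z hz => hM ⟨z, hz, rfl⟩
  have hB' : ∀ z ∈ closedBall p 1, enorm2 v₁ v₂ z ≤ B := fun z hz => hB ⟨z, hz, rfl⟩
  have hMpos : 0 < M := lt_of_lt_of_le (by rw [etot]; positivity) (hM' p (mem_closedBall_self zero_le_one))
  set r := ‖z₀ - p‖ ^ 2 with hr
  have hr0 : 0 < r := by have := norm_pos_iff.2 (sub_ne_zero.2 hz₀p); positivity
  have hr1 : r < 1 := by
    rw [mem_ball, dist_eq_norm] at hz₀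
    rw [hr]; nlinarith [norm_nonneg (z₀ - p)]
  obtain ⟨k, hk⟩ : ∃ k : ℕ, r ^ (k + 1) * (B * rexp M) < enorm2 v₁ v₂ z₀ := by
    have : Tendsto (fun k : ℕ => r ^ (k + 1) * (B * rexp M)) atTop (𝓝 (0 * (B * rexp M))) :=
      ((tendsto_pow_atTop_nhds_zero_of_lt_one hr0.le hr1).comp (tendsto_add_atTop_nat 1)).mul_const _
    rw [zero_mul] at this
    exact (this.eventually_lt_const hN0).exists
  set f : ℂ → ℝ := fun z => enorm2 v₁ v₂ z * rexp (M * ‖z - p‖ ^ 2) / (‖z - p‖ ^ 2) ^ (k + 1) with hfdef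
  have hfc : Continuous f := by
    refine continuous_iff_continuousAt.2 fun z => ?_
    by_cases hz : z = p
    · subst hz
      have hO := (h.flat_enorm2 (k := 2 * (k + 1) + 1) (hf _)).isBigO h.smN
      have hO2 : f =O[𝓝 z] fun x => ‖x - z‖ := by
        obtain ⟨C, hC⟩ := hO.bound
        have hE : Tendsto (fun x => rexp (M * ‖x - z‖ ^ 2)) (𝓝 z) (𝓝 (rexp (M * ‖z - z‖ ^ 2))) :=
          Continuous.tendsto (by fun_prop) z
        refine IsBigO.of_bound (|C| * 2) ?_
        have hE2 := hE.eventually_lt_const (u := 2) (by simp)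
        filter_upwards [hC, hE2] with x h1 h2
        by_cases hx : x = z
        · simp [hfdef, hx]
        have hx' : 0 < ‖x - z‖ := norm_pos_iff.2 (sub_ne_zero.2 hx)
        rw [hfdef]
        simp only [norm_div, norm_mul, norm_pow, Real.norm_eq_abs, abs_norm,
          Real.abs_exp] at h1 ⊢
        rw [div_le_iff₀ (by positivity), ← pow_mul]
        calc _ ≤ (|C| * ‖x - z‖ ^ (2 * (k + 1) + 1)) * 2 := by
              refine mul_le_mul (h1.trans ?_) h2.le (Real.exp_pos _).le (by positivity)
              gcongr; exact le_abs_self _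
          _ = _ := by ring
      have hf0 : f z = 0 := by simp [hfdef]
      rw [ContinuousAt, hf0]
      refine hO2.trans_tendsto ?_
      have : Continuous fun x => ‖x - z‖ := by fun_prop
      simpa using this.tendsto z
    · have hz' : (‖z - p‖ ^ 2) ^ (k + 1) ≠ 0 := by
        have := norm_pos_iff.2 (sub_ne_zero.2 hz); positivity
      exact ContinuousAt.div (by fun_prop) (by fun_prop) hz'
  obtain ⟨z₁, hz₁, hmax⟩ := (isCompact_closedBall p 1).exists_isMaxOn ⟨z₀, ball_subset_closedBall hz₀⟩
    hfc.continuousOn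
  have hf01 : f z₀ ≤ f z₁ := hmax (ball_subset_closedBall hz₀)
  have hf0 : B * rexp M < f z₀ := by
    rw [hfdef]; simp only
    rw [lt_div_iff₀ (by positivity)]
    have : 1 ≤ rexp (M * ‖z₀ - p‖ ^ 2) := Real.one_le_exp (by positivity)
    nlinarith
  have hB0 : 0 ≤ B * rexp M := mul_nonneg ((enorm2_nonneg _ _ _).trans (hB' p (by simp))) (exp_pos _).le
  have hz₁p : z₁ ≠ p := by
    rintro rfl
    have : f z₁ = 0 := by simp [hfdef]
    linarith
  have hz₁' : 0 < ‖z₁ - p‖ := norm_pos_iff.2 (sub_ne_zero.2 hz₁p)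
  have hz₁b : z₁ ∈ ball p 1 := by
    rw [mem_closedBall, dist_eq_norm] at hz₁
    rw [mem_ball, dist_eq_norm]
    refine lt_of_le_of_ne hz₁ fun he => ?_
    have : f z₁ ≤ B * rexp M := by
      rw [hfdef]; simp only [he]; norm_num
      exact mul_le_mul_of_nonneg_right (hB' _ (by rw [mem_closedBall, dist_eq_norm, he])) (exp_pos _).le
    linarith
  have hN1 : 0 < enorm2 v₁ v₂ z₁ := by
    refine lt_of_le_of_ne (enorm2_nonneg _ _ _) fun he => ?_
    have : f z₁ = 0 := by simp [hfdef, ← he]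
    linarith
  set L : ℂ → ℝ := fun z => log (enorm2 v₁ v₂ z) + (M * ‖z - p‖ ^ 2 + (-(k + 1 : ℝ)) * log (‖z - p‖ ^ 2))
    with hL
  have sN := (h.smN z₁).log hN1.ne'
  have sq := smAt_sq_norm_sub p z₁
  have sl := sq.log (by positivity)
  have sM := (SmAt.const M z₁).mul sq
  have sk := (SmAt.const (-(k + 1 : ℝ)) z₁).mul sl
  have hLs : SmAt L z₁ := sN.add (sM.add sk)
  have hLf : ∀ᶠ z in 𝓝 z₁, 0 < enorm2 v₁ v₂ z ∧ L z = log (f z) := by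
    filter_upwards [hNc.continuousAt.eventually_const_lt hN1, isOpen_ne.mem_nhds hz₁p] with z h1 h2
    have h2' : 0 < ‖z - p‖ := norm_pos_iff.2 (sub_ne_zero.2 h2)
    refine ⟨h1, ?_⟩
    rw [hfdef]; simp only
    rw [Real.log_div (by positivity) (by positivity), Real.log_mul h1.ne' (exp_pos _).ne', Real.log_exp,
      Real.log_pow (n := k + 1) (x := ‖z - p‖ ^ 2), hL]
    push_cast; ring
  have hLmax : IsLocalMax L z₁ := by
    have he := hLf.self_of_nhds.2
    filter_upwards [hLf, isOpen_ball.mem_nhds hz₁b, isOpen_ne.mem_nhds hz₁p] with z h1 h2 h3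
    have h3' : 0 < ‖z - p‖ := norm_pos_iff.2 (sub_ne_zero.2 h3)
    rw [h1.2, he]
    refine Real.log_le_log ?_ (hmax (ball_subset_closedBall h2))
    have := h1.1
    rw [hfdef]; positivity
  have hle : lap2 L z₁ ≤ 0 := add_nonpos (hLmax.pd_pd_nonpos hLs 1) (hLmax.pd_pd_nonpos hLs I)
  have hlog : lap2 (fun z => log (‖z - p‖ ^ 2)) z₁ = 0 := by
    have e : ‖z₁ - p‖ ^ 2 = (z₁.re - p.re) ^ 2 + (z₁.im - p.im) ^ 2 := by
      rw [sq_norm_re_im]; simp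
    rw [lap2_log sq (by positivity), lap2_sq_norm_sub, pd_sq_norm_sub, pd_sq_norm_sub, div_eq_zero_iff]
    left; rw [e]; simp; ring
  rw [hL, lap2_add sN (sM.add sk), lap2_add sM sk, lap2_const_mul _ sq, lap2_const_mul _ sl, hlog,
    lap2_sq_norm_sub] at hle
  have h1 := h.lap_log_enorm2 hN1
  have h2 := hM' _ hz₁
  have h3 : 0 ≤ 2 * F z₁ * ediff v₁ v₂ z₁ ^ 2 / enorm2 v₁ v₂ z₁ := by
    have := h.pos z₁; positivity
  linarith

end UniqueContinuation

section BoundaryStructure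

open Filter Topology Set Metric Asymptotics
open Complex (I)

variable {v₁ v₂ F : ℂ → ℝ} {p : ℂ} {Ω : Set ℂ}

lemma norm_cgrad_eq (W : ℂ → ℝ) (z : ℂ) : ‖cgrad W z‖ = ‖(pd 1 W z : ℂ) - I * pd I W z‖ := by
  rw [← Complex.norm_conj]
  congr 1
  apply Complex.ext <;> simp [cgrad]

lemma norm_fderiv_le_cgrad (W : ℂ → ℝ) (z : ℂ) : ‖fderiv ℝ W z‖ ≤ ‖cgrad W z‖ := by
  refine ContinuousLinearMap.opNorm_le_bound _ (norm_nonneg _) fun v => ?_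
  change |pd v W z| ≤ _
  rw [abs_le]
  refine ⟨by rw [pd_cgrad]; exact re_im_le _ _, ?_⟩
  have := re_im_le (cgrad W z) (-v)
  rw [pd_cgrad]
  simp only [Complex.neg_re, Complex.neg_im, norm_neg] at this
  linarith

/-- The gradient of the difference has an exact order of vanishing at a zero. -/
lemma LPair.grad_two_sided (h : LPair v₁ v₂ F) (hp : v₁ p = v₂ p)
    (hnz : ∃ z ∈ ball p 1, v₁ z ≠ v₂ z) :
    ∃ n : ℕ, ∃ c C r : ℝ, 0 < c ∧ 0 < C ∧ 0 < r ∧ ∀ z ∈ ball p r,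
      c * ‖z - p‖ ^ n ≤ ‖cgrad (fun z => v₂ z - v₁ z) z‖ ∧
      ‖cgrad (fun z => v₂ z - v₁ z) z‖ ≤ C * ‖z - p‖ ^ n := by
  classical
  set w : ℂ → ℝ := fun z => v₂ z - v₁ z with hw
  have hex : ∃ k, ¬ Flat p k w := by
    by_contra! hall
    obtain ⟨z, hz, hne⟩ := hnz
    exact hne (h.eventually_eq hall hz)
  obtain ⟨n, hn1, hn2⟩ : ∃ n, Flat p (n + 1) w ∧ ¬ Flat p (n + 2) w := by
    by_contra! hall
    obtain ⟨k, hk⟩ := hex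
    have h1 : Flat p 1 w := ⟨by simp [hw, hp], fun _ => trivial⟩
    have h2 : ∀ k, Flat p (k + 1) w := fun k => by
      induction k with
      | zero => exact h1
      | succ k ih => exact hall k ih
    exact hk (h2 k).pred
  have s := fun v z => (h.smw z).pd v
  have e2 : (fun z => pd I (pd 1 w) z - pd 1 (pd I w) z) = fun _ => 0 := by
    ext z; rw [pd_symm I 1 (h.smw z), sub_self]
  have hlap : Flat p n fun z => pd 1 (pd 1 w) z + pd I (pd I w) z := by
    have e : (fun z => pd 1 (pd 1 w) z + pd I (pd I w) z) =
        fun z => ediff v₁ v₂ z * ((-1) * (rexp (v₁ z) + rexp (v₂ z))) := by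
      ext z
      change lap2 w z = _
      rw [h.lap_w, ediff]; ring
    rw [e]
    exact (h.flat_ediff hn1.pred).mul h.smD fun z =>
      (SmAt.const (-1) z).mul ((h.sm1 z).exp.add (h.sm2 z).exp)
  have hzero : ∀ n, Flat p n (fun _ => (0 : ℝ)) := fun n => by
    induction n with
    | zero => trivial
    | succ n ih =>
      refine ⟨rfl, fun v => ?_⟩
      rw [show pd v (fun _ : ℂ => (0 : ℝ)) = fun _ => 0 from funext fun z => pd_const v 0 z]
      exact ih
  obtain ⟨a, ha, ha0⟩ := Flat.leading (s 1) (s I) (hn1.2 1) (hn1.2 I) hlap (by rw [e2]; exact hzero n)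
  have hane : a ≠ 0 := fun h0 => hn2 ⟨hn1.1, fun v => by
    rw [pd_eq_comb]; exact (ha0 h0).1.comb (s 1) (s I) (ha0 h0).2 _ _⟩
  have ha' : 0 < ‖a‖ := norm_pos_iff.2 hane
  obtain ⟨C, hC⟩ := ha.bound
  obtain ⟨r, hr, hball⟩ := Metric.eventually_nhds_iff_ball.1 hC
  refine ⟨n, ‖a‖ / 2, 2 * ‖a‖, min r (‖a‖ / (2 * (|C| + 1))), by positivity, by positivity,
    by positivity, fun z hz => ?_⟩
  have hz1 := hball z (ball_subset_ball (min_le_left _ _) hz)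
  have hz2 : ‖z - p‖ ≤ ‖a‖ / (2 * (|C| + 1)) := by
    have := ball_subset_ball (min_le_right _ _) hz
    rw [mem_ball, dist_eq_norm] at this; exact this.le
  rw [norm_cgrad_eq]
  set G : ℂ := (pd 1 w z : ℂ) - I * pd I w z
  have hb : ‖G - a * (z - p) ^ n‖ ≤ ‖a‖ / 2 * ‖z - p‖ ^ n := by
    refine hz1.trans ?_
    rw [norm_pow, norm_norm, pow_succ]
    have h3 : C * ‖z - p‖ ≤ ‖a‖ / 2 := by
      rw [le_div_iff₀ (by positivity)] at hz2
      nlinarith [le_abs_self C, norm_nonneg (z - p), mul_le_mul_of_nonneg_right (le_abs_self C) (norm_nonneg (z - p))]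
    have h4 : 0 ≤ ‖z - p‖ ^ n := by positivity
    nlinarith
  have hn : ‖a * (z - p) ^ n‖ = ‖a‖ * ‖z - p‖ ^ n := by rw [norm_mul, norm_pow]
  have h5 := norm_sub_norm_le (a * (z - p) ^ n) G
  rw [norm_sub_rev _ G] at h5
  have h6 := norm_sub_norm_le G (a * (z - p) ^ n)
  have h7 : 0 ≤ ‖a‖ * ‖z - p‖ ^ n := by positivity
  constructor <;> linarith

lemma exists_frontier_nearest (hΩ : IsOpen Ω) (hne : Ωᶜ.Nonempty) {z : ℂ} (hz : z ∈ Ω) :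
    0 < infDist z Ωᶜ ∧ ∃ q ∈ frontier Ω, dist z q = infDist z Ωᶜ := by
  have hc : IsClosed Ωᶜ := hΩ.isClosed_compl
  have hd : 0 < infDist z Ωᶜ := (hc.notMem_iff_infDist_pos hne).1 (by simpa using hz)
  obtain ⟨q, hq, he⟩ := hc.exists_infDist_eq_dist hne z
  refine ⟨hd, q, ?_, he.symm⟩
  rw [frontier, hΩ.interior_eq]
  refine ⟨?_, hq⟩
  have hsub : ball z (infDist z Ωᶜ) ⊆ Ω := by
    have := disjoint_ball_infDist (x := z) (s := Ωᶜ)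
    exact disjoint_compl_right_iff_subset.1 this
  have h1 := closure_mono hsub
  rw [closure_ball z hd.ne'] at h1
  exact h1 (by rw [mem_closedBall, dist_comm, he])

lemma LPair.boundary_local (h : LPair v₁ v₂ F) (hΩ : IsOpen Ω) (hne : Ωᶜ.Nonempty)
    (hpos : ∀ z ∈ Ω, v₁ z < v₂ z) (hfr : ∀ z ∈ frontier Ω, v₁ z = v₂ z) (hp : p ∈ frontier Ω) :
    ∃ r K : ℝ, 0 < r ∧ ∀ z ∈ Ω, z ∈ ball p r → cgrad (fun z => v₂ z - v₁ z) z ≠ 0 ∧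
      v₂ z - v₁ z ≤ K * infDist z Ωᶜ * ‖cgrad (fun z => v₂ z - v₁ z) z‖ := by
  set w : ℂ → ℝ := fun z => v₂ z - v₁ z with hw
  have hpc : p ∉ Ω := by rw [frontier, hΩ.interior_eq] at hp; exact hp.2
  obtain ⟨z', hz', hz''⟩ := Metric.mem_closure_iff.1 hp.1 1 one_pos
  obtain ⟨n, c, C, r, hc, hC, hr, hball⟩ := h.grad_two_sided (hfr p hp)
    ⟨z', by rwa [mem_ball, dist_comm], (hpos z' hz').ne⟩
  refine ⟨r / 2, C * 2 ^ n / c, by positivity, fun z hz hzb => ?_⟩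
  rw [mem_ball, dist_eq_norm] at hzb
  have hzp : 0 < ‖z - p‖ := norm_pos_iff.2 (sub_ne_zero.2 fun h => hpc (h ▸ hz))
  have hz1 := (hball z (by rw [mem_ball, dist_eq_norm]; linarith)).1
  have hg : 0 < ‖cgrad w z‖ := lt_of_lt_of_le (by positivity) hz1
  refine ⟨norm_pos_iff.1 hg, ?_⟩
  obtain ⟨hd, q, hq, he⟩ := exists_frontier_nearest hΩ hne hz
  have hdp : infDist z Ωᶜ ≤ ‖z - p‖ := by
    rw [← dist_eq_norm]; exact infDist_le_dist_of_mem hpc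
  have hmv := (convex_closedBall z (infDist z Ωᶜ)).norm_image_sub_le_of_norm_fderiv_le (𝕜 := ℝ)
    (f := w) (C := C * (2 * ‖z - p‖) ^ n) (x := q) (y := z) (fun x _ => (h.smw x).diff) (fun x hx => ?_)
    (by rw [mem_closedBall, dist_comm, he]) (mem_closedBall_self hd.le)
  · have hq0 : w q = 0 := by simp [hw, hfr q hq]
    rw [hq0, sub_zero, ← dist_eq_norm z q, he] at hmv
    refine (le_abs_self _).trans (hmv.trans ?_)
    rw [mul_pow]
    calc C * (2 ^ n * ‖z - p‖ ^ n) * infDist z Ωᶜ = C * 2 ^ n / c * infDist z Ωᶜ * (c * ‖z - p‖ ^ n) := by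
          field_simp
      _ ≤ _ := by gcongr
  · rw [mem_closedBall, dist_eq_norm] at hx
    have hxp : ‖x - p‖ ≤ 2 * ‖z - p‖ := by
      have := norm_add_le (x - z) (z - p)
      rw [sub_add_sub_cancel] at this; linarith
    refine (norm_fderiv_le_cgrad w x).trans ?_
    refine ((hball x (by rw [mem_ball, dist_eq_norm]; linarith)).2).trans ?_
    gcongr

/-- Near the boundary the gradient controls the function divided by the boundary distance. -/
lemma LPair.boundary_estimate (h : LPair v₁ v₂ F) (hΩ : IsOpen Ω) (hb : Bornology.IsBounded Ω)
    (hpos : ∀ z ∈ Ω, v₁ z < v₂ z) (hfr : ∀ z ∈ frontier Ω, v₁ z = v₂ z) :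
    ∃ δ K : ℝ, 0 < δ ∧ 0 ≤ K ∧ ∀ z ∈ Ω, infDist z Ωᶜ < δ → cgrad (fun z => v₂ z - v₁ z) z ≠ 0 ∧
      v₂ z - v₁ z ≤ K * infDist z Ωᶜ * ‖cgrad (fun z => v₂ z - v₁ z) z‖ := by
  have hne : Ωᶜ.Nonempty := by
    rw [nonempty_compl]; rintro rfl; exact NormedSpace.unbounded_univ ℝ ℂ hb
  have hcomp : IsCompact (frontier Ω) := by
    refine Metric.isCompact_of_isClosed_isBounded isClosed_frontier (hb.closure.subset ?_)
    exact frontier_subset_closure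
  obtain ⟨K, U, hU, hfU, hK⟩ : ∃ K : ℝ, ∃ U : Set ℂ, IsOpen U ∧ frontier Ω ⊆ U ∧ ∀ z ∈ Ω, z ∈ U →
      cgrad (fun z => v₂ z - v₁ z) z ≠ 0 ∧
      v₂ z - v₁ z ≤ K * infDist z Ωᶜ * ‖cgrad (fun z => v₂ z - v₁ z) z‖ := by
    refine hcomp.induction_on (p := fun s => ∃ K : ℝ, ∃ U : Set ℂ, IsOpen U ∧ s ⊆ U ∧ ∀ z ∈ Ω, z ∈ U →
      cgrad (fun z => v₂ z - v₁ z) z ≠ 0 ∧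
      v₂ z - v₁ z ≤ K * infDist z Ωᶜ * ‖cgrad (fun z => v₂ z - v₁ z) z‖) ?_ ?_ ?_ ?_
    · exact ⟨0, ∅, isOpen_empty, subset_rfl, fun z _ h => h.elim⟩
    · rintro s t hst ⟨K, U, h1, h2, h3⟩; exact ⟨K, U, h1, hst.trans h2, h3⟩
    · rintro s t ⟨K, U, h1, h2, h3⟩ ⟨K', U', h1', h2', h3'⟩
      refine ⟨max K K', U ∪ U', h1.union h1', union_subset_union h2 h2', fun z hz hzU => ?_⟩
      have hd : 0 ≤ infDist z Ωᶜ := infDist_nonneg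
      rcases hzU with hzU | hzU
      · refine ⟨(h3 z hz hzU).1, (h3 z hz hzU).2.trans ?_⟩
        gcongr; exact le_max_left _ _
      · refine ⟨(h3' z hz hzU).1, (h3' z hz hzU).2.trans ?_⟩
        gcongr; exact le_max_right _ _
    · intro q hq
      obtain ⟨r, K, hr, hK⟩ := h.boundary_local hΩ hne hpos hfr hq
      exact ⟨ball q r, mem_nhdsWithin_of_mem_nhds (ball_mem_nhds q hr), K, ball q r, isOpen_ball,
        subset_rfl, hK⟩
  obtain ⟨δ, hδ, hth⟩ := hcomp.exists_thickening_subset_open hU hfU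
  refine ⟨δ, max K 0, hδ, le_max_right _ _, fun z hz hzd => ?_⟩
  obtain ⟨hd, q, hq, he⟩ := exists_frontier_nearest hΩ hne hz
  have hzU : z ∈ U := hth (mem_thickening_iff.2 ⟨q, hq, he ▸ hzd⟩)
  refine ⟨(hK z hz hzU).1, (hK z hz hzU).2.trans ?_⟩
  gcongr; exact le_max_left _ _

end BoundaryStructure

section DomainArea

open Filter Topology Set Metric
open Complex (I)

variable {v₁ v₂ F : ℂ → ℝ} {Ω : Set ℂ} {φ : ℂ → ℂ}

/-- The inverse of a conformal embedding of the disc. -/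
noncomputable def discInv (φ : ℂ → ℂ) : ℂ → ℂ := Function.invFunOn φ (ball 0 1)

lemma DiscMap.discInv_apply (hφ : DiscMap φ) {z : ℂ} (hz : z ∈ ball (0 : ℂ) 1) :
    discInv φ (φ z) = z := hφ.inj.leftInvOn_invFunOn hz

lemma DiscMap.hasDerivAt_discInv (hφ : DiscMap φ) {z : ℂ} (hz : z ∈ ball (0 : ℂ) 1) :
    HasDerivAt (discInv φ) (deriv φ z)⁻¹ (φ z) := by
  have hsd : HasStrictDerivAt φ (deriv φ z) z := (hφ.analyticAt hz).hasStrictDerivAt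
  have hne := hφ.ne z hz
  refine (hsd.to_localInverse hne).hasDerivAt.congr_of_eventuallyEq ?_
  have h7 := hsd.map_nhds_eq hne
  change ∀ᶠ x in 𝓝 (φ z), discInv φ x = hsd.localInverse _ _ _ hne x
  rw [← h7, eventually_map]
  filter_upwards [hsd.eventually_left_inverse hne, isOpen_ball.mem_nhds hz] with x hx hx'
  rw [hφ.discInv_apply hx']; exact hx.symm

lemma DiscMap.infDist_le (hφ : DiscMap φ) (himg : φ '' ball 0 1 = Ω) (hΩ : IsOpen Ω)
    (hne : Ωᶜ.Nonempty) {z : ℂ} (hz : z ∈ ball (0 : ℂ) 1) :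
    infDist (φ z) Ωᶜ ≤ ‖deriv φ z‖ * (1 - ‖z‖ ^ 2) := by
  have hzΩ : φ z ∈ Ω := himg ▸ mem_image_of_mem φ hz
  have hd : 0 < infDist (φ z) Ωᶜ :=
    (hΩ.isClosed_compl.notMem_iff_infDist_pos hne).1 (by simpa using hzΩ)
  have hsub : ball (φ z) (infDist (φ z) Ωᶜ) ⊆ Ω :=
    disjoint_compl_right_iff_subset.1 disjoint_ball_infDist
  have hz' := mem_ball_zero_iff.1 hz
  have hinv : ∀ x ∈ Ω, ‖discInv φ x‖ < 1 ∧ DifferentiableAt ℂ (discInv φ) x := by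
    intro x hx
    rw [← himg] at hx
    obtain ⟨y, hy, rfl⟩ := hx
    exact ⟨by rw [hφ.discInv_apply hy]; exact mem_ball_zero_iff.1 hy,
      (hφ.hasDerivAt_discInv hy).differentiableAt⟩
  have hψd : DifferentiableOn ℂ (fun x => mob z (discInv φ x)) (ball (φ z) (infDist (φ z) Ωᶜ)) :=
    fun x hx => ((hasDerivAt_mob hz' (hinv x (hsub hx)).1).differentiableAt.comp x
      (hinv x (hsub hx)).2).differentiableWithinAt
  have h0 : mob z (discInv φ (φ z)) = 0 := by rw [hφ.discInv_apply hz]; simp [mob]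
  have hS := Complex.norm_deriv_le_div_of_mapsTo_ball (R₂ := 1) hψd (fun x hx => by
    rw [h0, mem_closedBall_zero_iff]; exact (norm_mob_lt hz' (hinv x (hsub hx)).1).le) hd
  have hder : HasDerivAt (fun x => mob z (discInv φ x))
      ((1 - (‖z‖ : ℂ) ^ 2) / (1 - (starRingEnd ℂ) z * z) ^ 2 * (deriv φ z)⁻¹) (φ z) := by
    have := hasDerivAt_mob hz' hz'
    rw [← hφ.discInv_apply hz] at this
    have h2 := this.comp (φ z) (hφ.hasDerivAt_discInv hz)
    simp only [hφ.discInv_apply hz] at h2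
    exact h2
  have hpos : 0 < 1 - ‖z‖ ^ 2 := by nlinarith [norm_nonneg z]
  have hderne := norm_pos_iff.2 (hφ.ne z hz)
  have e : ‖(1 - (‖z‖ : ℂ) ^ 2) / (1 - (starRingEnd ℂ) z * z) ^ 2 * (deriv φ z)⁻¹‖ =
      1 / (‖deriv φ z‖ * (1 - ‖z‖ ^ 2)) := by
    rw [Complex.conj_mul', norm_mul, norm_div, norm_inv, norm_pow,
      show (1 : ℂ) - (‖z‖ : ℂ) ^ 2 = ((1 - ‖z‖ ^ 2 : ℝ) : ℂ) by push_cast; ring, Complex.norm_real,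
      Real.norm_of_nonneg hpos.le]
    field_simp
  rw [hder.deriv, e, div_le_div_iff₀ (by positivity) hd] at hS
  linarith

lemma DiscMap.avoids_compact (hφ : DiscMap φ) (himg : φ '' ball 0 1 = Ω) {K : Set ℂ}
    (hK : IsCompact K) (hKΩ : K ⊆ Ω) : ∃ ρ : ℝ, ρ < 1 ∧ ∀ z ∈ ball (0 : ℂ) 1, ρ ≤ ‖z‖ → φ z ∉ K := by
  have hc : ContinuousOn (fun x => ‖discInv φ x‖) K := by
    intro x hx
    have := hKΩ hx
    rw [← himg] at this
    obtain ⟨y, hy, rfl⟩ := this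
    exact (hφ.hasDerivAt_discInv hy).continuousAt.norm.continuousWithinAt
  rcases K.eq_empty_or_nonempty with rfl | hne
  · exact ⟨0, one_pos, fun z _ _ h => h.elim⟩
  obtain ⟨x, hx, hmax⟩ := hK.exists_isMaxOn hne hc
  have hx1 : ‖discInv φ x‖ < 1 := by
    have := hKΩ hx
    rw [← himg] at this
    obtain ⟨y, hy, rfl⟩ := this
    rw [hφ.discInv_apply hy]; exact mem_ball_zero_iff.1 hy
  refine ⟨(1 + ‖discInv φ x‖) / 2, by linarith, fun z hz hzr hzK => ?_⟩
  have := hmax hzK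
  simp only [mem_ofPred_eq, hφ.discInv_apply hz] at this
  linarith

/-- A simply connected domain on whose boundary two solutions agree carries total mass
greater than `4π`. -/
theorem LPair.domain_area (h : LPair v₁ v₂ F) (hΩ : IsOpen Ω) (hsc : IsSimplyConnected Ω)
    (hb : Bornology.IsBounded Ω) (hpos : ∀ z ∈ Ω, v₁ z < v₂ z)
    (hfr : ∀ z ∈ frontier Ω, v₁ z = v₂ z) : 4 * π < ∫ z in Ω, etot v₁ v₂ z := by
  obtain ⟨φ, hd, hi, himg, hdn⟩ := riemann_mapping hΩ hsc hb
  have hφ : DiscMap φ := ⟨hd, hi, hdn⟩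
  have hmem : ∀ z ∈ ball (0 : ℂ) 1, φ z ∈ Ω := fun z hz => himg ▸ mem_image_of_mem φ hz
  have hne : Ωᶜ.Nonempty := by
    rw [nonempty_compl]; rintro rfl; exact NormedSpace.unbounded_univ ℝ ℂ hb
  obtain ⟨δ, K, hδ, hK0, hK⟩ := h.boundary_estimate hΩ hb hpos hfr
  have hcl : IsCompact (closure Ω) := Metric.isCompact_of_isClosed_isBounded isClosed_closure hb.closure
  have hwc : Continuous fun z => v₂ z - v₁ z := continuous_iff_continuousAt.2 fun z => (h.smw z).continuousAt
  have hdc : Continuous fun z => infDist z Ωᶜ := continuous_infDist_pt _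
  have hcore : ∀ d : ℝ, 0 < d → IsCompact {z | d ≤ infDist z Ωᶜ} ∧ {z | d ≤ infDist z Ωᶜ} ⊆ Ω := by
    intro d hd
    have hs : {z | d ≤ infDist z Ωᶜ} ⊆ Ω := by
      intro z hz
      by_contra hcon
      have : infDist z Ωᶜ = 0 := infDist_zero_of_mem hcon
      rw [mem_ofPred_eq, this] at hz; linarith
    exact ⟨Metric.isCompact_of_isClosed_isBounded (isClosed_le continuous_const hdc) (hb.subset hs), hs⟩
  have hnear : ∀ d : ℝ, 0 < d → ∃ ρ : ℝ, ρ < 1 ∧ ∀ z ∈ ball (0 : ℂ) 1, ρ ≤ ‖z‖ → infDist (φ z) Ωᶜ < d := by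
    intro d hd
    obtain ⟨ρ, h1, h2⟩ := hφ.avoids_compact himg (hcore d hd).1 (hcore d hd).2
    exact ⟨ρ, h1, fun z hz hr => not_le.1 (h2 z hz hr)⟩
  obtain ⟨B, hB⟩ := hcl.bddAbove_image (f := fun z => rexp (v₂ z)) (continuous_iff_continuousAt.2
    fun z => (h.sm2 z).exp.continuousAt).continuousOn
  have hB' : ∀ z ∈ Ω, rexp (v₂ z) ≤ B := fun z hz => hB ⟨z, subset_closure hz, rfl⟩
  have hB0 : 0 ≤ B := (exp_pos _).le.trans (hB' _ (hmem 0 (by simp)))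
  have hed : ∀ z ∈ Ω, |ediff v₁ v₂ z| ≤ B * (v₂ z - v₁ z) := by
    intro z hz
    have h1 := hpos z hz
    have h2 : rexp (v₁ z) ≤ rexp (v₂ z) := Real.exp_le_exp.2 h1.le
    rw [ediff, abs_of_nonneg (by linarith)]
    have h3 : rexp (v₁ z) = rexp (v₂ z) * rexp (-(v₂ z - v₁ z)) := by rw [← Real.exp_add]; ring_nf
    have h4 := Real.add_one_le_exp (-(v₂ z - v₁ z))
    have h5 := hB' z hz
    have h6 := exp_pos (v₂ z)
    calc rexp (v₂ z) - rexp (v₁ z) ≤ rexp (v₂ z) * (v₂ z - v₁ z) := by rw [h3]; nlinarith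
      _ ≤ _ := mul_le_mul_of_nonneg_right h5 (by linarith)
  rw [← himg]
  refine disc_area hφ h (by rwa [himg]) (by rwa [himg]) ?_ ?_ ?_ ?_
  · intro ε hε
    have hKs : closure Ω ∩ {z | ε ≤ v₂ z - v₁ z} ⊆ Ω := by
      rintro z ⟨hz1, hz2⟩
      by_contra hcon
      have := hfr z ⟨hz1, by rwa [hΩ.interior_eq]⟩
      simp only [mem_ofPred_eq, this, sub_self] at hz2; linarith
    obtain ⟨ρ, h1, h2⟩ := hφ.avoids_compact himg
      (hcl.inter_right (isClosed_le continuous_const hwc)) hKs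
    exact ⟨ρ, h1, fun z hz hr => not_le.1 fun hcon => h2 z hz hr ⟨subset_closure (hmem z hz), hcon⟩⟩
  · obtain ⟨hc1, hc2⟩ := hcore δ hδ
    rcases {z | δ ≤ infDist z Ωᶜ}.eq_empty_or_nonempty with he | hne'
    · refine ⟨1, one_pos, fun z hz _ => (hK _ (hmem z hz) (not_le.1 fun hcon => ?_)).1⟩
      exact (he ▸ hcon : φ z ∈ (∅ : Set ℂ))
    · obtain ⟨x, hx, hmin⟩ := hc1.exists_isMinOn hne' hwc.continuousOn
      have hx0 := hpos x (hc2 hx)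
      refine ⟨(v₂ x - v₁ x) / 2, by linarith, fun z hz hle => ?_⟩
      refine (hK _ (hmem z hz) (not_le.1 fun hcon => ?_)).1
      have : v₂ x - v₁ x ≤ v₂ (φ z) - v₁ (φ z) := hmin hcon
      linarith
  · obtain ⟨ρ, h1, h2⟩ := hnear δ hδ
    refine ⟨2 * B * (B * K), ρ, h1, fun z hz hr => ?_⟩
    have hzΩ := hmem z hz
    have h3 := (hK _ hzΩ (h2 z hz hr)).2
    have h4 := hφ.infDist_le himg hΩ hne hz
    have h5 : |lap2 (fun z => v₂ z - v₁ z) (φ z)| ≤ 2 * B * |ediff v₁ v₂ (φ z)| := by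
      rw [h.lap_w, show rexp (v₁ (φ z)) ^ 2 - rexp (v₂ (φ z)) ^ 2 =
        -(rexp (v₁ (φ z)) + rexp (v₂ (φ z))) * ediff v₁ v₂ (φ z) by rw [ediff]; ring, abs_mul]
      refine mul_le_mul_of_nonneg_right ?_ (abs_nonneg _)
      have h6 := hB' _ hzΩ
      have h7 : rexp (v₁ (φ z)) ≤ rexp (v₂ (φ z)) := Real.exp_le_exp.2 (hpos _ hzΩ).le
      rw [abs_neg, abs_of_nonneg (by positivity)]; linarith
    refine h5.trans ?_
    calc 2 * B * |ediff v₁ v₂ (φ z)| ≤ 2 * B * (B * (v₂ (φ z) - v₁ (φ z))) := by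
          have := hed _ hzΩ; gcongr
      _ ≤ 2 * B * (B * (K * infDist (φ z) Ωᶜ * ‖cgrad (fun z => v₂ z - v₁ z) (φ z)‖)) := by gcongr
      _ ≤ 2 * B * (B * (K * (‖deriv φ z‖ * (1 - ‖z‖ ^ 2)) *
          ‖cgrad (fun z => v₂ z - v₁ z) (φ z)‖)) := by gcongr
      _ = _ := by ring
  · intro ε hε
    obtain ⟨ρ, h1, h2⟩ := hnear (min δ (ε / (B * K + 1))) (by positivity)
    refine ⟨ρ, h1, fun z hz hr => ?_⟩
    have hzΩ := hmem z hz
    have h2' := h2 z hz hr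
    have h3 := (hK _ hzΩ (h2'.trans_le (min_le_left _ _))).2
    have h4 : infDist (φ z) Ωᶜ * (B * K + 1) ≤ ε :=
      (le_div_iff₀ (by positivity)).1 (h2'.le.trans (min_le_right _ _))
    have h5 : 0 ≤ infDist (φ z) Ωᶜ := infDist_nonneg
    calc |ediff v₁ v₂ (φ z)| ≤ B * (v₂ (φ z) - v₁ (φ z)) := hed _ hzΩ
      _ ≤ B * (K * infDist (φ z) Ωᶜ * ‖cgrad (fun z => v₂ z - v₁ z) (φ z)‖) := by gcongr
      _ = (infDist (φ z) Ωᶜ * (B * K)) * ‖cgrad (fun z => v₂ z - v₁ z) (φ z)‖ := by ring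
      _ ≤ _ := by gcongr; linarith

end DomainArea

section Sphere

open Filter Topology Set
open Complex (I)

lemma pd_homogeneous {u : E3 → ℝ} {r c : ℝ} (h : ∀ x, u (r • x) = c * u x) (v x : E3)
    (hx : DifferentiableAt ℝ u x) : r * pd v u (r • x) = c * pd v u x := by
  have h1 : fderiv ℝ (fun x => u (r • x)) x = r • fderiv ℝ u (r • x) := fderiv_comp_smul r
  rw [← pd_const_mul v c hx, pd, pd, ← (funext h : (fun x => u (r • x)) = fun x => c * u x), h1]
  simp

variable {u : E3 → ℝ} {α : ℝ}

lemma MFE.smAt (hu : MFE u α) {x : E3} (hx : x ≠ 0) : SmAt u x := by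
  filter_upwards [isOpen_ne.mem_nhds hx] with z hz
  exact hu.1.contDiffAt (isOpen_compl_singleton.mem_nhds hz)

lemma MFE.pd_smul (hu : MFE u α) {x : E3} (hx : x ≠ 0) (v : E3) {r : ℝ} (hr : 0 < r) :
    pd v u (r • x) = r⁻¹ * pd v u x := by
  have := pd_homogeneous (u := u) (c := 1) (fun x => by rw [hu.2.1 x r hr, one_mul]) v x
    (hu.smAt hx).diff
  field_simp
  linarith

lemma MFE.pd_pd_smul (hu : MFE u α) {x : E3} (hx : x ≠ 0) (v w : E3) {r : ℝ} (hr : 0 < r) :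
    pd v (pd w u) (r • x) = (r ^ 2)⁻¹ * pd v (pd w u) x := by
  have h1 : fderiv ℝ (fun x => pd w u (r • x)) x = r • fderiv ℝ (pd w u) (r • x) :=
    fderiv_comp_smul r
  have h2 : (fun x => pd w u (r • x)) =ᶠ[𝓝 x] fun x => r⁻¹ * pd w u x := by
    filter_upwards [isOpen_ne.mem_nhds hx] with z hz using hu.pd_smul hz w hr
  have h3 := pd_congr v h2
  rw [pd_const_mul v _ ((hu.smAt hx).pd w).diff, pd, h1] at h3
  simp only [smul_apply, smul_eq_mul] at h3
  change r * pd v (pd w u) (r • x) = _ at h3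
  field_simp at h3 ⊢
  linarith

/-- Euler's identity for the derivatives of a homogeneous function. -/
lemma MFE.pd_self_pd (hu : MFE u α) {x : E3} (hx : x ≠ 0) (v : E3) :
    pd x (pd v u) x = - pd v u x := by
  have hd := ((hu.smAt hx).pd v).diff
  have h1 : HasDerivAt (fun r : ℝ => r • x) x 1 := by
    simpa using (hasDerivAt_id (1 : ℝ)).smul_const x
  have h2 : HasDerivAt (fun r : ℝ => pd v u (r • x)) (pd x (pd v u) x) 1 :=
    HasFDerivAt.comp_hasDerivAt (l := pd v u) (1 : ℝ) (by simpa using hd.hasFDerivAt) h1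
  have h3 : HasDerivAt (fun r : ℝ => r⁻¹ * pd v u x) (-1 * pd v u x) 1 := by
    simpa using (hasDerivAt_inv (one_ne_zero (α := ℝ))).mul_const (pd v u x)
  have h4 : (fun r : ℝ => pd v u (r • x)) =ᶠ[𝓝 1] fun r : ℝ => r⁻¹ * pd v u x := by
    filter_upwards [lt_mem_nhds (zero_lt_one (α := ℝ))] with r hr using hu.pd_smul hx v hr
  rw [h2.unique (h3.congr_of_eventuallyEq h4)]; ring

lemma lap_eq_pd {x : E3} (hu : SmAt u x) (b : OrthonormalBasis (Fin 3) ℝ E3) :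
    lap u x = pd (b 0) (pd (b 0) u) x + pd (b 1) (pd (b 1) u) x + pd (b 2) (pd (b 2) u) x := by
  have h1 := congrFun (InnerProductSpace.laplacian_eq_iteratedFDeriv_orthonormalBasis u b) x
  have h2 := congrFun (InnerProductSpace.laplacian_eq_iteratedFDeriv_orthonormalBasis u
    (EuclideanSpace.basisFun (Fin 3) ℝ)) x
  have h3 : lap u x = ∑ i, iteratedFDeriv ℝ 2 u x ![b i, b i] := by
    rw [← h1, h2]; simp [lap]
  rw [h3, Fin.sum_univ_three]
  simp only [pd_pd _ _ hu, iteratedFDeriv_two_apply]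
  simp

/-- The inverse stereographic projection, without its normalising factor `1 + ‖z‖ ^ 2`. -/
noncomputable def stereo (b : OrthonormalBasis (Fin 3) ℝ E3) (ε : ℝ) (z : ℂ) : E3 :=
  (2 * z.re) • b 0 + (2 * z.im) • b 1 + (ε * (1 - (z.re ^ 2 + z.im ^ 2))) • b 2

variable (b : OrthonormalBasis (Fin 3) ℝ E3) {ε : ℝ}

lemma OrthonormalBasis.inner_lin (x y z x' y' z' : ℝ) :
    ⟪x • b 0 + y • b 1 + z • b 2, x' • b 0 + y' • b 1 + z' • b 2⟫ = x * x' + y * y' + z * z' := by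
  have := b.orthonormal
  rw [orthonormal_iff_ite] at this
  simp only [inner_add_left, inner_add_right, inner_smul_left, inner_smul_right, this]
  simp
  ring

lemma norm_stereo (hε : ε ^ 2 = 1) (z : ℂ) : ‖stereo b ε z‖ = 1 + ‖z‖ ^ 2 := by
  rw [← sq_eq_sq₀ (norm_nonneg _) (by positivity), sq_norm_re_im, ← real_inner_self_eq_norm_sq,
    stereo, b.inner_lin]
  linear_combination (1 - (z.re ^ 2 + z.im ^ 2)) ^ 2 * hε

lemma stereo_ne_zero (hε : ε ^ 2 = 1) (z : ℂ) : stereo b ε z ≠ 0 := by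
  rw [← norm_pos_iff, norm_stereo b hε]; positivity

lemma contDiff_stereo : ContDiff ℝ ∞ (stereo b ε) := by
  have h1 : ContDiff ℝ ∞ Complex.re := Complex.reCLM.contDiff
  have h2 : ContDiff ℝ ∞ Complex.im := Complex.imCLM.contDiff
  unfold stereo
  exact (((contDiff_const.mul h1).smul contDiff_const).add
    ((contDiff_const.mul h2).smul contDiff_const)).add
    ((contDiff_const.mul (contDiff_const.sub ((h1.pow 2).add (h2.pow 2)))).smul contDiff_const)

lemma SmAt.comp_stereo {f : E3 → ℝ} {z : ℂ} (hf : SmAt f (stereo b ε z)) :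
    SmAt (fun z => f (stereo b ε z)) z :=
  ((contDiff_stereo b).continuous.continuousAt.eventually hf).mono fun w hw =>
    ContDiffAt.comp w hw (contDiff_stereo b).contDiffAt

lemma pd_comp_stereo {f : E3 → ℝ} {z : ℂ} (hf : DifferentiableAt ℝ f (stereo b ε z)) (v : ℂ) :
    pd v (fun z => f (stereo b ε z)) z = 2 * v.re * pd (b 0) f (stereo b ε z) +
      2 * v.im * pd (b 1) f (stereo b ε z) -
      2 * ε * (z.re * v.re + z.im * v.im) * pd (b 2) f (stereo b ε z) := by
  have h1 : HasFDerivAt Complex.re Complex.reCLM z := Complex.reCLM.hasFDerivAt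
  have h2 : HasFDerivAt Complex.im Complex.imCLM z := Complex.imCLM.hasFDerivAt
  have h3 : HasFDerivAt (stereo b ε) _ z :=
    (((h1.const_mul 2).smul_const (b 0)).add ((h2.const_mul 2).smul_const (b 1))).add
      ((((h1.pow 2).add (h2.pow 2)).const_sub 1).const_mul ε |>.smul_const (b 2))
  have h4 := hf.hasFDerivAt.comp z h3
  rw [pd, show (fun z => f (stereo b ε z)) = f ∘ stereo b ε from rfl, h4.fderiv]
  simp [pd]
  ring

lemma MFE.lap2_comp_stereo (hu : MFE u α) (hε : ε ^ 2 = 1) (z : ℂ) :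
    lap2 (fun z => u (stereo b ε z)) z =
      4 / (1 + ‖z‖ ^ 2) ^ 2 * (α - exp (2 * u (stereo b ε z))) := by
  have hne : ∀ z, stereo b ε z ≠ 0 := stereo_ne_zero b hε
  have sm := fun z => hu.smAt (hne z)
  set P := stereo b ε z with hP
  have e1 : pd 1 (fun z => u (stereo b ε z)) = fun z => 2 * pd (b 0) u (stereo b ε z) -
      2 * ε * z.re * pd (b 2) u (stereo b ε z) := by
    ext z; rw [pd_comp_stereo b (sm z).diff]; simp
  have e2 : pd I (fun z => u (stereo b ε z)) = fun z => 2 * pd (b 1) u (stereo b ε z) -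
      2 * ε * z.im * pd (b 2) u (stereo b ε z) := by
    ext z; rw [pd_comp_stereo b (sm z).diff]; simp
  have s : ∀ i, SmAt (fun z => pd (b i) u (stereo b ε z)) z := fun i =>
    ((sm z).pd _).comp_stereo b
  have s1 : SmAt (fun z : ℂ => 2 * ε * z.re) z := (SmAt.const _ z).mul (smAt_re z)
  have s2 : SmAt (fun z : ℂ => 2 * ε * z.im) z := (SmAt.const _ z).mul (smAt_im z)
  have d := fun i => ((sm z).pd (b i)).diff
  have L : lap2 (fun z => u (stereo b ε z)) z = 4 * lap u P := by
    have eul := hu.pd_self_pd (hne z) (b 2)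
    rw [← hP] at eul
    have lin : pd P (pd (b 2) u) P = 2 * z.re * pd (b 0) (pd (b 2) u) P +
        2 * z.im * pd (b 1) (pd (b 2) u) P +
        ε * (1 - (z.re ^ 2 + z.im ^ 2)) * pd (b 2) (pd (b 2) u) P := by
      conv_lhs => rw [pd]
      conv_lhs => enter [2]; rw [hP, stereo]
      simp [pd]
    rw [lap2, e1, e2, pd_sub _ ((SmAt.const 2 z).mul (s 0)).diff (s1.mul (s 2)).diff,
      pd_sub _ ((SmAt.const 2 z).mul (s 1)).diff (s2.mul (s 2)).diff,
      pd_const_mul _ _ (s 0).diff, pd_const_mul _ _ (s 1).diff, pd_mul _ s1.diff (s 2).diff,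
      pd_mul _ s2.diff (s 2).diff, pd_const_mul _ _ (smAt_re z).diff,
      pd_const_mul _ _ (smAt_im z).diff, pd_re, pd_im, pd_comp_stereo b (d 0),
      pd_comp_stereo b (d 1), pd_comp_stereo b (d 2), pd_comp_stereo b (d 2),
      lap_eq_pd (sm z) b, ← hP, pd_symm (b 2) (b 0) (sm z), pd_symm (b 2) (b 1) (sm z)]
    simp only [Complex.one_re, Complex.one_im, Complex.I_re, Complex.I_im]
    rw [← hP]
    rw [eul] at lin
    linear_combination 4 * ε * lin + 4 * pd (b 2) (pd (b 2) u) P * hε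
  have N : 0 < 1 + ‖z‖ ^ 2 := by positivity
  set Q := (1 + ‖z‖ ^ 2)⁻¹ • P with hQ
  have PQ : P = (1 + ‖z‖ ^ 2) • Q := by rw [hQ, smul_smul, mul_inv_cancel₀ N.ne', one_smul]
  have Q0 : Q ∈ S2 := by
    rw [S2, mem_sphere_zero_iff_norm, hQ, norm_smul, hP, norm_stereo b hε,
      Real.norm_of_nonneg (by positivity), inv_mul_cancel₀ N.ne']
  have Q1 : Q ≠ 0 := by
    intro h; rw [S2, mem_sphere_zero_iff_norm, h] at Q0; simp at Q0
  have L2 : lap u P = ((1 + ‖z‖ ^ 2) ^ 2)⁻¹ * lap u Q := by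
    rw [lap_eq_pd (sm z) b, lap_eq_pd (hu.smAt Q1) b, ← hP, PQ, hu.pd_pd_smul Q1 _ _ N,
      hu.pd_pd_smul Q1 _ _ N, hu.pd_pd_smul Q1 _ _ N]
    ring
  have uPQ : u P = u Q := by rw [PQ, hu.2.1 _ _ N]
  rw [L, L2, uPQ, ← hu.2.2 Q Q0]
  field_simp
  ring

lemma smAt_one_add_sq (z : ℂ) : SmAt (fun z => 1 + ‖z‖ ^ 2) z := by
  simpa using (SmAt.const 1 z).add (smAt_sq_norm_sub 0 z)

lemma lap2_log_one_add_sq (z : ℂ) :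
    lap2 (fun z => log (1 + ‖z‖ ^ 2)) z = 4 / (1 + ‖z‖ ^ 2) ^ 2 := by
  have s0 : SmAt (fun z : ℂ => ‖z‖ ^ 2) z := by simpa using smAt_sq_norm_sub 0 z
  have p : ∀ v, pd v (fun z : ℂ => ‖z‖ ^ 2) z = 2 * (z.re * v.re + z.im * v.im) := by
    intro v; simpa using pd_sq_norm_sub 0 v z
  have l : lap2 (fun z : ℂ => ‖z‖ ^ 2) z = 4 := by simpa using lap2_sq_norm_sub 0 z
  have l1 : lap2 (fun _ : ℂ => (1 : ℝ)) z = 0 := by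
    have : ∀ v : ℂ, pd v (fun _ : ℂ => (1 : ℝ)) = fun _ => 0 := fun v => funext (pd_const v 1)
    rw [lap2, this, this, pd_const, pd_const, add_zero]
  have N : 0 < 1 + ‖z‖ ^ 2 := by positivity
  rw [lap2_log (smAt_one_add_sq z) N.ne', lap2_add (SmAt.const 1 z) s0,
    pd_add _ (SmAt.const 1 z).diff s0.diff, pd_add _ (SmAt.const 1 z).diff s0.diff, l, l1, p, p,
    pd_const, pd_const]
  congr 1
  simp only [Complex.one_re, Complex.one_im, Complex.I_re, Complex.I_im]
  linear_combination 4 * sq_norm_re_im z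

/-- The conformal factor together with the pulled back solution. -/
noncomputable def stereoSol (u : E3 → ℝ) (b : OrthonormalBasis (Fin 3) ℝ E3) (ε : ℝ) (z : ℂ) : ℝ :=
  u (stereo b ε z) + (log 2 - log (1 + ‖z‖ ^ 2))

lemma exp_sq_stereoSol (z : ℂ) :
    exp (stereoSol u b ε z) ^ 2 = 4 / (1 + ‖z‖ ^ 2) ^ 2 * exp (2 * u (stereo b ε z)) := by
  have N : 0 < 1 + ‖z‖ ^ 2 := by positivity
  rw [stereoSol, exp_add, exp_sub, exp_log two_pos, exp_log N, two_mul, exp_add]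
  field_simp
  norm_num

lemma MFE.smAt_comp_stereo (hu : MFE u α) (hε : ε ^ 2 = 1) (z : ℂ) :
    SmAt (fun z => u (stereo b ε z)) z := (hu.smAt (stereo_ne_zero b hε z)).comp_stereo b

lemma MFE.smAt_stereoSol (hu : MFE u α) (hε : ε ^ 2 = 1) (z : ℂ) : SmAt (stereoSol u b ε) z :=
  (hu.smAt_comp_stereo b hε z).add
    ((SmAt.const _ z).sub ((smAt_one_add_sq z).log (by positivity)))

lemma MFE.lap2_stereoSol (hu : MFE u α) (hε : ε ^ 2 = 1) (z : ℂ) :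
    lap2 (stereoSol u b ε) z =
      -exp (stereoSol u b ε z) ^ 2 + (α - 1) * (4 / (1 + ‖z‖ ^ 2) ^ 2) := by
  have s := hu.smAt_comp_stereo b hε z
  have s1 : SmAt (fun z : ℂ => log (1 + ‖z‖ ^ 2)) z := (smAt_one_add_sq z).log (by positivity)
  have l1 : lap2 (fun _ : ℂ => log 2) z = 0 := by
    have : ∀ v : ℂ, pd v (fun _ : ℂ => log 2) = fun _ => 0 := fun v => funext (pd_const v _)
    rw [lap2, this, this, pd_const, pd_const, add_zero]
  rw [exp_sq_stereoSol]
  unfold stereoSol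
  rw [lap2_add s ((SmAt.const _ z).sub s1), lap2_sub (SmAt.const _ z) s1, l1,
    lap2_log_one_add_sq, hu.lap2_comp_stereo b hε]
  ring

lemma MFE.lpair (hu : MFE u α) (hα : 1 < α) :
    LPair (stereoSol u b 1) (stereoSol u b (-1))
      fun z => (α - 1) * (4 / (1 + ‖z‖ ^ 2) ^ 2) where
  sm1 := hu.smAt_stereoSol b (by norm_num)
  sm2 := hu.smAt_stereoSol b (by norm_num)
  eq1 := hu.lap2_stereoSol b (by norm_num)
  eq2 := hu.lap2_stereoSol b (by norm_num)
  pos z := by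
    have : 0 < α - 1 := by linarith
    positivity

end Sphere

section DiscDivergence

open Filter Topology Set Metric
open Complex (I)

/-- The closed half-infinite fundamental strip of the exponential. -/
def expStrip : Set ℂ := {s | s.re ≤ 0 ∧ 0 < s.im ∧ s.im ≤ 2 * π}

lemma measurableSet_expStrip : MeasurableSet expStrip :=
  (measurableSet_le Complex.measurable_re measurable_const).inter
    ((measurableSet_lt measurable_const Complex.measurable_im).inter
      (measurableSet_le Complex.measurable_im measurable_const))

lemma injOn_exp_expStrip : InjOn Complex.exp expStrip := by
  intro s hs t ht e
  obtain ⟨n, hn⟩ := Complex.exp_eq_exp_iff_exists_int.1 e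
  have h2 := congrArg Complex.im hn
  simp at h2
  have h3 : |(n : ℝ)| < 1 := by
    rw [abs_lt]
    have := hs.2; have := ht.2; have := Real.two_pi_pos
    constructor <;> nlinarith
  have h4 : n = 0 := Int.abs_lt_one_iff.1 (by exact_mod_cast h3)
  rw [hn, h4]; simp

/-- The punctured closed unit disc, as the image of a fundamental strip. -/
def pDisc : Set ℂ := Complex.exp '' expStrip

lemma pDisc_subset : pDisc ⊆ closedBall 0 1 := by
  rintro _ ⟨s, hs, rfl⟩
  rw [mem_closedBall_zero_iff, Complex.norm_exp]
  exact Real.exp_le_one_iff.2 hs.1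

lemma subset_pDisc : ball 0 1 \ {0} ⊆ pDisc := by
  rintro z ⟨hz, h0⟩
  have h0 : z ≠ 0 := h0
  rw [mem_ball_zero_iff] at hz
  have hl : Real.log ‖z‖ ≤ 0 := Real.log_nonpos (norm_nonneg _) hz.le
  have h1 := Complex.neg_pi_lt_arg z
  have h2 := Complex.arg_le_pi z
  by_cases ha : 0 < z.arg
  · exact ⟨Complex.log z, ⟨by simpa [Complex.log_re] using hl, by simpa [Complex.log_im] using ha,
      by rw [Complex.log_im]; linarith [pi_pos]⟩, Complex.exp_log h0⟩
  · push Not at ha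
    refine ⟨Complex.log z + 2 * π * I, ⟨by simpa [Complex.log_re] using hl, ?_, ?_⟩, ?_⟩
    · simp [Complex.log_im]; linarith
    · simp [Complex.log_im]; linarith
    · rw [Complex.exp_periodic, Complex.exp_log h0]

lemma integrableOn_pDisc {h : ℂ → ℝ} (hh : Continuous h) : IntegrableOn h pDisc :=
  (hh.continuousOn.integrableOn_compact (isCompact_closedBall 0 1)).mono_set pDisc_subset

lemma integral_pDisc (h : ℂ → ℝ) :
    (IntegrableOn h pDisc ↔
      IntegrableOn (fun s => ‖deriv Complex.exp s‖ ^ 2 * h (Complex.exp s)) expStrip) ∧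
    ∫ z in pDisc, h z = ∫ s in expStrip, ‖deriv Complex.exp s‖ ^ 2 * h (Complex.exp s) :=
  integrableOn_image_hol measurableSet_expStrip
    (fun _ _ => Complex.differentiableAt_exp) injOn_exp_expStrip h

lemma continuous_of_smAt {E : Type*} [NormedAddCommGroup E] [NormedSpace ℝ E] {f : E → ℝ}
    (hf : ∀ z, SmAt f z) : Continuous f :=
  continuous_iff_continuousAt.2 fun z => (hf z).continuousAt

/-- The divergence theorem on the unit disc. -/
lemma disc_divergence {G : ℂ → ℝ} (hG : ∀ z, SmAt G z) :
    ∫ z in pDisc, lap2 G z = ∫ t in (0 : ℝ)..2 * π, pd 1 (fun s => G (Complex.exp s)) (t * I) := by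
  have an : ∀ s, AnalyticAt ℂ Complex.exp s := fun s => analyticAt_cexp
  set H : ℂ → ℝ := fun s => G (Complex.exp s) with hH
  have sH : ∀ s, SmAt H s := fun s => (hG _).comp_hol (an s)
  have per : ∀ s, pd I H (s + 2 * π * I) = pd I H s := by
    intro s
    rw [pd_comp_hol (hG _).diff (an _).differentiableAt, pd_comp_hol (hG _).diff (an _).differentiableAt]
    simp only [Complex.deriv_exp, Complex.exp_periodic s]
  have key : ∀ n : ℕ, (∫ s in pRect (-n) 0, ‖deriv Complex.exp s‖ ^ 2 * lap2 G (Complex.exp s)) =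
      (∫ t in (0 : ℝ)..2 * π, pd 1 H (t * I)) -
        ∫ t in (0 : ℝ)..2 * π, pd 1 H ((-n : ℝ) + t * I) := by
    intro n
    have := strip_div' (a := -n) (b := 0) (by simp) (f := pd 1 H) (g := pd I H)
      (fun s _ _ => (sH s).pd 1) (fun s _ _ => (sH s).pd I) per
    rw [Complex.ofReal_zero] at this
    simp only [zero_add] at this
    rw [this]
    congr 1
    ext s
    rw [← lap2_comp_hol (hG _) (an s), lap2]
  have hU : (⋃ n : ℕ, pRect (-n) 0) = expStrip := by
    ext s
    simp only [mem_iUnion]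
    constructor
    · rintro ⟨n, hn⟩; exact ⟨hn.1.2, hn.2.1, hn.2.2⟩
    · rintro ⟨h1, h2, h3⟩
      obtain ⟨n, hn⟩ := exists_nat_gt (-s.re)
      exact ⟨n, ⟨by linarith, h1⟩, h2, h3⟩
  have cl : Continuous (lap2 G) := continuous_of_smAt fun z => (hG z).lap2
  have lim1 := tendsto_setIntegral_of_monotone (μ := volume) (s := fun n : ℕ => pRect (-n) 0)
    (f := fun s => ‖deriv Complex.exp s‖ ^ 2 * lap2 G (Complex.exp s))
    (fun n => measurableSet_pRect _ _)
    (fun m n hmn s hs => ⟨⟨lt_of_le_of_lt (by simpa using hmn) hs.1.1, hs.1.2⟩, hs.2⟩)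
    (by rw [hU]; exact (integral_pDisc _).1.1 (integrableOn_pDisc cl))
  rw [hU, ← (integral_pDisc _).2] at lim1
  have lim2 : Tendsto (fun n : ℕ => ∫ t in (0 : ℝ)..2 * π, pd 1 H ((-n : ℝ) + t * I)) atTop (𝓝 0) := by
    have cf : Continuous (fderiv ℝ G) := by
      refine ContDiff.continuous_fderiv (n := ∞) ?_ (by simp)
      exact contDiff_iff_contDiffAt.2 fun z => (hG z).cd
    obtain ⟨C, hC⟩ := (isCompact_closedBall (0 : ℂ) 1).exists_bound_of_continuousOn cf.continuousOn
    have hb : ∀ n : ℕ, ‖∫ t in (0 : ℝ)..2 * π, pd 1 H ((-n : ℝ) + t * I)‖ ≤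
        C * exp (-n) * |2 * π - 0| := by
      intro n
      refine intervalIntegral.norm_integral_le_of_norm_le_const fun t _ => ?_
      have ne : ‖Complex.exp ((-n : ℝ) + t * I)‖ = exp (-n) := by
        rw [Complex.norm_exp]; simp
      rw [pd_comp_hol (hG _).diff (an _).differentiableAt, pd]
      refine (ContinuousLinearMap.le_opNorm _ _).trans ?_
      rw [Complex.deriv_exp, mul_one, ne]
      gcongr
      exact hC _ (by rw [mem_closedBall_zero_iff, ne]; simp)
    refine squeeze_zero_norm hb ?_
    have : Tendsto (fun n : ℕ => exp (-(n : ℝ))) atTop (𝓝 0) :=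
      tendsto_exp_neg_atTop_nhds_zero.comp tendsto_natCast_atTop_atTop
    simpa using (this.const_mul C).mul_const |2 * π - 0|
  have lim3 := (tendsto_const_nhds (x := ∫ t in (0 : ℝ)..2 * π, pd 1 H (t * I))).sub lim2
  rw [sub_zero] at lim3
  exact tendsto_nhds_unique (lim1.congr key) lim3

lemma integral_conformal_factor : ∫ z in pDisc, 4 / (1 + ‖z‖ ^ 2) ^ 2 = 2 * π := by
  have h := disc_divergence (G := fun z => log (1 + ‖z‖ ^ 2))
    fun z => (smAt_one_add_sq z).log (by positivity)
  simp only [lap2_log_one_add_sq] at h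
  rw [h]
  have : ∀ t : ℝ, pd 1 (fun s => log (1 + ‖Complex.exp s‖ ^ 2)) (t * I) = 1 := by
    intro t
    have sm : SmAt (fun z : ℂ => log (1 + ‖z‖ ^ 2)) (Complex.exp (t * I)) :=
      (smAt_one_add_sq _).log (by positivity)
    have s0 : SmAt (fun z : ℂ => ‖z‖ ^ 2) (Complex.exp (t * I)) := by
      simpa using smAt_sq_norm_sub 0 (Complex.exp (t * I))
    rw [pd_comp_hol (f := fun z => log (1 + ‖z‖ ^ 2)) sm.diff Complex.differentiableAt_exp,
      pd_log _ (smAt_one_add_sq _).diff (by positivity), pd_add _ (SmAt.const 1 _).diff s0.diff,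
      pd_const]
    have p := pd_sq_norm_sub 0 (deriv Complex.exp (t * I) * 1) (Complex.exp (t * I))
    simp only [sub_zero] at p
    have q := sq_norm_re_im (Complex.exp (t * I))
    rw [p]
    simp only [Complex.zero_re, Complex.zero_im, sub_zero, Complex.deriv_exp, mul_one, ← sq]
    rw [← q, Complex.norm_exp_ofReal_mul_I]
    norm_num
  simp [this]

end DiscDivergence

section Total

open Filter Topology Set Metric
open Complex (I)

variable {u : E3 → ℝ} {α : ℝ} (b : OrthonormalBasis (Fin 3) ℝ E3)

lemma stereo_exp_neg_conj (s : ℂ) (ε : ℝ) :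
    stereo b ε (Complex.exp (-(starRingEnd ℂ) s)) =
      exp (-(2 * s.re)) • stereo b (-ε) (Complex.exp s) := by
  have h1 : exp (-s.re) = exp (-(2 * s.re)) * exp s.re := by rw [← exp_add]; ring_nf
  have h2 : exp (-s.re) * exp s.re = 1 := by rw [← exp_add]; simp
  simp only [stereo, smul_add, smul_smul]
  congr 2
  · congr 1
    simp only [Complex.exp_re, Complex.neg_re, Complex.neg_im, Complex.conj_re, Complex.conj_im, neg_neg]
    rw [h1]; ring
  · congr 1
    simp only [Complex.exp_im, Complex.neg_re, Complex.neg_im, Complex.conj_re, Complex.conj_im, neg_neg]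
    rw [h1]; ring
  · rw [← sq_norm_re_im, ← sq_norm_re_im, Complex.norm_exp, Complex.norm_exp]
    simp only [Complex.neg_re, Complex.conj_re]
    have h3 : exp (-(2 * s.re)) = exp (-s.re) ^ 2 := by rw [← exp_nat_mul]; push_cast; ring_nf
    rw [h3]
    linear_combination -ε * (exp (-s.re) * exp s.re + 1) * h2

lemma MFE.integral_etot (hu : MFE u α) :
    ∫ z in pDisc, etot (stereoSol u b 1) (stereoSol u b (-1)) z = 4 * π * α := by
  have s1 := hu.smAt_comp_stereo b (ε := 1) (by norm_num)
  have s2 := hu.smAt_comp_stereo b (ε := -1) (by norm_num)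
  set G : ℂ → ℝ := fun z => u (stereo b 1 z) + u (stereo b (-1) z) with hG
  have h := disc_divergence (G := G) fun z => (s1 z).add (s2 z)
  have hl : ∀ z, lap2 G z = 2 * α * (4 / (1 + ‖z‖ ^ 2) ^ 2) -
      etot (stereoSol u b 1) (stereoSol u b (-1)) z := by
    intro z
    rw [hG, lap2_add (s1 z) (s2 z), hu.lap2_comp_stereo b (by norm_num),
      hu.lap2_comp_stereo b (by norm_num), etot, exp_sq_stereoSol, exp_sq_stereoSol]
    ring
  have even : ∀ s, G (Complex.exp (-(starRingEnd ℂ) s)) = G (Complex.exp s) := by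
    intro s
    simp only [hG]
    rw [stereo_exp_neg_conj b s 1, stereo_exp_neg_conj b s (-1),
      hu.2.1 _ _ (exp_pos _), hu.2.1 _ _ (exp_pos _), neg_neg, add_comm]
  have flux : ∀ t : ℝ, pd 1 (fun s => G (Complex.exp s)) (t * I) = 0 := by
    intro t
    have sm : SmAt (fun s => G (Complex.exp s)) (t * I) :=
      SmAt.comp_hol (f := G) ((s1 _).add (s2 _)) analyticAt_cexp
    have line : HasDerivAt (fun r : ℝ => (r : ℂ) + t * I) 1 0 :=
      (Complex.ofRealCLM.hasDerivAt (x := (0 : ℝ))).add_const _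
    have h2 : HasDerivAt (fun r : ℝ => G (Complex.exp (r + t * I)))
        (pd 1 (fun s => G (Complex.exp s)) (t * I)) 0 :=
      HasFDerivAt.comp_hasDerivAt (l := fun s => G (Complex.exp s)) (0 : ℝ)
        (by simpa using sm.diff.hasFDerivAt) line
    have h3 : (fun r : ℝ => G (Complex.exp ((-r : ℝ) + t * I))) =
        fun r : ℝ => G (Complex.exp (r + t * I)) := by
      ext r
      rw [← even (r + t * I)]
      simp [add_comm]
    have h4 := deriv_comp_neg (fun r : ℝ => G (Complex.exp (r + t * I))) 0
    rw [h3, neg_zero, h2.deriv] at h4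
    linarith
  have ci : IntegrableOn (etot (stereoSol u b 1) (stereoSol u b (-1))) pDisc :=
    integrableOn_pDisc (continuous_of_smAt fun z => by
      have a1 := hu.smAt_stereoSol b (ε := 1) (by norm_num) z
      have a2 := hu.smAt_stereoSol b (ε := -1) (by norm_num) z
      exact (a1.exp.pow 2).add (a2.exp.pow 2))
  have cq : IntegrableOn (fun z : ℂ => 2 * α * (4 / (1 + ‖z‖ ^ 2) ^ 2)) pDisc :=
    integrableOn_pDisc (continuous_const.mul (continuous_const.div₀ (by fun_prop)
      fun z => by positivity))
  simp only [hl, flux, intervalIntegral.integral_zero] at h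
  rw [integral_sub cq ci, integral_const_mul, integral_conformal_factor] at h
  linarith

end Total

section NodalDomains

open Filter Topology Set Metric
open Complex (I)

variable {u : E3 → ℝ} {α : ℝ} (b : OrthonormalBasis (Fin 3) ℝ E3)

/-- The inverse stereographic projection from `-b 2`. -/
noncomputable def nstereo (z : ℂ) : E3 := (1 + ‖z‖ ^ 2)⁻¹ • stereo b 1 z

/-- The stereographic projection from `-b 2`. -/
noncomputable def stereoProj (x : E3) : ℂ :=
  ⟨⟪x, b 0⟫ / (1 + ⟪x, b 2⟫), ⟪x, b 1⟫ / (1 + ⟪x, b 2⟫)⟩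

lemma one_add_sq_pos (z : ℂ) : 0 < 1 + ‖z‖ ^ 2 := by positivity

lemma continuous_nstereo : Continuous (nstereo b) :=
  (Continuous.inv₀ (by fun_prop) fun z => (one_add_sq_pos z).ne').smul (contDiff_stereo b).continuous

lemma nstereo_mem (z : ℂ) : nstereo b z ∈ S2 := by
  rw [S2, mem_sphere_zero_iff_norm, nstereo, norm_smul, norm_stereo b (by norm_num),
    Real.norm_of_nonneg (inv_nonneg.2 (one_add_sq_pos z).le), inv_mul_cancel₀ (one_add_sq_pos z).ne']

lemma OrthonormalBasis.inner_lin_basis (x y z : ℝ) :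
    ⟪x • b 0 + y • b 1 + z • b 2, b 0⟫ = x ∧ ⟪x • b 0 + y • b 1 + z • b 2, b 1⟫ = y ∧
      ⟪x • b 0 + y • b 1 + z • b 2, b 2⟫ = z := by
  have := b.orthonormal
  rw [orthonormal_iff_ite] at this
  simp only [inner_add_left, inner_smul_left, this]
  simp

lemma inner_nstereo (z : ℂ) : ⟪nstereo b z, b 0⟫ = 2 * z.re / (1 + ‖z‖ ^ 2) ∧
    ⟪nstereo b z, b 1⟫ = 2 * z.im / (1 + ‖z‖ ^ 2) ∧
    ⟪nstereo b z, b 2⟫ = (1 - ‖z‖ ^ 2) / (1 + ‖z‖ ^ 2) := by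
  obtain ⟨h0, h1, h2⟩ := b.inner_lin_basis (2 * z.re) (2 * z.im) (1 * (1 - (z.re ^ 2 + z.im ^ 2)))
  simp only [nstereo, stereo, real_inner_smul_left] at *
  rw [h0, h1, h2, ← sq_norm_re_im]
  refine ⟨?_, ?_, ?_⟩ <;> ring

lemma stereoProj_nstereo (z : ℂ) : stereoProj b (nstereo b z) = z := by
  have := one_add_sq_pos z
  obtain ⟨h0, h1, h2⟩ := inner_nstereo b z
  have h3 : 1 + (1 - ‖z‖ ^ 2) / (1 + ‖z‖ ^ 2) = 2 / (1 + ‖z‖ ^ 2) := by field_simp; ring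
  apply Complex.ext
  · simp only [stereoProj, h0, h2, h3]; field_simp
  · simp only [stereoProj, h1, h2, h3]; field_simp

lemma nstereo_stereoProj {x : E3} (hx : x ∈ S2) (h : 0 < 1 + ⟪x, b 2⟫) :
    nstereo b (stereoProj b x) = x := by
  have hs : x = ⟪x, b 0⟫ • b 0 + ⟪x, b 1⟫ • b 1 + ⟪x, b 2⟫ • b 2 := by
    conv_lhs => rw [← b.sum_repr x, Fin.sum_univ_three]
    simp only [b.repr_apply_apply, real_inner_comm]
  have hn : ⟪x, b 0⟫ ^ 2 + ⟪x, b 1⟫ ^ 2 + ⟪x, b 2⟫ ^ 2 = 1 := by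
    have h1 := b.inner_lin ⟪x, b 0⟫ ⟪x, b 1⟫ ⟪x, b 2⟫ ⟪x, b 0⟫ ⟪x, b 1⟫ ⟪x, b 2⟫
    rw [← hs, real_inner_self_eq_norm_sq, mem_sphere_zero_iff_norm.1 hx] at h1
    linarith
  have hz : ‖stereoProj b x‖ ^ 2 = (1 - ⟪x, b 2⟫) / (1 + ⟪x, b 2⟫) := by
    rw [sq_norm_re_im]
    simp only [stereoProj]
    field_simp
    linear_combination hn
  have hN : 1 + (1 - ⟪x, b 2⟫) / (1 + ⟪x, b 2⟫) = 2 / (1 + ⟪x, b 2⟫) := by field_simp; ring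
  rw [nstereo, stereo, ← sq_norm_re_im, hz, hN]
  simp only [stereoProj, smul_add, smul_smul]
  conv_rhs => rw [hs]
  congr 2
  · congr 1; field_simp
  · congr 1; field_simp
  · field_simp; ring

lemma refl_nstereo (z : ℂ) : Refl (b 2) (nstereo b z) = (1 + ‖z‖ ^ 2)⁻¹ • stereo b (-1) z := by
  rw [Refl, (inner_nstereo b z).2.2, nstereo, stereo, stereo, ← sq_norm_re_im]
  module

lemma MFE.nodal_apply (hu : MFE u α) (z : ℂ) :
    u (nstereo b z) - u (Refl (b 2) (nstereo b z)) =
      stereoSol u b 1 z - stereoSol u b (-1) z := by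
  have := inv_pos.2 (one_add_sq_pos z)
  rw [refl_nstereo, nstereo, hu.2.1 _ _ this, hu.2.1 _ _ this, stereoSol, stereoSol]
  ring

/-- The planar picture of a nodal domain inside the half-sphere. -/
lemma MFE.exists_planar_domain (hu : MFE u α) (hα : 1 < α) {w : E3 → ℝ}
    (hw : w = fun x => u x - u (Refl (b 2) x)) {Ω : Set E3} (hΩ : IsNodalDomain w Ω)
    (hsc : SimplyConnectedSpace Ω) (hH : Ω ⊆ halfSphere (b 2)) :
    nstereo b ⁻¹' Ω ⊆ ball 0 1 ∧ IsOpen (nstereo b ⁻¹' Ω) ∧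
      4 * π < ∫ z in nstereo b ⁻¹' Ω, etot (stereoSol u b 1) (stereoSol u b (-1)) z := by
  set v₁ := stereoSol u b 1 with hv₁
  set v₂ := stereoSol u b (-1) with hv₂
  have L : LPair v₁ v₂ _ := hu.lpair b hα
  have c₁ : Continuous v₁ := continuous_of_smAt L.sm1
  have c₂ : Continuous v₂ := continuous_of_smAt L.sm2
  have wz : ∀ z, w (nstereo b z) = v₁ z - v₂ z := fun z => by rw [hw]; exact hu.nodal_apply b z
  obtain ⟨x₀, hx₀, hwx₀, hΩe⟩ := hΩ
  have sub : Ω ⊆ {z ∈ S2 | w z ≠ 0} := hΩe ▸ connectedComponentIn_subset _ _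
  have pos : ∀ x ∈ Ω, 0 < ⟪x, b 2⟫ := by
    intro x hx
    refine lt_of_le_of_ne (hH hx).2 fun h => (sub hx).2 ?_
    rw [hw]
    simp [Refl, ← h]
  set O := nstereo b ⁻¹' Ω with hO
  have hball : O ⊆ ball 0 1 := by
    intro z hz
    have h1 := pos _ hz
    rw [(inner_nstereo b z).2.2, div_pos_iff_of_pos_right (one_add_sq_pos z)] at h1
    rw [mem_ball_zero_iff]
    nlinarith [norm_nonneg z]
  have hne : ∀ z ∈ O, v₁ z ≠ v₂ z := by
    intro z hz h
    exact (sub hz).2 (by rw [wz, h, sub_self])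
  have absorb : ∀ (B : Set ℂ) (z : ℂ), IsPreconnected B → (∀ z ∈ B, v₁ z ≠ v₂ z) → z ∈ B → z ∈ O →
      B ⊆ O := by
    intro B z hB hBv hz hzO
    have h1 : nstereo b '' B ⊆ {z ∈ S2 | w z ≠ 0} := by
      rintro _ ⟨p, hp, rfl⟩
      exact ⟨nstereo_mem b p, by rw [wz]; exact sub_ne_zero.2 (hBv p hp)⟩
    have h2 := (hB.image _ (continuous_nstereo b).continuousOn).subset_connectedComponentIn
      (mem_image_of_mem _ hz) h1
    have h3 : nstereo b z ∈ connectedComponentIn {z ∈ S2 | w z ≠ 0} x₀ := hΩe ▸ hzO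
    rw [← connectedComponentIn_eq h3, ← hΩe] at h2
    exact fun p hp => h2 (mem_image_of_mem _ hp)
  have nbhd : ∀ z, v₁ z ≠ v₂ z → ∃ r > 0, ∀ p ∈ ball z r, v₁ p ≠ v₂ p := fun z hz =>
    Metric.mem_nhds_iff.1 ((isOpen_ne_fun c₁ c₂).mem_nhds hz)
  have hopen : IsOpen O := by
    rw [Metric.isOpen_iff]
    intro z hz
    obtain ⟨r, hr, h⟩ := nbhd z (hne z hz)
    exact ⟨r, hr, absorb _ z (convex_ball z r).isPreconnected h (mem_ball_self hr) hz⟩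
  have hfr : ∀ z ∈ frontier O, v₁ z = v₂ z := by
    intro z hz
    by_contra hv
    obtain ⟨r, hr, h⟩ := nbhd z hv
    obtain ⟨p, hp, hpO⟩ := mem_closure_iff_nhds.1 hz.1 _ (ball_mem_nhds z hr)
    have := absorb _ p (convex_ball z r).isPreconnected h hp hpO (mem_ball_self hr)
    rw [hopen.frontier_eq] at hz
    exact hz.2 this
  have hOsc : IsSimplyConnected O := by
    have cp : ContinuousOn (stereoProj b) Ω := by
      have e : stereoProj b = fun x => (((⟪x, b 0⟫ / (1 + ⟪x, b 2⟫) : ℝ) : ℂ) +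
          ((⟪x, b 1⟫ / (1 + ⟪x, b 2⟫) : ℝ) : ℂ) * I) := by
        funext x
        exact Complex.mk_eq_add_mul_I _ _
      have hd : ∀ x ∈ Ω, 1 + ⟪x, b 2⟫ ≠ 0 := fun x hx => by linarith [pos x hx]
      rw [e]
      have k : ∀ i, ContinuousOn (fun x : E3 => ⟪x, b i⟫) Ω := fun i => by fun_prop
      have q : ∀ i, ContinuousOn (fun x : E3 => ((⟪x, b i⟫ / (1 + ⟪x, b 2⟫) : ℝ) : ℂ)) Ω := fun i =>
        Complex.continuous_ofReal.comp_continuousOn ((k i).div (continuousOn_const.add (k 2)) hd)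
      exact (q 0).add ((q 1).mul continuousOn_const)
    have inv : ∀ x ∈ Ω, nstereo b (stereoProj b x) = x := fun x hx =>
      nstereo_stereoProj b (sub hx).1 (by linarith [pos x hx])
    have mem : ∀ x : Ω, stereoProj b x ∈ O := fun x => by
      change nstereo b _ ∈ Ω
      rw [inv x x.2]; exact x.2
    let e : O ≃ₜ Ω :=
      { toFun := fun z => ⟨nstereo b z, z.2⟩
        invFun := fun x => ⟨stereoProj b x, mem x⟩
        left_inv := fun z => Subtype.ext (stereoProj_nstereo b z)
        right_inv := fun x => Subtype.ext (inv x x.2)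
        continuous_toFun := ((continuous_nstereo b).comp continuous_subtype_val).subtype_mk _
        continuous_invFun := (continuousOn_iff_continuous_domRestrict.1 cp).subtype_mk mem }
    exact e.toHomotopyEquiv.simplyConnectedSpace
  have hbd : Bornology.IsBounded O := isBounded_ball.subset hball
  refine ⟨hball, hopen, ?_⟩
  have hpc : IsPreconnected O := hOsc.isPathConnected.isConnected.isPreconnected
  have hsign : (∀ z ∈ O, v₁ z < v₂ z) ∨ ∀ z ∈ O, v₂ z < v₁ z := by
    by_contra! hcon
    obtain ⟨⟨p, hp, hp'⟩, q, hq, hq'⟩ := hcon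
    obtain ⟨z, hz, hzv⟩ := hpc.intermediate_value₂ hq hp c₁.continuousOn c₂.continuousOn hq' hp'
    exact hne z hz hzv
  rcases hsign with hs | hs
  · exact L.domain_area hopen hOsc hbd hs hfr
  · have := L.symm.domain_area hopen hOsc hbd hs fun z hz => (hfr z hz).symm
    simpa only [etot, add_comm] using this

lemma IsNodalDomain.disjoint {w : E3 → ℝ} {Ω₁ Ω₂ : Set E3} (h₁ : IsNodalDomain w Ω₁)
    (h₂ : IsNodalDomain w Ω₂) (h : Ω₁ ≠ Ω₂) : Disjoint Ω₁ Ω₂ := by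
  obtain ⟨x₁, _, _, rfl⟩ := h₁
  obtain ⟨x₂, _, _, rfl⟩ := h₂
  rw [Set.disjoint_left]
  exact fun x h1 h2 => h ((connectedComponentIn_eq h1).trans (connectedComponentIn_eq h2).symm)

lemma exists_orthonormalBasis_last {y : E3} (hy : y ∈ S2) :
    ∃ b : OrthonormalBasis (Fin 3) ℝ E3, b 2 = y := by
  have hn : ‖y‖ = 1 := mem_sphere_zero_iff_norm.1 hy
  have ho : Orthonormal ℝ (({2} : Set (Fin 3)).domRestrict fun _ => y) := by
    rw [orthonormal_iff_ite]
    rintro ⟨i, rfl⟩ ⟨j, rfl⟩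
    simp [Set.domRestrict, hn]
  obtain ⟨b, hb⟩ := ho.exists_orthonormalBasis_extension_of_card_eq (by simp)
  exact ⟨b, hb 2 rfl⟩

end NodalDomains

theorem stmt9 (α : ℝ) (hα1 : 2 < α) (hα2 : α ≤ 3) (u : E3 → ℝ) (hu : MFE u α)
    (y : E3) (hy : y ∈ S2)
    (w : E3 → ℝ) (hw : w = fun x => u x - u (Refl y x))
    (hw0 : ∃ x ∈ S2, w x ≠ 0) :
    ¬ ∃ Ω₁ Ω₂ Ω₃ : Set E3, Ω₁ ≠ Ω₂ ∧ Ω₁ ≠ Ω₃ ∧ Ω₂ ≠ Ω₃ ∧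
      (IsNodalDomain w Ω₁ ∧ SimplyConnectedSpace Ω₁ ∧ Ω₁ ⊆ halfSphere y) ∧
      (IsNodalDomain w Ω₂ ∧ SimplyConnectedSpace Ω₂ ∧ Ω₂ ⊆ halfSphere y) ∧
      (IsNodalDomain w Ω₃ ∧ SimplyConnectedSpace Ω₃ ∧ Ω₃ ⊆ halfSphere y) := by
  rintro ⟨Ω₁, Ω₂, Ω₃, h12, h13, h23, ⟨n1, s1, k1⟩, ⟨n2, s2, k2⟩, n3, s3, k3⟩
  obtain ⟨b, rfl⟩ := exists_orthonormalBasis_last hy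
  obtain ⟨b1, o1, a1⟩ := hu.exists_planar_domain b (by linarith) hw n1 s1 k1
  obtain ⟨b2, o2, a2⟩ := hu.exists_planar_domain b (by linarith) hw n2 s2 k2
  obtain ⟨b3, o3, a3⟩ := hu.exists_planar_domain b (by linarith) hw n3 s3 k3
  have d12 := (n1.disjoint n2 h12).preimage (nstereo b)
  have d13 := (n1.disjoint n3 h13).preimage (nstereo b)
  have d23 := (n2.disjoint n3 h23).preimage (nstereo b)
  set O₁ := nstereo b ⁻¹' Ω₁
  set O₂ := nstereo b ⁻¹' Ω₂
  set O₃ := nstereo b ⁻¹' Ω₃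
  have L := hu.lpair b (by linarith)
  set T := etot (stereoSol u b 1) (stereoSol u b (-1)) with hT
  have ci : IntegrableOn T (Metric.closedBall 0 1) :=
    (continuous_of_smAt fun z => L.smT z).continuousOn.integrableOn_compact
      (isCompact_closedBall 0 1)
  have hi : ∀ {O : Set ℂ}, O ⊆ Metric.ball 0 1 → IntegrableOn T O := fun h =>
    ci.mono_set (h.trans Metric.ball_subset_closedBall)
  have hU : O₁ ∪ (O₂ ∪ O₃) ⊆ Metric.ball 0 1 :=
    Set.union_subset b1 (Set.union_subset b2 b3)
  have e1 : ∫ z in O₁ ∪ (O₂ ∪ O₃), T z = (∫ z in O₁, T z) + ((∫ z in O₂, T z) + ∫ z in O₃, T z) := by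
    rw [setIntegral_union (d12.union_right d13) (o2.union o3).measurableSet (hi b1)
      (hi (Set.union_subset b2 b3)), setIntegral_union d23 o3.measurableSet (hi b2) (hi b3)]
  have e2 : ∫ z in O₁ ∪ (O₂ ∪ O₃), T z ≤ ∫ z in pDisc, T z := by
    refine setIntegral_mono_set (ci.mono_set pDisc_subset)
      (.of_forall fun z => by simp only [hT, etot]; positivity) ?_
    have h0 : ∀ᵐ z : ℂ, z ≠ 0 := by simp [ae_iff]
    filter_upwards [h0] with z hz hzU
    exact subset_pDisc ⟨hU hzU, hz⟩
  rw [hu.integral_etot b] at e2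
  nlinarith [pi_pos]
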